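/- (Theorem 5.2: intrinsic Harnack inequality of forward, backward and elliptic type.) Let d ≥ 3 and 0 < m < 1, and let p satisfy p = 1 if m > m_c and p > p_c if m ≤ m_c, where m_c = (d−2)/d, p_c = d(1−m)/2 and ϑ_p = 1/(2p − d(1−m)). There exist positive constants h₁ and h₂ depending only on m, d and p such that the following holds. Let u be a classical solution of the FDE ∂ₜu = Δ(u^m) on (0,T) × Ω taking nonnegative initial data u₀ ∈ L^p_loc(Ω) and having finite extinction time T, and let x₀ ∈ Ω, R > 0 with dist(x₀, ∂Ω) ≥ 6R. For t₀ ∈ [0, T) set t_*(t₀) = h₂ R^{2−d(1−m)} ‖u(t₀,·)‖_{L¹(B_R(x₀))}^{1−m} (with u(0,·) = u₀), and assume ‖u(t₀,·)‖_{L¹(B_R(x₀))} > 0. Then t₀ + t_*(t₀) ≤ T, and for every ε ∈ (0,1] and all t, ϑ ≥ 0 with t₀ + ε t_*(t₀) < t − ϑ and t + ϑ < t₀ + t_*(t₀), both inf over x ∈ B_R(x₀) of u(t+ϑ, x) and inf over x ∈ B_R(x₀) of u(t−ϑ, x) are at least h₁ ε^{2pϑ_p/(1−m)} ( ‖u(t₀,·)‖_{L¹(B_R(x₀))}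 R^{d/p} / ( ‖u(t₀,·)‖_{L^p(B_R(x₀))} R^d ) )^{2pϑ_p + 1/m} · u(t, x₀). -/

import Mathlib

open MeasureTheory Metric Set Real

/-- The spatial Laplacian of `f : ℝ^d → ℝ` at a point, as the sum of second
coordinate derivatives. -/
noncomputable def spaceLap {d : ℕ} (f : EuclideanSpace ℝ (Fin d) → ℝ)
    (x : EuclideanSpace ℝ (Fin d)) : ℝ :=
  ∑ i : Fin d, fderiv ℝ (fun y => fderiv ℝ f y (EuclideanSpace.single i 1)) x
    (EuclideanSpace.single i 1)

/-- `u` is a classical solution of the fast diffusion equation `∂ₜ u = Δ(u^m)`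
on the space-time set `Q`: it is positive and smooth on `Q` and satisfies the
equation pointwise on `Q`. -/
def IsFDESol {d : ℕ} (m : ℝ) (Q : Set (ℝ × EuclideanSpace ℝ (Fin d)))
    (u : ℝ → EuclideanSpace ℝ (Fin d) → ℝ) : Prop :=
  (∀ p ∈ Q, 0 < u p.1 p.2) ∧
  ContDiffOn ℝ (⊤ : ℕ∞) (fun p : ℝ × EuclideanSpace ℝ (Fin d) => u p.1 p.2) Q ∧
  ∀ p ∈ Q, deriv (fun s => u s p.2) p.1 = spaceLap (fun y => u p.1 y ^ m) p.2

/-- `u` (defined for `0 < t < T` on `Ω`) takes the initial data `u₀`: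
it extends continuously to `{0} × Ω` with value `u₀` there. -/
def TakesInit {d : ℕ} (T : ℝ) (Ω : Set (EuclideanSpace ℝ (Fin d)))
    (u : ℝ → EuclideanSpace ℝ (Fin d) → ℝ) (u₀ : EuclideanSpace ℝ (Fin d) → ℝ) : Prop :=
  ContinuousOn (fun p : ℝ × EuclideanSpace ℝ (Fin d) => u p.1 p.2) (Ico 0 T ×ˢ Ω) ∧
  ∀ x ∈ Ω, u 0 x = u₀ x

/-- `u` has finite extinction time `T` on `Ω`: it extends continuously to
`{T} × Ω` with value `0` there, while `u(t,·)` is not identically zero for `0 < t < T`. -/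
def ExtinctAt {d : ℕ} (T : ℝ) (Ω : Set (EuclideanSpace ℝ (Fin d)))
    (u : ℝ → EuclideanSpace ℝ (Fin d) → ℝ) : Prop :=
  ContinuousOn (fun p : ℝ × EuclideanSpace ℝ (Fin d) => u p.1 p.2) (Ioc 0 T ×ˢ Ω) ∧
  (∀ x ∈ Ω, u T x = 0) ∧
  ∀ t ∈ Ioo 0 T, ∃ x ∈ Ω, u t x ≠ 0

section
open Filter Topology
open Finset (sum_congr mul_sum sum_le_sum card_univ sum_const sum_sub_distrib sum_nonneg sum_add_distrib)
namespace FDE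
theorem mll {a b c : ℝ} (h : b ≤ c) (a0 : 0 ≤ a) : a * b ≤ a * c := mul_le_mul_of_nonneg_left h a0
theorem mlr {a b c : ℝ} (h : b ≤ c) (a0 : 0 ≤ a) : b * a ≤ c * a := mul_le_mul_of_nonneg_right h a0
end FDE
namespace FDE
/-- discrete Laplacian on the lattice of mesh `1/n`. -/
noncomputable def lap {d : ℕ} (n : ℕ) (f : (Fin d → ℤ) → ℝ) (x : Fin d → ℤ) : ℝ :=
  (n : ℝ) ^ 2 * ∑ i : Fin d, (f (x + Pi.single i 1) + f (x - Pi.single i 1) - 2 * f x)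
noncomputable def nsq {d : ℕ} (n : ℕ) (x : Fin d → ℤ) : ℝ := ∑ i : Fin d, ((x i : ℝ) / n) ^ 2
noncomputable def S {d : ℕ} (n : ℕ) : Finset (Fin d → ℤ) :=
  Fintype.piFinset fun _ => Finset.Icc (-(5 * n : ℤ)) (5 * n)
noncomputable def I {d : ℕ} (n : ℕ) (f : (Fin d → ℤ) → ℝ) : ℝ := (∑ x ∈ S n, f x) / (n : ℝ) ^ d
variable {d : ℕ}
theorem nsq_nonneg (n : ℕ) (x : Fin d → ℤ) : 0 ≤ nsq n x := sum_nonneg fun _ _ => sq_nonneg _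
theorem nsq_add_single (n : ℕ) (x : Fin d → ℤ) (i : Fin d) :
    nsq n (x + Pi.single i 1) = nsq n x + (2 * (x i / n) * (1 / n) + (1 / n : ℝ) ^ 2) := by
  unfold nsq
  rw [← Finset.add_sum_erase _ _ (Finset.mem_univ i), ← Finset.add_sum_erase (a := i) Finset.univ (fun j => ((x j : ℝ) / n) ^ 2) (Finset.mem_univ i)]
  have : ∑ j ∈ Finset.univ.erase i, (((x + Pi.single i 1 : Fin d → ℤ) j : ℤ) / n : ℝ) ^ 2
      = ∑ j ∈ Finset.univ.erase i, ((x j : ℝ) / n) ^ 2 := by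
    refine sum_congr rfl fun j hj => ?_
    rw [Pi.add_apply, Pi.single_eq_of_ne (Finset.ne_of_mem_erase hj), add_zero]
  rw [this, Pi.add_apply, Pi.single_eq_same]
  push_cast
  ring
theorem nsq_sub_single (n : ℕ) (x : Fin d → ℤ) (i : Fin d) :
    nsq n (x - Pi.single i 1) = nsq n x + (-(2 * (x i / n) * (1 / n)) + (1 / n : ℝ) ^ 2) := by
  unfold nsq
  rw [← Finset.add_sum_erase _ _ (Finset.mem_univ i), ← Finset.add_sum_erase (a := i) Finset.univ (fun j => ((x j : ℝ) / n) ^ 2) (Finset.mem_univ i)]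
  have : ∑ j ∈ Finset.univ.erase i, (((x - Pi.single i 1 : Fin d → ℤ) j : ℤ) / n : ℝ) ^ 2
      = ∑ j ∈ Finset.univ.erase i, ((x j : ℝ) / n) ^ 2 := by
    refine sum_congr rfl fun j hj => ?_
    rw [Pi.sub_apply, Pi.single_eq_of_ne (Finset.ne_of_mem_erase hj), sub_zero]
  rw [this, Pi.sub_apply, Pi.single_eq_same]
  push_cast
  ring
theorem coord_sq_le (n : ℕ) (x : Fin d → ℤ) (i : Fin d) : ((x i : ℝ) / n) ^ 2 ≤ nsq n x :=
  Finset.single_le_sum (f := fun i => ((x i : ℝ) / n) ^ 2) (fun _ _ => sq_nonneg _) (Finset.mem_univ i)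
theorem abs_coord_le {n : ℕ} {x : Fin d → ℤ} {r : ℝ} (hr : 0 ≤ r) (h : nsq n x ≤ r ^ 2) (i : Fin d) :
    |(x i : ℝ) / n| ≤ r := abs_le_of_sq_le_sq ((coord_sq_le n x i).trans h) hr
theorem mem_S {n : ℕ} (hn : 1 ≤ n) {x : Fin d → ℤ} (h : nsq n x ≤ 25) : x ∈ S n := by
  have hn' : (0 : ℝ) < n := by exact_mod_cast hn
  refine Fintype.mem_piFinset.2 fun i => ?_
  have := abs_coord_le (by norm_num : (0:ℝ) ≤ 5) (by linarith : nsq n x ≤ 5 ^ 2) i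
  rw [abs_div, abs_of_pos hn', div_le_iff₀ hn', abs_le] at this
  rw [Finset.mem_Icc]
  constructor
  · have := this.1; rw [← neg_mul] at *; exact_mod_cast (by simpa using this : (-5 : ℝ) * n ≤ x i)
  · exact_mod_cast this.2
theorem nsq_nbr_le {n : ℕ} (hn : 1 ≤ n) {x : Fin d → ℤ} (h : nsq n x ≤ 16) (i : Fin d) :
    nsq n (x + Pi.single i 1) ≤ 25 ∧ nsq n (x - Pi.single i 1) ≤ 25 := by
  have hn' : (1 : ℝ) ≤ n := by exact_mod_cast hn
  have h1 : (1 / n : ℝ) ≤ 1 := by rw [div_le_one (by linarith)]; exact hn'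
  have h0 : (0 : ℝ) ≤ 1 / n := by positivity
  have := abs_le.1 (abs_coord_le (by norm_num : (0:ℝ) ≤ 4) (by linarith : nsq n x ≤ 4 ^ 2) i)
  rw [nsq_add_single, nsq_sub_single]
  constructor <;> nlinarith [mul_nonneg h0 (sub_nonneg.2 h1), mul_nonneg h0 (sub_nonneg.2 this.2), mul_nonneg h0 (by linarith [this.1] : (0:ℝ) ≤ x i / n + 4)]
theorem sum_shift (T : Finset (Fin d → ℤ)) (g : (Fin d → ℤ) → ℝ) (e : Fin d → ℤ)
    (h : ∀ y, g y ≠ 0 → y ∈ T ∧ y - e ∈ T) : ∑ x ∈ T, g (x + e) = ∑ x ∈ T, g x := by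
  rw [← finsum_eq_sum_of_support_subset g (s := T) (fun y hy => (h y hy).1),
    ← finsum_eq_sum_of_support_subset (fun x => g (x + e)) (s := T)]
  · exact finsum_comp_equiv (Equiv.addRight e) (f := g)
  · intro y hy
    have := (h _ hy).2
    simpa using this
theorem sbp {n : ℕ} (hn : 1 ≤ n) (f ψ : (Fin d → ℤ) → ℝ) (h : ∀ x, ψ x ≠ 0 → nsq n x ≤ 16) :
    I n (fun x => f x * lap n ψ x) = I n (fun x => ψ x * lap n f x) := by
  unfold I lap
  congr 1
  have key : ∀ i : Fin d, ∑ x ∈ S n, f x * (ψ (x + Pi.single i 1) + ψ (x - Pi.single i 1) - 2 * ψ x)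
      = ∑ x ∈ S n, ψ x * (f (x + Pi.single i 1) + f (x - Pi.single i 1) - 2 * f x) := by
    intro i
    have h1 := sum_shift (S n) (fun y => f (y - Pi.single i 1) * ψ y) (Pi.single i 1) (by
      intro y hy
      have hy' := h y (right_ne_zero_of_mul hy)
      exact ⟨mem_S hn (hy'.trans (by norm_num)), mem_S hn (nsq_nbr_le hn hy' i).2⟩)
    have h2 := sum_shift (S n) (fun y => f (y + Pi.single i 1) * ψ y) (-Pi.single i 1) (by
      intro y hy
      have hy' := h y (right_ne_zero_of_mul hy)
      refine ⟨mem_S hn (hy'.trans (by norm_num)), ?_⟩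
      rw [sub_neg_eq_add]
      exact mem_S hn (nsq_nbr_le hn hy' i).1)
    simp only [add_sub_cancel_right, neg_add_cancel_right, ← sub_eq_add_neg, sub_add_cancel] at h1 h2
    have e1 : ∑ x ∈ S n, f x * (ψ (x + Pi.single i 1) + ψ (x - Pi.single i 1) - 2 * ψ x)
      = ∑ x ∈ S n, f x * ψ (x + Pi.single i 1) + ∑ x ∈ S n, f x * ψ (x - Pi.single i 1)
        - ∑ x ∈ S n, 2 * f x * ψ x := by
      rw [← sum_add_distrib, ← sum_sub_distrib]
      exact sum_congr rfl fun x _ => by ring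
    rw [e1, h1, h2, ← sum_add_distrib, ← sum_sub_distrib]
    exact sum_congr rfl fun x _ => by ring
  calc ∑ x ∈ S n, f x * ((n:ℝ) ^ 2 * ∑ i : Fin d, (ψ (x + Pi.single i 1) + ψ (x - Pi.single i 1) - 2 * ψ x))
      = (n:ℝ)^2 * ∑ i : Fin d, ∑ x ∈ S n, f x * (ψ (x + Pi.single i 1) + ψ (x - Pi.single i 1) - 2 * ψ x) := by
        rw [Finset.sum_comm, mul_sum]
        refine sum_congr rfl fun x _ => ?_
        rw [← mul_sum]; ring
    _ = (n:ℝ)^2 * ∑ i : Fin d, ∑ x ∈ S n, ψ x * (f (x + Pi.single i 1) + f (x - Pi.single i 1) - 2 * f x) := by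
        rw [sum_congr rfl fun i _ => key i]
    _ = _ := by
        rw [Finset.sum_comm, mul_sum]
        refine sum_congr rfl fun x _ => ?_
        rw [← mul_sum]; ring
theorem I_mono {n : ℕ} {f g : (Fin d → ℤ) → ℝ} (h : ∀ x ∈ S n, f x ≤ g x) : I n f ≤ I n g :=
  div_le_div_of_nonneg_right (sum_le_sum h) (by positivity)
theorem I_nonneg {n : ℕ} {f : (Fin d → ℤ) → ℝ} (h : ∀ x ∈ S n, 0 ≤ f x) : 0 ≤ I n f :=
  div_nonneg (sum_nonneg h) (by positivity)
theorem I_add (n : ℕ) (f g : (Fin d → ℤ) → ℝ) : I n (fun x => f x + g x) = I n f + I n g := by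
  unfold I; rw [sum_add_distrib, add_div]
theorem I_sub (n : ℕ) (f g : (Fin d → ℤ) → ℝ) : I n (fun x => f x - g x) = I n f - I n g := by
  unfold I; rw [sum_sub_distrib, sub_div]
theorem I_mul (n : ℕ) (c : ℝ) (f : (Fin d → ℤ) → ℝ) : I n (fun x => c * f x) = c * I n f := by
  unfold I; rw [← mul_sum, mul_div_assoc]
theorem I_one_le {n : ℕ} (hn : 1 ≤ n) : I n (fun _ : Fin d → ℤ => (1:ℝ)) ≤ 11 ^ d := by
  unfold I S
  have hn' : (1 : ℝ) ≤ n := by exact_mod_cast hn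
  rw [sum_const, Fintype.card_piFinset, nsmul_eq_mul, mul_one]
  simp only [Int.card_Icc, Finset.prod_const, card_univ, Fintype.card_fin]
  rw [div_le_iff₀ (by positivity), ← mul_pow]
  have : (5 * (n:ℤ) + 1 - -(5 * (n:ℤ))).toNat = 10 * n + 1 := by omega
  rw [this]
  push_cast
  exact pow_le_pow_left₀ (by positivity) (by linarith) _
theorem I_const_le {n : ℕ} (hn : 1 ≤ n) {c : ℝ} (hc : 0 ≤ c) : I n (fun _ : Fin d → ℤ => c) ≤ c * 11 ^ d := by
  have := I_mul n c (fun _ : Fin d → ℤ => (1:ℝ))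
  simp only [mul_one] at this
  rw [this]
  exact mll (I_one_le hn) hc
theorem lap_le_of {n : ℕ} {f g : (Fin d → ℤ) → ℝ} {x : Fin d → ℤ} (h : ∀ y, f y ≤ g y) (hx : f x = g x) :
    lap n f x ≤ lap n g x := by
  unfold lap
  refine mll (sum_le_sum fun i _ => ?_) (by positivity)
  have := h (x + Pi.single i 1); have := h (x - Pi.single i 1); linarith
theorem lap_smul (n : ℕ) (c : ℝ) (f : (Fin d → ℤ) → ℝ) (x : Fin d → ℤ) :
    lap n (fun y => c * f y) x = c * lap n f x := by
  unfold lap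
  simp only [mul_sum]
  exact sum_congr rfl fun i _ => by ring
theorem lap_const (n : ℕ) (c : ℝ) (x : Fin d → ℤ) : lap n (fun _ => c) x = 0 := by
  unfold lap; rw [Finset.sum_eq_zero, mul_zero]; intro i _; ring
theorem lap_sub (n : ℕ) (f g : (Fin d → ℤ) → ℝ) (x : Fin d → ℤ) :
    lap n (fun y => f y - g y) x = lap n f x - lap n g x := by
  unfold lap
  rw [← mul_sub, ← sum_sub_distrib]
  congr 1
  exact sum_congr rfl fun i _ => by ring
theorem lap_sum {ι : Type*} (n : ℕ) (s : Finset ι) (c : ι → ℝ) (f : ι → (Fin d → ℤ) → ℝ) (x : Fin d → ℤ) :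
    lap n (fun y => ∑ j ∈ s, c j * f j y) x = ∑ j ∈ s, c j * lap n (f j) x := by
  unfold lap
  simp only [mul_sum]
  rw [Finset.sum_comm]
  refine sum_congr rfl fun i _ => ?_
  rw [← sum_add_distrib, ← sum_sub_distrib, mul_sum]
  exact sum_congr rfl fun i _ => by ring
/-- L¹ comparison. -/
theorem kato {n : ℕ} (hn : 1 ≤ n) {m τ e : ℝ} (hm : 0 < m) (hτ : 0 ≤ τ) (he : 0 ≤ e)
    {V Y V' Y' : (Fin d → ℤ) → ℝ} (hV : ∀ x, 0 ≤ V x) (hY : ∀ x, 0 ≤ Y x)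
    (hV0 : ∀ x, 16 ≤ nsq n x → V x = 0)
    (h1 : ∀ x, nsq n x < 16 → V x ≤ V' x + τ * lap n (fun y => V y ^ m) x)
    (h2 : ∀ x, nsq n x < 16 → Y' x + τ * (lap n (fun y => Y y ^ m) x - e) ≤ Y x) :
    I n (fun x => max (V x - Y x) 0) ≤ I n (fun x => max (V' x - Y' x) 0) + τ * e * 11 ^ d := by
  set z : (Fin d → ℤ) → ℝ := fun y => V y ^ m - Y y ^ m with hz
  set zp : (Fin d → ℤ) → ℝ := fun y => max (z y) 0 with hzp
  have hlz : ∀ x, lap n z x = lap n (fun y => V y ^ m) x - lap n (fun y => Y y ^ m) x := fun x => lap_sub _ _ _ _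
  have h0 : ∀ x, V x ≤ Y x → 0 ≤ lap n zp x := by
    intro x hx
    have := lap_le_of (n := n) (f := fun _ => (0:ℝ)) (g := zp) (x := x) (fun y => le_max_right _ _) (by
      have := rpow_le_rpow (hV x) hx hm.le
      simp only [hzp, hz]; rw [max_eq_right]; linarith)
    rwa [lap_const] at this
  have pt : ∀ x ∈ S n, max (V x - Y x) 0 ≤ (max (V' x - Y' x) 0 + τ * e) + τ * (1 * lap n zp x) := by
    intro x _
    have hτe : 0 ≤ τ * e := mul_nonneg hτ he
    have hmx := le_max_right (V' x - Y' x) 0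
    have hmx' := le_max_left (V' x - Y' x) 0
    rcases le_or_gt (V x) (Y x) with hx | hx
    · rw [max_eq_right (by linarith)]
      have := mul_nonneg hτ (h0 x hx); linarith
    · have hD : nsq n x < 16 := by
        by_contra hc
        have := hV0 x (not_lt.1 hc); have := hY x; linarith
      rw [max_eq_left (by linarith)]
      have hl : lap n z x ≤ lap n zp x := lap_le_of (fun y => le_max_left _ _) (by
        have := rpow_le_rpow (hY x) hx.le hm.le
        simp only [hzp, hz]; rw [max_eq_left]; linarith)
      have a1 := h1 x hD; have a2 := h2 x hD
      have := mll hl hτ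
      rw [hlz] at this
      nlinarith
  have hsb := sbp hn (fun _ => 1) zp (by
    intro x hx
    by_contra hc
    apply hx
    simp only [hzp, hz]
    rw [hV0 x (not_le.1 hc).le, Real.zero_rpow hm.ne']
    have := rpow_nonneg (hY x) m
    rw [max_eq_right]; linarith)
  have hz0 : I n (fun x => zp x * lap n (fun _ => 1) x) = 0 := by
    simp [I, lap_const]
  have := I_mono pt
  rw [I_add, I_add, I_mul n τ (fun x => 1 * lap n zp x), hsb, hz0, mul_zero, add_zero] at this
  exact this.trans (add_le_add le_rfl (I_const_le hn (mul_nonneg hτ he)))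
theorem le_of_I_le_zero {n : ℕ} (hn : 1 ≤ n) {f g : (Fin d → ℤ) → ℝ} 
    (h : I n (fun x => max (f x - g x) 0) ≤ 0) {x : Fin d → ℤ} (hx : x ∈ S n) : f x ≤ g x := by
  have hn' : (0 : ℝ) < n := by exact_mod_cast hn
  unfold I at h
  have h' : ∑ x ∈ S n, max (f x - g x) 0 ≤ 0 := by
    by_contra hc
    exact absurd h (not_le.2 (div_pos (not_le.1 hc) (by positivity)))
  have := Finset.single_le_sum (f := fun x => max (f x - g x) 0) (fun _ _ => le_max_right _ _) hx
  have := le_max_left (f x - g x) 0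
  simp only at *
  linarith
/-- exact comparison -/
theorem comparison {n : ℕ} (hn : 1 ≤ n) {m τ : ℝ} (hm : 0 < m) (hτ : 0 ≤ τ)
    {V Y V' Y' : (Fin d → ℤ) → ℝ} (hV : ∀ x, 0 ≤ V x) (hY : ∀ x, 0 ≤ Y x)
    (hV0 : ∀ x, 16 ≤ nsq n x → V x = 0)
    (h1 : ∀ x, nsq n x < 16 → V x ≤ V' x + τ * lap n (fun y => V y ^ m) x)
    (h2 : ∀ x, nsq n x < 16 → Y' x + τ * lap n (fun y => Y y ^ m) x ≤ Y x)
    (h3 : ∀ x, V' x ≤ Y' x) (x : Fin d → ℤ) : V x ≤ Y x := by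
  rcases lt_or_ge (nsq n x) 16 with hx | hx
  · have := kato hn hm hτ le_rfl hV hY hV0 h1 (fun x hx => by rw [sub_zero]; exact h2 x hx)
    have e : I n (fun x => max (V' x - Y' x) 0) = 0 := by
      unfold I
      rw [Finset.sum_eq_zero, zero_div]
      intro x _
      exact max_eq_right (by linarith [h3 x])
    rw [e] at this
    exact le_of_I_le_zero hn (by simpa using this) (mem_S hn (by linarith))
  · rw [hV0 x hx]; exact hY x
end FDE
namespace FDE
theorem conv_tangent {x y r : ℝ} (hx : 0 ≤ x) (hy : 0 ≤ y) (hr : 1 ≤ r) :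
    y ^ r + r * y ^ (r - 1) * (x - y) ≤ x ^ r := by
  rcases hy.eq_or_lt with rfl | hy
  · rw [Real.zero_rpow (by linarith)]
    rcases hr.eq_or_lt with rfl | hr
    · simp
    · rw [Real.zero_rpow (by linarith)]
      have := rpow_nonneg hx r
      simpa using this
  · have h := one_add_mul_self_le_rpow_one_add (s := x / y - 1) (by have := div_nonneg hx hy.le; linarith) hr
    have e : 1 + (x / y - 1) = x / y := by ring
    rw [e, Real.div_rpow hx hy.le, le_div_iff₀ (by positivity)] at h
    rw [rpow_sub_one hy.ne']
    refine le_trans (le_of_eq ?_) h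
    field_simp
theorem conc_tangent {m l w : ℝ} (hm : 0 ≤ m) (hm1 : m ≤ 1) (hl : 0 < l) (hw : 0 ≤ w) :
    w ^ m ≤ l ^ m + m * l ^ (m - 1) * (w - l) := by
  have h := rpow_one_add_le_one_add_mul_self (s := w / l - 1) (by have := div_nonneg hw hl.le; linarith) hm hm1
  have e : 1 + (w / l - 1) = w / l := by ring
  rw [e, Real.div_rpow hw hl.le, div_le_iff₀ (by positivity)] at h
  rw [rpow_sub_one hl.ne']
  refine le_trans h (le_of_eq ?_)
  field_simp
theorem neg_tangent {x y s : ℝ} (hx : 0 < x) (hy : 0 < y) (hs : 0 ≤ s) :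
    y ^ (-s) - s * y ^ (-s - 1) * (x - y) ≤ x ^ (-s) := by
  have ht : 0 < x / y := by positivity
  have h : 1 - s * (x / y - 1) ≤ (x / y) ^ (-s) := by
    rw [rpow_def_of_pos ht]
    have h1 := Real.log_le_sub_one_of_pos ht
    have h2 := Real.add_one_le_exp (Real.log (x / y) * -s)
    nlinarith
  rw [Real.div_rpow hx.le hy.le, le_div_iff₀ (by positivity)] at h
  rw [rpow_sub_one hy.ne']
  refine le_trans (le_of_eq ?_) h
  field_simp
theorem second_diff {f f' f'' : ℝ → ℝ} {x z : ℝ} (hz : 0 < z)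
    (h1 : ∀ t ∈ Icc (x - z) (x + z), HasDerivAt f (f' t) t)
    (h2 : ∀ t ∈ Icc (x - z) (x + z), HasDerivAt f' (f'' t) t) :
    ∃ ξ ∈ Icc (x - z) (x + z), f (x + z) + f (x - z) - 2 * f x = z ^ 2 * f'' ξ := by
  have hg : ∀ t ∈ Icc 0 z, HasDerivAt (fun t => f (x + t) + f (x - t)) (f' (x + t) - f' (x - t)) t := by
    intro t ht
    have a1 := (h1 (x + t) ⟨by linarith [ht.1, ht.2], by linarith [ht.1, ht.2]⟩).comp_const_add x t
    have a2 := (h1 (x - t) ⟨by linarith [ht.1, ht.2], by linarith [ht.1, ht.2]⟩).comp_const_sub x t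
    exact (a1.add a2).congr_deriv (by ring)
  obtain ⟨c, hc, h⟩ := exists_ratio_hasDerivAt_eq_ratio_slope (fun t => f (x + t) + f (x - t))
    (fun t => f' (x + t) - f' (x - t)) hz (fun t ht => (hg t ht).continuousAt.continuousWithinAt)
    (fun t ht => hg t (Ioo_subset_Icc_self ht)) (fun t => t ^ 2) (fun t => 2 * t)
    (by fun_prop) (fun t _ => by simpa using hasDerivAt_pow 2 t)
  obtain ⟨ξ, hξ, h'⟩ := exists_hasDerivAt_eq_slope f' f'' (a := x - c) (b := x + c) (by linarith [hc.1])
    (fun t ht => (h2 t ⟨by linarith [ht.1, hc.2], by linarith [ht.2, hc.2]⟩).continuousAt.continuousWithinAt)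
    (fun t ht => h2 t ⟨by linarith [ht.1, hc.2], by linarith [ht.2, hc.2]⟩)
  refine ⟨ξ, ⟨by linarith [hξ.1, hc.2], by linarith [hξ.2, hc.2]⟩, ?_⟩
  have hc0 := hc.1
  rw [eq_div_iff (by linarith)] at h'
  simp only [add_zero, sub_zero] at h
  have : (f (x + z) + f (x - z) - 2 * f x) * (2 * c) = (z ^ 2 * f'' ξ) * (2 * c) := by
    rw [show f'' ξ = f'' ξ from rfl]
    linear_combination -h - z ^ 2 * h'
  exact mul_right_cancel₀ (by positivity) this
theorem pow_taylor_aux {x s M : ℝ} (hx : 0 ≤ x) (hs : 0 ≤ s) (hxM : x ≤ M) (hsM : s ≤ M) (b : ℕ) :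
    x ^ (b + 2) ≤ s ^ (b + 2) + (b + 2) * s ^ (b + 1) * (x - s) + (b + 2) ^ 2 * (x - s) ^ 2 * M ^ b := by
  have hM : 0 ≤ M := hx.trans hxM
  induction b with
  | zero => norm_num; nlinarith [sq_nonneg (x - s)]
  | succ b ih =>
    have h1 := mll ih hx
    have h2 : s ^ (b + 1) ≤ M ^ (b + 1) := pow_le_pow_left₀ hs hsM _
    have h3 : x * ((b + 2) ^ 2 * (x - s) ^ 2 * M ^ b) ≤ M * ((b + 2) ^ 2 * (x - s) ^ 2 * M ^ b) :=
      mlr hxM (by positivity)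
    have h4 := mll h2 (by positivity : 0 ≤ (b + 2) * (x - s) ^ 2)
    have e1 : x ^ (b + 1 + 2) = x * x ^ (b + 2) := by ring
    have h5 : 0 ≤ (x - s) ^ 2 * M ^ (b + 1) := by positivity
    push_cast
    rw [e1]
    calc _ ≤ _ := h1
      _ = s ^ (b + 3) + (b + 3) * s ^ (b + 2) * (x - s) + (b + 2) * (x - s) ^ 2 * s ^ (b + 1)
          + x * ((b + 2) ^ 2 * (x - s) ^ 2 * M ^ b) := by ring
      _ ≤ s ^ (b + 3) + (b + 3) * s ^ (b + 2) * (x - s) + (b + 2) * (x - s) ^ 2 * M ^ (b + 1)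
          + M * ((b + 2) ^ 2 * (x - s) ^ 2 * M ^ b) := by linarith
      _ ≤ _ := by
        have : 0 ≤ (x - s) ^ 2 * M ^ (b + 1) * (b + 3) := by positivity
        ring_nf at this ⊢
        linarith
theorem pow_taylor {x s M : ℝ} (hxM : max x 0 ≤ M) (hsM : max s 0 ≤ M) (b : ℕ) :
    max x 0 ^ (b + 2) ≤ max s 0 ^ (b + 2) + (b + 2) * max s 0 ^ (b + 1) * (x - s)
      + (b + 2) ^ 2 * (x - s) ^ 2 * M ^ b := by
  have hM : 0 ≤ M := (le_max_right _ _).trans hxM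
  rcases le_or_gt 0 s with hs | hs
  · rw [max_eq_left hs] at hsM ⊢
    rcases le_or_gt 0 x with hx | hx
    · rw [max_eq_left hx] at hxM ⊢
      exact pow_taylor_aux hx hs hxM hsM b
    · rw [max_eq_right hx.le, zero_pow (by omega)]
      have h1 : s ^ b ≤ M ^ b := pow_le_pow_left₀ hs hsM _
      have h2 : s ^ (b + 1) * (s - x) ≤ (x - s) ^ 2 * M ^ b := by
        calc s ^ (b + 1) * (s - x) = s ^ b * (s * (s - x)) := by ring
          _ ≤ M ^ b * ((s - x) * (s - x)) := by
            apply mul_le_mul h1 _ (mul_nonneg hs (by linarith)) (by positivity)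
            exact mlr (by linarith) (by linarith)
          _ = _ := by ring
      have h3 : 0 ≤ (x - s) ^ 2 * M ^ b := by positivity
      have h4 : 0 ≤ s ^ (b + 2) := by positivity
      have hb : (0:ℝ) ≤ b := by positivity
      nlinarith [mll h2 (by positivity : (0:ℝ) ≤ b + 2), mul_nonneg hb h3, mul_nonneg (mul_nonneg hb hb) h3]
  · rw [max_eq_right hs.le, zero_pow (by omega), zero_pow (by omega)]
    rcases le_or_gt 0 x with hx | hx
    · rw [max_eq_left hx] at hxM ⊢
      have h1 : x ^ b ≤ M ^ b := pow_le_pow_left₀ hx hxM _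
      have : x ^ (b + 2) ≤ (x - s) ^ 2 * M ^ b := by
        calc x ^ (b + 2) = x ^ 2 * x ^ b := by ring
          _ ≤ (x - s) ^ 2 * M ^ b := mul_le_mul (by nlinarith) h1 (by positivity) (by positivity)
      have h3 : 0 ≤ (x - s) ^ 2 * M ^ b := by positivity
      have hb : (0:ℝ) ≤ b := by positivity
      nlinarith [mul_nonneg hb h3, mul_nonneg (mul_nonneg hb hb) h3]
    · rw [max_eq_right hx.le, zero_pow (by omega)]
      have : 0 ≤ ((b:ℝ) + 2) ^ 2 * (x - s) ^ 2 * M ^ b := by positivity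
      linarith
theorem pow_tangent (x s : ℝ) (b : ℕ) :
    max s 0 ^ (b + 2) + (b + 2) * max s 0 ^ (b + 1) * (x - s) ≤ max x 0 ^ (b + 2) := by
  have h := conv_tangent (le_max_right x 0) (le_max_right s 0) (r := ((b + 2 : ℕ) : ℝ)) (by push_cast; linarith [(by positivity : (0:ℝ) ≤ b)])
  rw [show ((b + 2 : ℕ) : ℝ) - 1 = ((b + 1 : ℕ) : ℝ) by push_cast; ring, rpow_natCast, rpow_natCast, rpow_natCast] at h
  refine le_trans ?_ h
  push_cast
  refine add_le_add le_rfl ?_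
  rcases le_or_gt 0 s with hs | hs
  · rw [max_eq_left hs]
    exact mll (by linarith [le_max_left x 0]) (by positivity)
  · rw [max_eq_right hs.le, zero_pow (by omega)]; simp
theorem gsum_hasDeriv {s t : ℝ} (ht : |t| < 1) :
    HasDerivAt (fun z : ℝ => (1 + z) ^ (-s) + (1 - z) ^ (-s))
      (-s * ((1 + t) ^ (-s - 1) - (1 - t) ^ (-s - 1))) t := by
  rw [abs_lt] at ht
  have a1 := (((hasDerivAt_id t).const_add 1).rpow_const (p := -s) (Or.inl (by simp; linarith [ht.1])))
  have a2 := (((hasDerivAt_id t).const_sub 1).rpow_const (p := -s) (Or.inl (by simp; linarith [ht.2])))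
  exact (a1.add a2).congr_deriv (by simp; ring)
theorem gdiff_hasDeriv {s t : ℝ} (ht : |t| < 1) :
    HasDerivAt (fun z : ℝ => -s * ((1 + z) ^ (-s - 1) - (1 - z) ^ (-s - 1)))
      (s * (s + 1) * ((1 + t) ^ (-(s + 2)) + (1 - t) ^ (-(s + 2)))) t := by
  rw [abs_lt] at ht
  have a1 := (((hasDerivAt_id t).const_add 1).rpow_const (p := -s - 1) (Or.inl (by simp; linarith [ht.1])))
  have a2 := (((hasDerivAt_id t).const_sub 1).rpow_const (p := -s - 1) (Or.inl (by simp; linarith [ht.2])))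
  refine ((a1.sub a2).const_mul (-s)).congr_deriv ?_
  rw [show -s - 1 - 1 = -(s + 2) by ring]
  simp; ring
theorem gsum_ge_two {s t : ℝ} (hs : 0 ≤ s) (ht : |t| < 1) : 2 ≤ (1 + t) ^ (-s) + (1 - t) ^ (-s) := by
  rw [abs_lt] at ht
  have a1 := neg_tangent (x := 1 + t) (y := 1) (by linarith [ht.1]) one_pos hs
  have a2 := neg_tangent (x := 1 - t) (y := 1) (by linarith [ht.2]) one_pos hs
  simp only [Real.one_rpow] at a1 a2
  linarith
theorem gsum_eq {s z : ℝ} (hz : |z| < 1) : ∃ ξ, |ξ| ≤ |z| ∧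
    (1 + z) ^ (-s) + (1 - z) ^ (-s) = 2 + z ^ 2 / 2 * (s * (s + 1) * ((1 + ξ) ^ (-(s + 2)) + (1 - ξ) ^ (-(s + 2)))) := by
  rcases eq_or_ne z 0 with rfl | h0
  · exact ⟨0, le_rfl, by norm_num⟩
  · have hp : 0 < |z| := abs_pos.2 h0
    obtain ⟨ξ, hξ, h⟩ := second_diff (x := 0) hp
      (fun t ht => gsum_hasDeriv (s := s) (t := t) (lt_of_le_of_lt (abs_le.2 ⟨by linarith [ht.1], by linarith [ht.2]⟩) hz))
      (fun t ht => gdiff_hasDeriv (s := s) (t := t) (lt_of_le_of_lt (abs_le.2 ⟨by linarith [ht.1], by linarith [ht.2]⟩) hz))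
    refine ⟨ξ, abs_le.2 ⟨by linarith [hξ.1], by linarith [hξ.2]⟩, ?_⟩
    rw [sq_abs] at h
    simp only [zero_add, zero_sub, add_zero, sub_zero, Real.one_rpow, sub_neg_eq_add, ← sub_eq_add_neg] at h
    rcases abs_choice z with e | e <;> rw [e] at h
    · linarith
    · rw [sub_neg_eq_add, ← sub_eq_add_neg] at h; linarith
theorem gsum_lower {s z : ℝ} (hs : 0 ≤ s) (hz : |z| < 1) :
    2 + s * (s + 1) * z ^ 2 ≤ (1 + z) ^ (-s) + (1 - z) ^ (-s) := by
  obtain ⟨ξ, hξ, h⟩ := gsum_eq (s := s) hz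
  have := gsum_ge_two (s := s + 2) (by linarith) (lt_of_le_of_lt hξ hz)
  rw [h]
  nlinarith [mll this (by positivity : 0 ≤ z ^ 2 / 2 * (s * (s + 1)))]
theorem gsum_upper (s : ℝ) (hs : 0 ≤ s) : ∃ C, 0 ≤ C ∧ ∀ z : ℝ, |z| ≤ 1 / 2 →
    (1 + z) ^ (-s) + (1 - z) ^ (-s) ≤ 2 + s * (s + 1) * z ^ 2 + C * z ^ 4 := by
  have base : ∀ (σ z : ℝ), 0 ≤ σ → |z| ≤ 1 / 2 → (1 + z) ^ (-σ) + (1 - z) ^ (-σ) ≤ 2 * 2 ^ σ := by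
    intro σ z hσ hz
    rw [abs_le] at hz
    have e : (2:ℝ) ^ σ = (1 / 2) ^ (-σ) := by
      rw [rpow_neg (by norm_num), one_div, Real.inv_rpow (by norm_num), inv_inv]
    have a1 := rpow_le_rpow_of_nonpos (z := -σ) (by norm_num : (0:ℝ) < 1 / 2) (by linarith [hz.1] : 1 / 2 ≤ 1 + z) (by linarith)
    have a2 := rpow_le_rpow_of_nonpos (z := -σ) (by norm_num : (0:ℝ) < 1 / 2) (by linarith [hz.2] : 1 / 2 ≤ 1 - z) (by linarith)
    rw [e]; linarith
  refine ⟨s * (s + 1) / 2 * ((s + 2) * (s + 3) * 2 ^ (s + 4)), by positivity, fun z hz => ?_⟩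
  obtain ⟨ξ, hξ, h⟩ := gsum_eq (s := s) (lt_of_le_of_lt hz (by norm_num))
  obtain ⟨η, hη, h'⟩ := gsum_eq (s := s + 2) (lt_of_le_of_lt (hξ.trans hz) (by norm_num))
  have b := base (s + 2 + 2) η (by linarith) (hη.trans (hξ.trans hz))
  have hx : ξ ^ 2 ≤ z ^ 2 := sq_le_sq.2 hξ
  have : (1 + ξ) ^ (-(s + 2)) + (1 - ξ) ^ (-(s + 2)) ≤ 2 + z ^ 2 * ((s + 2) * (s + 3) * 2 ^ (s + 4)) := by
    rw [h', show s + 2 + 2 = s + 4 by ring] at *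
    have := mll b (by positivity : 0 ≤ (s + 2) * (s + 3))
    have := mul_le_mul (by linarith : ξ ^ 2 / 2 ≤ z ^ 2 / 2) this (mul_nonneg (by positivity) (by
      have := gsum_ge_two (s := s + 4) (by linarith) (lt_of_le_of_lt (hη.trans (hξ.trans hz)) (by norm_num)); linarith)) (by positivity)
    rw [show s + 2 + 1 = s + 3 by ring]
    linarith
  rw [h]
  nlinarith [mll this (by positivity : 0 ≤ z ^ 2 / 2 * (s * (s + 1)))]
end FDE
namespace FDE
variable {d : ℕ}
theorem nsq_one_add (x : Fin d → ℤ) (i : Fin d) : nsq 1 (x + Pi.single i 1) = nsq 1 x + 1 + 2 * x i := by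
  rw [nsq_add_single]; simp; ring
theorem nsq_one_sub (x : Fin d → ℤ) (i : Fin d) : nsq 1 (x - Pi.single i 1) = nsq 1 x + 1 - 2 * x i := by
  rw [nsq_sub_single]; simp; ring
theorem nsq_one (x : Fin d → ℤ) : nsq 1 x = ∑ i, (x i : ℝ) ^ 2 := by simp [nsq]
theorem gamma_lap (hd : 3 ≤ d) : ∃ κ c0 : ℝ, 36 ≤ κ ∧ 0 < c0 ∧
    (∀ y : Fin d → ℤ, lap 1 (fun y => (nsq 1 y + κ) ^ (-(((d:ℝ) - 2) / 2))) y ≤ 0) ∧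
    lap 1 (fun y : Fin d → ℤ => (nsq 1 y + κ) ^ (-(((d:ℝ) - 2) / 2))) 0 ≤ -c0 := by
  set s : ℝ := ((d:ℝ) - 2) / 2 with hs
  have hd' : (3:ℝ) ≤ d := by exact_mod_cast hd
  have hs0 : 0 < s := by rw [hs]; linarith
  obtain ⟨C, hC, hg⟩ := gsum_upper s hs0.le
  set κ : ℝ := 36 + 16 * C / (d * s) with hκ
  have hds : 0 < d * s := by positivity
  have hκ36 : 36 ≤ κ := by have : 0 ≤ 16 * C / (d * s) := by positivity
                           linarith
  have key : ∀ y : Fin d → ℤ, lap 1 (fun y => (nsq 1 y + κ) ^ (-s)) y ≤ -(d * s * ((nsq 1 y + κ + 1) ^ (-s) / (nsq 1 y + κ + 1) ^ 2)) := by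
    intro y
    set N := nsq 1 y with hN
    have hN0 : 0 ≤ N := nsq_nonneg 1 y
    set B := N + κ + 1 with hB
    have hB0 : 0 < B := by linarith
    set P := B ^ (-s) with hP
    have hP0 : 0 < P := rpow_pos_of_pos hB0 _
    have hA : P + s * (P / B) ≤ (N + κ) ^ (-s) := by
      have := neg_tangent (x := N + κ) (y := B) (by linarith) hB0 hs0.le
      rw [rpow_sub_one hB0.ne'] at this
      have e : N + κ - B = -1 := by rw [hB]; ring
      rw [e] at this; linarith
    have per : ∀ i : Fin d, (nsq 1 (y + Pi.single i 1) + κ) ^ (-s) + (nsq 1 (y - Pi.single i 1) + κ) ^ (-s) - 2 * (N + κ) ^ (-s)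
        ≤ P / B ^ 2 * ((4 * s * (s + 1) + 16 * C / B) * (y i : ℝ) ^ 2 - 2 * s * B) := by
      intro i
      set t : ℝ := (y i : ℝ) with ht
      have htN : t ^ 2 ≤ N := by have := coord_sq_le 1 y i; simpa using this
      set z := 2 * t / B with hz
      have hzB : z * B = 2 * t := by rw [hz]; field_simp
      have hz2 : |z| ≤ 1 / 2 := by
        rw [hz, abs_div, abs_of_pos hB0, div_le_iff₀ hB0, abs_le]
        constructor <;> nlinarith [sq_nonneg (t - 2), sq_nonneg (t + 2)]
      have hza := abs_le.1 hz2
      have e1 : nsq 1 (y + Pi.single i 1) + κ = B * (1 + z) := by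
        rw [nsq_one_add, mul_add, mul_comm B z, hzB, hB]; ring
      have e2 : nsq 1 (y - Pi.single i 1) + κ = B * (1 - z) := by
        rw [nsq_one_sub, mul_sub, mul_comm B z, hzB, hB]; ring
      rw [e1, e2, Real.mul_rpow hB0.le (by linarith), Real.mul_rpow hB0.le (by linarith)]
      have h1 := mll (hg z hz2) hP0.le
      have hz4 : z ^ 4 ≤ z ^ 2 * (4 / B) := by
        have : z ^ 2 ≤ 4 / B := by
          rw [hz, div_pow, div_le_div_iff₀ (by positivity) hB0]
          nlinarith
        calc z ^ 4 = z ^ 2 * z ^ 2 := by ring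
          _ ≤ _ := mll this (by positivity)
      have h2 := mll (mll hz4 hC) hP0.le
      calc _ ≤ P * (s * (s + 1) * z ^ 2 + C * (z ^ 2 * (4 / B))) - 2 * (s * (P / B)) := by
            rw [← hP]; linarith
        _ = _ := by rw [hz]; field_simp; ring
    unfold lap
    simp only [Nat.cast_one, one_pow, one_mul]
    refine (sum_le_sum fun i _ => per i).trans ?_
    rw [← mul_sum, sum_sub_distrib, ← mul_sum, ← nsq_one, ← hN]
    simp only [sum_const, card_univ, Fintype.card_fin, nsmul_eq_mul]
    have hNB : 16 * C / B * N ≤ 16 * C := by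
      rw [div_mul_eq_mul_div, div_le_iff₀ hB0]
      exact mll (by linarith) (by linarith)
    have hs4 : 4 * s * (s + 1) = 2 * (d * s) := by rw [hs]; ring
    have hκC : d * s * κ = d * s * 36 + 16 * C := by rw [hκ]; field_simp
    have : (4 * s * (s + 1) + 16 * C / B) * N - d * (2 * s * B) ≤ -(d * s) := by
      rw [hs4, hB]; rw [hB] at hNB; nlinarith
    calc _ ≤ P / B ^ 2 * -(d * s) := mll this (by positivity)
      _ = _ := by ring
  refine ⟨κ, d * s * ((κ + 1) ^ (-s) / (κ + 1) ^ 2), hκ36, by positivity, fun y => (key y).trans ?_, ?_⟩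
  · have := nsq_nonneg 1 y
    have : 0 ≤ d * s * ((nsq 1 y + κ + 1) ^ (-s) / (nsq 1 y + κ + 1) ^ 2) := by positivity
    linarith
  · have := key 0
    have e : nsq 1 (0 : Fin d → ℤ) = 0 := by simp [nsq]
    rwa [e, zero_add] at this
/-- truncation -/
noncomputable def F (δ s : ℝ) : ℝ := if s ≤ 0 then 0 else if s ≤ δ then s ^ 2 / (2 * δ) else s - δ / 2
noncomputable def F' (δ s : ℝ) : ℝ := max 0 (min 1 (s / δ))
theorem F'_nonneg (δ s : ℝ) : 0 ≤ F' δ s := le_max_left _ _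
theorem F_taylor {δ : ℝ} (hδ : 0 < δ) (s t : ℝ) : F δ t ≤ F δ s + F' δ s * (t - s) + (t - s) ^ 2 / (2 * δ) := by
  have e : F' δ s = if s ≤ 0 then 0 else if s ≤ δ then s / δ else 1 := by
    unfold F'
    split_ifs with h1 h2
    · rw [max_eq_left]; exact (min_le_right _ _).trans (div_nonpos_of_nonpos_of_nonneg h1 hδ.le)
    · rw [min_eq_right ((div_le_one hδ).2 h2), max_eq_right (div_nonneg (not_le.1 h1).le hδ.le)]
    · rw [min_eq_left ((one_le_div hδ).2 (not_le.1 h2).le), max_eq_right zero_le_one]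
  rw [e]
  unfold F
  have h2 : 0 < 2 * δ := by linarith
  split_ifs with a b c d e f g <;> rw [← sub_nonneg]
  · have : 0 ≤ (t - s) ^ 2 / (2 * δ) := by positivity
    linarith
  · have : s ^ 2 / (2 * δ) + s / δ * (t - s) + (t - s) ^ 2 / (2 * δ) - 0 = t ^ 2 / (2 * δ) := by field_simp; ring
    rw [this]; positivity
  · have : s - δ / 2 + 1 * (t - s) + (t - s) ^ 2 / (2 * δ) - 0 = ((t - s + δ) ^ 2 + 2 * δ * (s - δ)) / (2 * δ) := by field_simp; ring
    rw [this]; have := not_le.1 c; apply div_nonneg _ h2.le; nlinarith [sq_nonneg (t - s + δ)]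
  · have : 0 + 0 * (t - s) + (t - s) ^ 2 / (2 * δ) - t ^ 2 / (2 * δ) = ((-s) * (2 * t - s)) / (2 * δ) := by field_simp; ring
    rw [this]; apply div_nonneg _ h2.le; apply mul_nonneg <;> linarith [not_le.1 a]
  · have : s ^ 2 / (2 * δ) + s / δ * (t - s) + (t - s) ^ 2 / (2 * δ) - t ^ 2 / (2 * δ) = 0 := by field_simp; ring
    rw [this]
  · have : s - δ / 2 + 1 * (t - s) + (t - s) ^ 2 / (2 * δ) - t ^ 2 / (2 * δ) = ((s - δ) * (s + δ - 2 * t + (0:ℝ)) ) / (2 * δ) := by field_simp; ring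
    rw [this]; apply div_nonneg _ h2.le; apply mul_nonneg <;> linarith [not_le.1 f]
  · have : 0 + 0 * (t - s) + (t - s) ^ 2 / (2 * δ) - (t - δ / 2) = ((t - δ) ^ 2 + (-s) * (2 * t - s)) / (2 * δ) := by field_simp; ring
    rw [this]; apply div_nonneg _ h2.le; have : 0 ≤ (-s) * (2 * t - s) := by apply mul_nonneg <;> linarith
    nlinarith [sq_nonneg (t - δ)]
  · have : s ^ 2 / (2 * δ) + s / δ * (t - s) + (t - s) ^ 2 / (2 * δ) - (t - δ / 2) = ((t - δ) ^ 2) / (2 * δ) := by field_simp; ring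
    rw [this]; positivity
  · have : 0 ≤ (t - s) ^ 2 / (2 * δ) := by positivity
    linarith
theorem F_of_nonpos {δ s : ℝ} (h : s ≤ 0) : F δ s = 0 := if_pos h
theorem F_of_ge {δ s : ℝ} (hδ : 0 < δ) (h : δ ≤ s) : F δ s = s - δ / 2 := by
  unfold F
  rw [if_neg (by linarith)]
  split_ifs with h1
  · have : s = δ := le_antisymm h1 h
    subst this; field_simp; ring
  · rfl
theorem F_nonneg {δ : ℝ} (hδ : 0 < δ) (s : ℝ) : 0 ≤ F δ s := by
  unfold F; split_ifs with h1 h2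
  · rfl
  · positivity
  · linarith
theorem F_le {δ : ℝ} (hδ : 0 < δ) {s : ℝ} (hs : 0 ≤ s) : F δ s ≤ s := by
  unfold F; split_ifs with h1 h2
  · exact hs
  · rw [div_le_iff₀ (by linarith)]; nlinarith
  · linarith
end FDE
namespace FDE
variable {d : ℕ}
theorem rpow_neg_diff {x y l s : ℝ} (hl : 0 < l) (hx : l ≤ x) (hy : l ≤ y) (hs : 0 ≤ s) :
    |x ^ (-s) - y ^ (-s)| ≤ s * l ^ (-s - 1) * |x - y| := by
  have hx0 : 0 < x := hl.trans_le hx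
  have hy0 : 0 < y := hl.trans_le hy
  have a1 := neg_tangent hx0 hy0 hs
  have a2 := neg_tangent hy0 hx0 hs
  have b1 := rpow_le_rpow_of_nonpos hl hx (by linarith : -s - 1 ≤ 0)
  have b2 := rpow_le_rpow_of_nonpos hl hy (by linarith : -s - 1 ≤ 0)
  have hd := abs_nonneg (x - y)
  have c1 : s * y ^ (-s - 1) * (x - y) ≤ s * l ^ (-s - 1) * |x - y| := by
    refine (mll (le_abs_self _) (by positivity)).trans ?_
    exact mlr (mll b2 hs) hd
  have c2 : s * x ^ (-s - 1) * (y - x) ≤ s * l ^ (-s - 1) * |x - y| := by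
    rw [abs_sub_comm]
    refine (mll (le_abs_self _) (by positivity)).trans ?_
    rw [abs_sub_comm]
    exact mlr (mll b1 hs) hd
  rw [abs_le]; constructor <;> linarith
set_option maxHeartbeats 1000000 in
theorem green (hd : 3 ≤ d) : ∃ c0 C R0 : ℝ, 0 < c0 ∧ 0 < C ∧ 1 ≤ R0 ∧ ∀ R : ℝ, R0 ≤ R →
    ∃ Φ : (Fin d → ℤ) → ℝ, (∀ y, 0 ≤ Φ y) ∧ (∀ y, Φ y ≤ (nsq 1 y + 1) ^ (-(((d:ℝ) - 2) / 2))) ∧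
      (∀ y, Φ y ≠ 0 → nsq 1 y ≤ R ^ 2) ∧
      (∀ y, lap 1 Φ y ≤ (if y = 0 then -c0 else 0) + (if nsq 1 y ≤ 4 * R ^ 2 then C / R ^ d else 0)) := by
  obtain ⟨κ, c0, hκ, hc0, hG, hG0⟩ := gamma_lap hd
  set s : ℝ := ((d:ℝ) - 2) / 2 with hs
  have hd' : (3:ℝ) ≤ d := by exact_mod_cast hd
  have hs0 : 0 < s := by rw [hs]; linarith
  have h4s : 1 < (4:ℝ) ^ s := Real.one_lt_rpow (by norm_num) hs0
  set C : ℝ := 2 * d * ((s * (1 / 32) ^ (-s - 1) * 5) ^ 2 / (2 * (4 ^ s - 1))) with hC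
  have hC0 : 0 < C := by
    have : 0 < (4:ℝ) ^ s - 1 := by linarith
    rw [hC]; positivity
  refine ⟨c0, C, 4 * κ, hc0, hC0, by linarith, fun R hR => ?_⟩
  have hR0 : 0 < R := by linarith
  have hRκ : 16 * κ < R ^ 2 := by nlinarith
  set δ : ℝ := R ^ (-(2 * s)) * (4 ^ s - 1) with hδ
  have hδ0 : 0 < δ := mul_pos (rpow_pos_of_pos hR0 _) (by linarith)
  set g : ℝ → ℝ := fun A => A ^ (-s) with hg
  set c : ℝ := g (R ^ 2) with hc
  have hcR : c = R ^ (-(2 * s)) := by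
    rw [hc, hg]; simp only
    rw [← rpow_natCast, ← rpow_mul hR0.le]; congr 1; push_cast; ring
  have hcd : g (R ^ 2 / 4) = c + δ := by
    rw [hδ, hcR, hg]; simp only
    rw [Real.div_rpow (by positivity) (by norm_num), ← rpow_natCast, ← rpow_mul hR0.le,
      rpow_neg (by norm_num : (0:ℝ) ≤ 4) s]
    rw [show ((2:ℕ):ℝ) * -s = -(2 * s) by push_cast; ring, div_inv_eq_mul]; ring
  have hgm : ∀ A B : ℝ, 0 < A → A ≤ B → g B ≤ g A := fun A B hA h =>
    rpow_le_rpow_of_nonpos hA h (by linarith)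
  have hc00 : 0 < c := rpow_pos_of_pos (by positivity) _
  set A : (Fin d → ℤ) → ℝ := fun y => nsq 1 y + κ with hA
  have hAκ : ∀ y, κ ≤ A y := fun y => by have := nsq_nonneg 1 y; simp only [hA]; linarith
  have hAp : ∀ y i, A (y + Pi.single i 1) = A y + 1 + 2 * y i := fun y i => by
    simp only [hA, nsq_one_add]; ring
  have hAm : ∀ y i, A (y - Pi.single i 1) = A y + 1 - 2 * y i := fun y i => by
    simp only [hA, nsq_one_sub]; ring
  have hyi : ∀ (y : Fin d → ℤ) i, (y i : ℝ) ^ 2 ≤ A y := fun y i => by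
    have := coord_sq_le 1 y i
    simp only [Nat.cast_one, div_one] at this
    simp only [hA]; linarith
  have hyi' : ∀ (y : Fin d → ℤ) i, 1 + 2 * |(y i : ℝ)| ≤ A y / 2 := fun y i => by
    have h1 := hyi y i; have h2 := hAκ y; rw [← sq_abs] at h1
    nlinarith [sq_nonneg (|(y i : ℝ)| - 4)]
  have hnb : ∀ (y : Fin d → ℤ) i, (A y / 2 ≤ A (y + Pi.single i 1) ∧ A (y + Pi.single i 1) ≤ 3 / 2 * A y) ∧
      (A y / 2 ≤ A (y - Pi.single i 1) ∧ A (y - Pi.single i 1) ≤ 3 / 2 * A y) := fun y i => by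
    have h1 := hyi' y i
    have h2 := le_abs_self (y i : ℝ); have h3 := neg_abs_le (y i : ℝ)
    have h4 := hAκ y
    rw [hAp, hAm]
    refine ⟨⟨?_, ?_⟩, ?_, ?_⟩ <;> linarith
  set Φ : (Fin d → ℤ) → ℝ := fun y => F δ (g (A y) - c) with hΦ
  have hΦ0 : ∀ y, R ^ 2 ≤ A y → Φ y = 0 := fun y h => by
    apply F_of_nonpos; have := hgm _ _ (by positivity) h; linarith
  have hΦ1 : ∀ y, A y ≤ R ^ 2 / 4 → Φ y = g (A y) - (c + δ / 2) := fun y h => by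
    have := hgm _ _ (by have := hAκ y; linarith) h
    simp only [hΦ]; rw [F_of_ge hδ0 (by linarith)]; ring
  refine ⟨Φ, fun y => F_nonneg hδ0 _, fun y => ?_, fun y hy => ?_, fun y => ?_⟩
  · have h1 : g (A y) ≤ (nsq 1 y + 1) ^ (-s) := hgm _ _ (by have := nsq_nonneg 1 y; linarith) (by simp only [hA]; linarith)
    rcases le_or_gt 0 (g (A y) - c) with h | h
    · have := F_le hδ0 h; simp only [hΦ]; linarith
    · simp only [hΦ]; rw [F_of_nonpos h.le]
      have := nsq_nonneg 1 y; positivity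
  · by_contra hcon
    exact hy (hΦ0 y (by simp only [hA]; linarith))
  · have hCR : 0 ≤ C / R ^ d := by positivity
    have hite : 0 ≤ if nsq 1 y ≤ 4 * R ^ 2 then C / R ^ d else 0 := by split_ifs <;> linarith
    rcases le_or_gt (A y) (R ^ 2 / 16) with h1 | h1
    · have e : lap 1 Φ y = lap 1 (fun y => g (A y)) y := by
        have e1 : lap 1 Φ y = lap 1 (fun y => g (A y) - (c + δ / 2)) y := by
          unfold lap
          congr 1
          refine sum_congr rfl fun i _ => ?_
          have := hnb y i
          have := sq_nonneg R
          rw [hΦ1 _ (by linarith), hΦ1 _ (by linarith), hΦ1 _ (by linarith)]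
        rw [e1, lap_sub, lap_const, sub_zero]
      rw [e]
      have : lap 1 (fun y => g (A y)) y ≤ if y = 0 then -c0 else 0 := by
        split_ifs with hy
        · subst hy; exact hG0
        · exact hG y
      linarith
    · have hy0 : y ≠ 0 := by
        rintro rfl
        have : A 0 = κ := by simp [hA, nsq]
        linarith
      rw [if_neg hy0, zero_add]
      rcases le_or_gt (nsq 1 y) (4 * R ^ 2) with h2 | h2
      · rw [if_pos h2]
        have hA5 : A y ≤ 5 * R ^ 2 := by simp only [hA]; linarith
        have hl : 0 < R ^ 2 / 32 := by positivity
        have hq : ∀ B : ℝ, R ^ 2 / 32 ≤ B → |B - A y| ≤ 5 * R → (g B - c - (g (A y) - c)) ^ 2 / (2 * δ) ≤ C / R ^ d / (2 * d) := by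
          intro B hB hBA
          have h3 := rpow_neg_diff hl hB (by linarith : R ^ 2 / 32 ≤ A y) hs0.le
          have h4 : |g B - c - (g (A y) - c)| ≤ s * (1 / 32) ^ (-s - 1) * 5 * R ^ (-2 * s - 1) := by
            have e1 : g B - c - (g (A y) - c) = B ^ (-s) - A y ^ (-s) := by simp only [hg]; ring
            rw [e1]
            refine h3.trans ((mll hBA (by positivity)).trans (le_of_eq ?_))
            rw [show R ^ 2 / 32 = 1 / 32 * R ^ 2 by ring, Real.mul_rpow (by norm_num) (by positivity),
              ← rpow_natCast R 2, ← rpow_mul hR0.le,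
              show -2 * s - 1 = ((2:ℕ):ℝ) * (-s - 1) + 1 by push_cast; ring, rpow_add_one hR0.ne']
            ring
          have h5 : (g B - c - (g (A y) - c)) ^ 2 ≤ (s * (1 / 32) ^ (-s - 1) * 5 * R ^ (-2 * s - 1)) ^ 2 := by
            rw [← sq_abs]; exact pow_le_pow_left₀ (abs_nonneg _) h4 2
          refine (div_le_div_of_nonneg_right h5 (by positivity)).trans (le_of_eq ?_)
          have e2 : (R ^ (-2 * s - 1)) ^ 2 = R ^ (-(2 * s)) / R ^ d := by
            rw [← rpow_natCast, ← rpow_mul hR0.le, ← rpow_natCast R d, ← rpow_sub hR0]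
            congr 1; rw [hs]; push_cast; ring
          have h6 : (4:ℝ) ^ s - 1 ≠ 0 := by linarith
          have h7 : R ^ (-(2 * s)) ≠ 0 := (rpow_pos_of_pos hR0 _).ne'
          rw [mul_pow, e2, hδ, hC]
          field_simp
        have hF := F'_nonneg δ (g (A y) - c)
        have hsum : lap 1 Φ y ≤ F' δ (g (A y) - c) * lap 1 (fun y => g (A y)) y + C / R ^ d := by
          unfold lap
          simp only [Nat.cast_one, one_pow, one_mul]
          have : C / R ^ d = ∑ i : Fin d, (C / R ^ d / (2 * d) + C / R ^ d / (2 * d)) := by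
            simp only [sum_const, card_univ, Fintype.card_fin, nsmul_eq_mul]
            field_simp; ring
          rw [this, mul_sum, ← sum_add_distrib]
          refine sum_le_sum fun i _ => ?_
          have hn := hnb y i
          have hyR : |(y i : ℝ)| ≤ 2 * R := by
            apply abs_le_of_sq_le_sq _ (by linarith)
            have := coord_sq_le 1 y i
            simp only [Nat.cast_one, div_one] at this
            nlinarith
          have hyR' := abs_le.1 hyR
          have q1 := hq (A (y + Pi.single i 1)) (by linarith) (by rw [hAp, abs_le]; constructor <;> linarith)
          have q2 := hq (A (y - Pi.single i 1)) (by linarith) (by rw [hAm, abs_le]; constructor <;> linarith)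
          have t1 := F_taylor hδ0 (g (A y) - c) (g (A (y + Pi.single i 1)) - c)
          have t2 := F_taylor hδ0 (g (A y) - c) (g (A (y - Pi.single i 1)) - c)
          simp only [hΦ]
          linarith
        have := mul_nonpos_of_nonneg_of_nonpos hF (hG y)
        exact hsum.trans (by linarith)
      · rw [if_neg (not_le.2 h2)]
        have hA4 : 4 * R ^ 2 ≤ A y := by simp only [hA]; linarith
        have e1 : lap 1 Φ y = lap 1 (fun _ : Fin d → ℤ => (0:ℝ)) y := by
          unfold lap
          congr 1
          refine sum_congr rfl fun i _ => ?_
          have := hnb y i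
          have := sq_nonneg R
          rw [hΦ0 _ (by linarith), hΦ0 _ (by linarith), hΦ0 _ (by linarith)]
        rw [e1, lap_const]
end FDE
namespace FDE
variable {d : ℕ}
theorem sum_oneD {γ : ℝ} (h0 : 0 ≤ γ) (h1 : γ < 1) (n : ℕ) :
    ∑ k ∈ Finset.Icc (-(n:ℤ)) n, (1 + (k:ℝ) ^ 2) ^ (-(γ / 2)) ≤ 1 + 2 / (1 - γ) * (n:ℝ) ^ (1 - γ) := by
  induction n with
  | zero => simp [Real.zero_rpow (by linarith : (1 - γ) ≠ 0)]
  | succ n ih =>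
    have e : Finset.Icc (-((n + 1 : ℕ):ℤ)) ((n + 1 : ℕ):ℤ)
        = insert ((n:ℤ) + 1) (insert (-((n:ℤ) + 1)) (Finset.Icc (-(n:ℤ)) n)) := by
      ext k; simp only [Finset.mem_insert, Finset.mem_Icc]; push_cast; omega
    rw [e, Finset.sum_insert (by simp; omega), Finset.sum_insert (by simp)]
    have hn : (0:ℝ) < (n:ℝ) + 1 := by positivity
    have hb : (1 + ((n:ℝ) + 1) ^ 2) ^ (-(γ / 2)) ≤ ((n:ℝ) + 1) ^ (-γ) := by
      have : ((n:ℝ) + 1) ^ (-γ) = (((n:ℝ) + 1) ^ 2) ^ (-(γ / 2)) := by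
        rw [← rpow_natCast, ← rpow_mul hn.le]; congr 1; push_cast; ring
      rw [this]
      exact rpow_le_rpow_of_nonpos (by positivity) (by linarith) (by linarith)
    have ht := conc_tangent (m := 1 - γ) (by linarith) (by linarith) hn (by positivity : (0:ℝ) ≤ n)
    rw [show 1 - γ - 1 = -γ by ring] at ht
    have hg : 0 < 1 - γ := by linarith
    have : 2 * ((n:ℝ) + 1) ^ (-γ) ≤ 2 / (1 - γ) * (((n:ℝ) + 1) ^ (1 - γ) - (n:ℝ) ^ (1 - γ)) := by
      rw [div_mul_eq_mul_div, le_div_iff₀ hg]; linarith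
    push_cast
    rw [neg_sq]
    linarith
theorem sum_lattice {β : ℝ} (h0 : 0 ≤ β) (h1 : β < d) : ∃ C, 0 ≤ C ∧ ∀ n : ℕ, 1 ≤ n →
    ∑ y ∈ Fintype.piFinset (fun _ : Fin d => Finset.Icc (-(n:ℤ)) n), (nsq 1 y + 1) ^ (-(β / 2)) ≤ C * (n:ℝ) ^ ((d:ℝ) - β) := by
  have hd : (0:ℝ) < d := by linarith
  set γ := β / d with hγ
  have hγ0 : 0 ≤ γ := by positivity
  have hγ1 : γ < 1 := (div_lt_one hd).2 h1
  have hg : 0 < 1 - γ := by linarith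
  refine ⟨(1 + 2 / (1 - γ)) ^ d, by positivity, fun n hn => ?_⟩
  have hn' : (1:ℝ) ≤ n := by exact_mod_cast hn
  calc _ ≤ ∑ y ∈ Fintype.piFinset (fun _ : Fin d => Finset.Icc (-(n:ℤ)) n), ∏ i : Fin d, (1 + (y i:ℝ) ^ 2) ^ (-(γ / 2)) := by
        refine sum_le_sum fun y _ => ?_
        have hN := nsq_nonneg 1 y
        have : (nsq 1 y + 1) ^ (-(β / 2)) = ∏ i : Fin d, (nsq 1 y + 1) ^ (-(γ / 2)) := by
          rw [Finset.prod_const, card_univ, Fintype.card_fin, ← rpow_natCast, ← rpow_mul (by linarith)]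
          congr 1; rw [hγ]; field_simp
        rw [this]
        refine Finset.prod_le_prod (fun i _ => by positivity) fun i _ => ?_
        refine rpow_le_rpow_of_nonpos (by positivity) ?_ (by linarith)
        have := coord_sq_le 1 y i
        simp only [Nat.cast_one, div_one] at this
        linarith
    _ = ∏ i : Fin d, ∑ k ∈ Finset.Icc (-(n:ℤ)) n, (1 + (k:ℝ) ^ 2) ^ (-(γ / 2)) := by
        rw [Finset.prod_univ_sum]
    _ ≤ ∏ i : Fin d, ((1 + 2 / (1 - γ)) * (n:ℝ) ^ (1 - γ)) := by
        refine Finset.prod_le_prod (fun i _ => sum_nonneg fun k _ => by positivity) fun i _ => ?_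
        refine (sum_oneD hγ0 hγ1 n).trans ?_
        have : (1:ℝ) ≤ (n:ℝ) ^ (1 - γ) := Real.one_le_rpow hn' hg.le
        linarith
    _ = _ := by
        rw [Finset.prod_const, card_univ, Fintype.card_fin, mul_pow, ← rpow_natCast ((n:ℝ) ^ (1 - γ)), ← rpow_mul (by positivity)]
        congr 2; rw [hγ]; field_simp
theorem nsq_scale {n : ℕ} (hn : 1 ≤ n) (x : Fin d → ℤ) : nsq 1 x = (n:ℝ) ^ 2 * nsq n x := by
  have hn' : (n:ℝ) ≠ 0 := by positivity
  unfold nsq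
  rw [mul_sum]
  exact sum_congr rfl fun i _ => by field_simp; simp
theorem mem_box {n : ℕ} (hn : 1 ≤ n) {x : Fin d → ℤ} (h : nsq n x ≤ 1) :
    x ∈ Fintype.piFinset (fun _ : Fin d => Finset.Icc (-(n:ℤ)) n) := by
  have hn' : (0 : ℝ) < n := by exact_mod_cast hn
  refine Fintype.mem_piFinset.2 fun i => ?_
  have := abs_coord_le (by norm_num : (0:ℝ) ≤ 1) (by linarith : nsq n x ≤ 1 ^ 2) i
  rw [abs_div, abs_of_pos hn', div_le_iff₀ hn', abs_le, one_mul] at this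
  rw [Finset.mem_Icc]
  exact ⟨by exact_mod_cast this.1, by exact_mod_cast this.2⟩
theorem I_green {σ : ℝ} (hd : 3 ≤ d) (h0 : 0 ≤ σ) (h1 : ((d:ℝ) - 2) * σ < d) : ∃ C, 0 ≤ C ∧ ∀ n : ℕ, 1 ≤ n →
    ∀ x : Fin d → ℤ, I n (fun y => if nsq n (y - x) ≤ 1 then
      ((n:ℝ) ^ ((d:ℝ) - 2) * (nsq 1 (y - x) + 1) ^ (-(((d:ℝ) - 2) / 2))) ^ σ else 0) ≤ C := by
  have hd' : (3:ℝ) ≤ d := by exact_mod_cast hd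
  obtain ⟨C, hC, h⟩ := sum_lattice (β := ((d:ℝ) - 2) * σ) (mul_nonneg (by linarith) h0) h1
  refine ⟨C, hC, fun n hn x => ?_⟩
  have hn' : (0:ℝ) < n := by exact_mod_cast hn
  unfold I
  rw [div_le_iff₀ (by positivity)]
  set B := Fintype.piFinset (fun _ : Fin d => Finset.Icc (-(n:ℤ)) n)
  set f : (Fin d → ℤ) → ℝ := fun z => ((n:ℝ) ^ ((d:ℝ) - 2) * (nsq 1 z + 1) ^ (-(((d:ℝ) - 2) / 2))) ^ σ with hf
  have hf0 : ∀ z, 0 ≤ f z := fun z => by have := nsq_nonneg 1 z; positivity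
  calc _ = ∑ y ∈ (S n).filter (fun y => nsq n (y - x) ≤ 1), f (y - x) := by rw [Finset.sum_filter]
    _ = ∑ z ∈ ((S n).filter (fun y => nsq n (y - x) ≤ 1)).image (fun y => y - x), f z := by
        rw [Finset.sum_image]; intro a _ b _ hab; simpa using hab
    _ ≤ ∑ z ∈ B, f z := by
        refine Finset.sum_le_sum_of_subset_of_nonneg ?_ fun z _ _ => hf0 z
        intro z hz
        obtain ⟨y, hy, rfl⟩ := Finset.mem_image.1 hz
        exact mem_box hn (Finset.mem_filter.1 hy).2
    _ = (n:ℝ) ^ (((d:ℝ) - 2) * σ) * ∑ z ∈ B, (nsq 1 z + 1) ^ (-(((d:ℝ) - 2) * σ / 2)) := by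
        rw [mul_sum]
        refine sum_congr rfl fun z _ => ?_
        have := nsq_nonneg 1 z
        simp only [hf]
        rw [Real.mul_rpow (by positivity) (by positivity), ← rpow_mul hn'.le, ← rpow_mul (by linarith)]
        congr 2; ring
    _ ≤ (n:ℝ) ^ (((d:ℝ) - 2) * σ) * (C * (n:ℝ) ^ ((d:ℝ) - ((d:ℝ) - 2) * σ)) :=
        mll (h n hn) (by positivity)
    _ = C * (n:ℝ) ^ d := by
        rw [mul_left_comm, ← rpow_add hn', ← rpow_natCast (n:ℝ) d]; congr 2; ring
end FDE
namespace FDE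
variable {d : ℕ}
noncomputable def cut (ρ : ℝ) (b n : ℕ) (y : Fin d → ℤ) : ℝ := max (1 - nsq n y / ρ) 0 ^ (b + 2)
theorem cut_nonneg (ρ : ℝ) (b n : ℕ) (y : Fin d → ℤ) : 0 ≤ cut ρ b n y := pow_nonneg (le_max_right _ _) _
theorem cut_base_le_one {ρ : ℝ} (hρ : 0 < ρ) (n : ℕ) (y : Fin d → ℤ) : max (1 - nsq n y / ρ) 0 ≤ 1 := by
  have : 0 ≤ nsq n y / ρ := div_nonneg (nsq_nonneg n y) hρ.le
  exact max_le (by linarith) zero_le_one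
theorem cut_le_one {ρ : ℝ} (hρ : 0 < ρ) (b n : ℕ) (y : Fin d → ℤ) : cut ρ b n y ≤ 1 :=
  pow_le_one₀ (le_max_right _ _) (cut_base_le_one hρ n y)
theorem cut_eq_zero {ρ : ℝ} (hρ : 0 < ρ) (b : ℕ) {n : ℕ} {y : Fin d → ℤ} (h : ρ ≤ nsq n y) : cut ρ b n y = 0 := by
  unfold cut
  rw [max_eq_right, zero_pow (by omega)]
  have := (one_le_div hρ).2 h; linarith
theorem nsq_of_cut_ne {ρ : ℝ} (hρ : 0 < ρ) {b n : ℕ} {y : Fin d → ℤ} (h : cut ρ b n y ≠ 0) : nsq n y < ρ := by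
  by_contra hc; exact h (cut_eq_zero hρ b (not_lt.1 hc))
theorem cut_lap_lower {ρ : ℝ} (hρ : 0 < ρ) (b : ℕ) {n : ℕ} (hn : 1 ≤ n) (y : Fin d → ℤ) :
    -(2 * d * (b + 2) / ρ * max (1 - nsq n y / ρ) 0 ^ (b + 1)) ≤ lap n (cut ρ b n) y := by
  have hn' : (0:ℝ) < n := by exact_mod_cast hn
  set s := 1 - nsq n y / ρ with hs
  have per : ∀ i : Fin d, -((b + 2) * max s 0 ^ (b + 1) * (2 * (1 / n) ^ 2 / ρ)) ≤
      cut ρ b n (y + Pi.single i 1) + cut ρ b n (y - Pi.single i 1) - 2 * cut ρ b n y := by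
    intro i
    have t1 := pow_tangent (1 - nsq n (y + Pi.single i 1) / ρ) s b
    have t2 := pow_tangent (1 - nsq n (y - Pi.single i 1) / ρ) s b
    unfold cut
    rw [← hs]
    have e : (1 - nsq n (y + Pi.single i 1) / ρ - s) + (1 - nsq n (y - Pi.single i 1) / ρ - s) = -(2 * (1 / n) ^ 2 / ρ) := by
      rw [nsq_add_single, nsq_sub_single, hs]; ring
    have := congrArg (fun t => (b + 2) * max s 0 ^ (b + 1) * t) e
    linarith
  unfold lap
  have := mll (sum_le_sum fun i (_ : i ∈ (Finset.univ : Finset (Fin d))) => per i) (by positivity : (0:ℝ) ≤ (n:ℝ) ^ 2)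
  refine le_trans (le_of_eq ?_) this
  simp only [sum_const, card_univ, Fintype.card_fin, nsmul_eq_mul]
  field_simp
theorem cut_lap_upper (b : ℕ) (hb : 1 ≤ b) : ∃ C, 0 ≤ C ∧ ∀ n : ℕ, 1 ≤ n → ∀ y : Fin d → ℤ,
    lap n (cut 1 b n) y ≤ C * (max (1 - nsq n y) 0 ^ b + 1 / n) := by
  refine ⟨50 * d * (b + 2) ^ 2 * 2 ^ (b - 1) * 5 ^ b, by positivity, fun n hn y => ?_⟩
  have hn' : (1:ℝ) ≤ n := by exact_mod_cast hn
  have hh1 : (1 / n : ℝ) ≤ 1 := by rw [div_le_one (by linarith)]; exact hn'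
  have hh0 : (0 : ℝ) < 1 / n := by positivity
  have hcut : ∀ z : Fin d → ℤ, cut 1 b n z = max (1 - nsq n z) 0 ^ (b + 2) := fun z => by simp [cut]
  have hr0 : 0 ≤ max (1 - nsq n y) 0 := le_max_right _ _
  rcases le_or_gt (nsq n y) 4 with hA | hA
  · set s := 1 - nsq n y with hs
    have hM : max s 0 ≤ max s 0 + 5 * (1 / n) := by linarith
    have per : ∀ i : Fin d, cut 1 b n (y + Pi.single i 1) + cut 1 b n (y - Pi.single i 1) - 2 * cut 1 b n y ≤
        50 * (b + 2) ^ 2 * (1 / n) ^ 2 * (max s 0 + 5 * (1 / n)) ^ b := by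
      intro i
      have hyi := abs_le.1 (abs_coord_le (by norm_num : (0:ℝ) ≤ 2) (by linarith : nsq n y ≤ 2 ^ 2) i)
      set t : ℝ := (y i : ℝ) / n
      set h : ℝ := 1 / n
      have q1 : (1 - nsq n (y + Pi.single i 1)) - s = -(2 * t * h + h ^ 2) := by
        rw [nsq_add_single, hs]; ring
      have q2 : (1 - nsq n (y - Pi.single i 1)) - s = 2 * t * h - h ^ 2 := by
        rw [nsq_sub_single, hs]; ring
      have b1 : |(1 - nsq n (y + Pi.single i 1)) - s| ≤ 5 * h := by
        rw [q1, abs_le]; constructor <;> nlinarith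
      have b2 : |(1 - nsq n (y - Pi.single i 1)) - s| ≤ 5 * h := by
        rw [q2, abs_le]; constructor <;> nlinarith
      have mx : ∀ x : ℝ, |x - s| ≤ 5 * h → max x 0 ≤ max s 0 + 5 * h := fun x hx => by
        rw [abs_le] at hx
        have := le_max_left s 0
        exact max_le (by linarith [hx.2]) (by positivity)
      have t1 := pow_taylor (mx _ b1) hM b
      have t2 := pow_taylor (mx _ b2) hM b
      have sq1 : ((1 - nsq n (y + Pi.single i 1)) - s) ^ 2 ≤ 25 * h ^ 2 := by
        rw [← sq_abs]; nlinarith [abs_nonneg ((1 - nsq n (y + Pi.single i 1)) - s)]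
      have sq2 : ((1 - nsq n (y - Pi.single i 1)) - s) ^ 2 ≤ 25 * h ^ 2 := by
        rw [← sq_abs]; nlinarith [abs_nonneg ((1 - nsq n (y - Pi.single i 1)) - s)]
      rw [hcut, hcut, hcut, ← hs]
      set M := (max s 0 + 5 * h) ^ b
      have hM0 : 0 ≤ M := by positivity
      have u1 := mlr (mll sq1 (by positivity : (0:ℝ) ≤ (b + 2) ^ 2)) hM0
      have u2 := mlr (mll sq2 (by positivity : (0:ℝ) ≤ (b + 2) ^ 2)) hM0
      have e : (b + 2) * max s 0 ^ (b + 1) * ((1 - nsq n (y + Pi.single i 1)) - s) + (b + 2) * max s 0 ^ (b + 1) * ((1 - nsq n (y - Pi.single i 1)) - s) ≤ 0 := by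
        rw [q1, q2]
        have : 0 ≤ (b + 2) * max s 0 ^ (b + 1) * h ^ 2 := by positivity
        nlinarith
      linarith
    unfold lap
    refine (mll (sum_le_sum fun i _ => per i) (by positivity)).trans ?_
    simp only [sum_const, card_univ, Fintype.card_fin, nsmul_eq_mul]
    have hp : (max s 0 + 5 * (1 / n)) ^ b ≤ 2 ^ (b - 1) * 5 ^ b * (max s 0 ^ b + 1 / n) := by
      refine (add_pow_le hr0 (by positivity) b).trans ?_
      rw [mul_assoc]
      refine mll ?_ (by positivity)
      rw [mul_pow, mul_add]
      have h5 : (1:ℝ) ≤ 5 ^ b := one_le_pow₀ (by norm_num)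
      have hhb : (1 / n : ℝ) ^ b ≤ 1 / n := pow_le_of_le_one hh0.le hh1 (by omega)
      have : 0 ≤ max s 0 ^ b := by positivity
      nlinarith
    calc _ = 50 * d * (b + 2) ^ 2 * (max s 0 + 5 * (1 / n)) ^ b := by field_simp
      _ ≤ 50 * d * (b + 2) ^ 2 * (2 ^ (b - 1) * 5 ^ b * (max s 0 ^ b + 1 / n)) := mll hp (by positivity)
      _ = _ := by ring
  · have z0 : ∀ z : Fin d → ℤ, 1 ≤ nsq n z → cut 1 b n z = 0 := fun z h => cut_eq_zero one_pos b h
    have e1 : lap n (cut 1 b n) y = lap n (fun _ : Fin d → ℤ => (0:ℝ)) y := by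
      unfold lap
      congr 1
      refine sum_congr rfl fun i _ => ?_
      have hyi := coord_sq_le n y i
      rw [z0, z0, z0]
      · linarith
      · rw [nsq_sub_single]; nlinarith [sq_nonneg ((y i : ℝ) / n - 2 * (1 / n))]
      · rw [nsq_add_single]; nlinarith [sq_nonneg ((y i : ℝ) / n + 2 * (1 / n))]
    rw [e1, lap_const]; positivity
/-- one step of the L^p estimate -/
theorem Lp_step {m p : ℝ} (hm : 0 < m) (hm1 : m < 1) (hp : 1 ≤ p) (b : ℕ) (hb1 : 1 ≤ b) (hb : 2 * p / (1 - m) ≤ b) :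
    ∃ C, 0 < C ∧ ∀ (K : ℝ), 1 ≤ K → ∀ n : ℕ, 1 ≤ n → K ^ p ≤ n → ∀ (v w : (Fin d → ℤ) → ℝ) (τ : ℝ), 0 ≤ τ →
      (∀ x, 0 ≤ v x) → (∀ x, 0 ≤ w x) → (∀ x, v x ≤ K) →
      (∀ x, nsq n x ≤ 1 → v x ≤ w x + τ * (lap n (fun y => v y ^ m) x + 1)) →
      I n (fun y => cut 1 b n y * v y ^ p) ≤ I n (fun y => cut 1 b n y * w y ^ p)
        + τ * C * (1 + I n (fun y => cut 1 b n y * v y ^ p)) := by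
  obtain ⟨C1, hC1, hcut⟩ := cut_lap_upper (d := d) b hb1
  set ρ := p + m - 1 with hρ
  have hρ0 : 0 < ρ := by linarith
  set r := ρ / m with hr
  have hr1 : 1 ≤ r := by rw [hr, one_le_div hm]; linarith
  set γ := ρ / p with hγ
  have hp0 : 0 < p := by linarith
  have hγ0 : 0 ≤ γ := by positivity
  have hγ1 : γ ≤ 1 := by rw [hγ, div_le_one hp0]; linarith
  have hbγ : ((b + 2 : ℕ) : ℝ) * γ ≤ b := by
    rw [div_le_iff₀ (by linarith)] at hb
    rw [hγ, mul_div_assoc', div_le_iff₀ hp0, hρ]; push_cast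
    have : (0:ℝ) ≤ b := by positivity
    nlinarith
  refine ⟨p * (1 + C1) * (3 * 11 ^ d), by positivity, fun K hK n hn hKn v w τ hτ hv hw hvK h => ?_⟩
  have hn' : (1:ℝ) ≤ n := by exact_mod_cast hn
  set ψ : (Fin d → ℤ) → ℝ := cut 1 b n with hψ
  have hψ0 : ∀ y, 0 ≤ ψ y := cut_nonneg 1 b n
  have hψ1 : ∀ y, ψ y ≤ 1 := cut_le_one one_pos b n
  have lapr : ∀ x, v x ^ (p - 1) * lap n (fun y => v y ^ m) x ≤ lap n (fun y => v y ^ ρ) x / r := by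
    intro x
    rw [le_div_iff₀ (by linarith)]
    unfold lap
    rw [mul_left_comm, mul_assoc, mul_sum, Finset.sum_mul]
    refine mll (sum_le_sum fun i _ => ?_) (by positivity)
    have e0 : ∀ z, v z ^ ρ = (v z ^ m) ^ r := fun z => by
      rw [← rpow_mul (hv z), hr]; congr 1; field_simp
    have e1 : v x ^ (p - 1) = (v x ^ m) ^ (r - 1) := by
      rw [← rpow_mul (hv x), hr]; congr 1; field_simp; rw [hρ]; ring
    have nn : ∀ z, 0 ≤ v z ^ m := fun z => rpow_nonneg (hv z) _
    have t1 := conv_tangent (nn (x + Pi.single i 1)) (nn x) hr1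
    have t2 := conv_tangent (nn (x - Pi.single i 1)) (nn x) hr1
    beta_reduce
    rw [e0, e0, e0, e1]
    linarith
  have pt : ∀ y ∈ S n, ψ y * v y ^ p ≤ ψ y * w y ^ p + (p * τ) * ((1 / r) * (ψ y * lap n (fun y => v y ^ ρ) y) + (1 + ψ y * v y ^ p)) := by
    intro y _
    have hvp : 0 ≤ v y ^ p := rpow_nonneg (hv y) _
    rcases eq_or_ne (ψ y) 0 with h0 | h0
    · rw [h0]; simp; positivity
    · have hy := (nsq_of_cut_ne one_pos h0).le
      have t := conv_tangent (hw y) (hv y) hp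
      have hvp1 : 0 ≤ v y ^ (p - 1) := rpow_nonneg (hv y) _
      have hle : v y ^ (p - 1) ≤ 1 + v y ^ p := by
        rcases le_total (v y) 1 with hv1 | hv1
        · have := rpow_le_one (hv y) hv1 (by linarith : 0 ≤ p - 1); linarith
        · have := rpow_le_rpow_of_exponent_le hv1 (by linarith : p - 1 ≤ p); linarith
      have h1 : v y ^ p ≤ w y ^ p + p * τ * (lap n (fun y => v y ^ ρ) y / r + (1 + v y ^ p)) := by
        have h2 := mll (by linarith [h y hy] : v y - w y ≤ τ * (lap n (fun y => v y ^ m) y + 1)) hvp1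
        have h3 := mll h2 hp0.le
        have h4 := mll (add_le_add (lapr y) hle) (mul_nonneg hp0.le hτ)
        nlinarith
      have h5 := mll h1 (hψ0 y)
      have h6 : 0 ≤ (p * τ) * (1 - ψ y) := mul_nonneg (by positivity) (by linarith [hψ1 y])
      calc _ ≤ _ := h5
        _ = ψ y * w y ^ p + (p * τ) * ((1 / r) * (ψ y * lap n (fun y => v y ^ ρ) y) + (ψ y + ψ y * v y ^ p)) := by ring
        _ ≤ _ := by nlinarith
  have hI := I_mono pt
  set Sv := I n (fun y => ψ y * v y ^ p) with hSv
  have hSv0 : 0 ≤ Sv := I_nonneg fun y _ => mul_nonneg (hψ0 y) (rpow_nonneg (hv y) _)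
  have e1 : I n (fun y => ψ y * w y ^ p + (p * τ) * ((1 / r) * (ψ y * lap n (fun y => v y ^ ρ) y) + (1 + ψ y * v y ^ p)))
      = I n (fun y => ψ y * w y ^ p) + (p * τ) * ((1 / r) * I n (fun y => ψ y * lap n (fun y => v y ^ ρ) y) + (I n (fun _ : Fin d → ℤ => 1) + Sv)) := by
    rw [I_add, I_mul, I_add, I_mul, I_add]
  have hsb := sbp hn (fun y => v y ^ ρ) ψ (fun y hy => (nsq_of_cut_ne one_pos hy).le.trans (by norm_num))
  have h11 : (1:ℝ) ≤ 11 ^ d := one_le_pow₀ (by norm_num)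
  have hlap : I n (fun y => ψ y * lap n (fun y => v y ^ ρ) y) ≤ C1 * (2 * 11 ^ d + Sv) := by
    rw [← hsb]
    have pt2 : ∀ y ∈ S n, v y ^ ρ * lap n ψ y ≤ C1 * ((1 + ψ y * v y ^ p) + 1) := by
      intro y _
      have hvρ : 0 ≤ v y ^ ρ := rpow_nonneg (hv y) _
      have a1 := mll (hcut n hn y) hvρ
      have hs1 : max (1 - nsq n y) 0 ≤ 1 := by have := cut_base_le_one one_pos n y; simpa using this
      have hs0 : 0 ≤ max (1 - nsq n y) 0 := le_max_right _ _
      have a2 : v y ^ ρ * max (1 - nsq n y) 0 ^ b ≤ 1 + ψ y * v y ^ p := by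
        have e : (ψ y * v y ^ p) ^ γ = v y ^ ρ * max (1 - nsq n y) 0 ^ (((b + 2 : ℕ) : ℝ) * γ) := by
          rw [Real.mul_rpow (hψ0 y) (rpow_nonneg (hv y) _), ← rpow_mul (hv y), hψ, cut, div_one,
            rpow_mul hs0, rpow_natCast, mul_comm]
          congr 2; rw [hγ]; field_simp
        have b1 : max (1 - nsq n y) 0 ^ b ≤ max (1 - nsq n y) 0 ^ (((b + 2 : ℕ) : ℝ) * γ) := by
          rw [← rpow_natCast _ b]
          exact rpow_le_rpow_of_exponent_ge_of_imp hs0 hs1 hbγ (fun _ hb0 => by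
            have : (1:ℝ) ≤ b := by exact_mod_cast hb1
            have h7 : 0 < ((b + 2 : ℕ) : ℝ) * γ := by positivity
            linarith)
        have hz : 0 ≤ ψ y * v y ^ p := mul_nonneg (hψ0 y) (rpow_nonneg (hv y) _)
        have b2 : (ψ y * v y ^ p) ^ γ ≤ 1 + ψ y * v y ^ p := by
          rcases le_total (ψ y * v y ^ p) 1 with h1 | h1
          · have := rpow_le_one hz h1 hγ0; linarith
          · have := rpow_le_rpow_of_exponent_le h1 hγ1; rw [rpow_one] at this; linarith
        rw [e] at b2
        exact (mll b1 hvρ).trans b2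
      have a3 : v y ^ ρ * (1 / n) ≤ 1 := by
        have : v y ^ ρ ≤ n := (rpow_le_rpow (hv y) (hvK y) hρ0.le).trans
          ((rpow_le_rpow_of_exponent_le hK (by linarith : ρ ≤ p)).trans hKn)
        rw [mul_one_div, div_le_one (by linarith)]; exact this
      have := mll (add_le_add a2 a3) hC1
      calc _ ≤ _ := a1
        _ = C1 * (v y ^ ρ * max (1 - nsq n y) 0 ^ b + v y ^ ρ * (1 / n)) := by ring
        _ ≤ _ := this
    refine (I_mono pt2).trans ?_
    rw [I_mul, I_add, I_add]
    have := I_one_le (d := d) hn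
    exact mll (by linarith) hC1
  rw [e1] at hI
  refine hI.trans (add_le_add le_rfl ?_)
  have hr' : 1 / r ≤ 1 := by rw [div_le_one (by linarith)]; exact hr1
  have hr0 : 0 ≤ 1 / r := by positivity
  have h1 := I_one_le (d := d) hn
  have hX : 0 ≤ C1 * (2 * 11 ^ d + Sv) := by positivity
  have : (1 / r) * I n (fun y => ψ y * lap n (fun y => v y ^ ρ) y) ≤ C1 * (2 * 11 ^ d + Sv) :=
    (mll hlap hr0).trans (mul_le_of_le_one_left hX hr')
  have h2 : (1 / r) * I n (fun y => ψ y * lap n (fun y => v y ^ ρ) y) + (I n (fun _ : Fin d → ℤ => 1) + Sv)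
      ≤ (1 + C1) * (3 * 11 ^ d) * (1 + Sv) := by
    have := mul_nonneg hC1 hSv0
    have := mul_nonneg (by linarith : (0:ℝ) ≤ 11 ^ d - 1) hSv0
    have := mul_nonneg hC1 this
    nlinarith
  calc _ ≤ p * τ * ((1 + C1) * (3 * 11 ^ d) * (1 + Sv)) := mll h2 (by positivity)
    _ = _ := by ring
end FDE
namespace FDE
variable {d : ℕ}
theorem nsq_young (n : ℕ) (x y : Fin d → ℤ) {η : ℝ} (hη : 0 < η) :
    nsq n y ≤ (1 + η) * nsq n x + (1 + 1 / η) * nsq n (y - x) := by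
  unfold nsq
  rw [mul_sum, mul_sum, ← sum_add_distrib]
  refine sum_le_sum fun i _ => ?_
  rw [Pi.sub_apply, Int.cast_sub, sub_div]
  set a := (x i : ℝ) / n
  set b := (y i : ℝ) / n
  have : (1 + η) * a ^ 2 + (1 + 1 / η) * (b - a) ^ 2 - b ^ 2 = (η * a - (b - a)) ^ 2 / η := by
    field_simp; ring
  have h2 : 0 ≤ (η * a - (b - a)) ^ 2 / η := by positivity
  linarith
structure Grid (n : ℕ) (t : ℕ → ℝ) : Prop where
  zero : t 0 = 0
  pos : 0 < t 1
  small : t 1 ≤ 2 / n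
  step : ∀ k, 1 ≤ k → t (k + 1) = (1 + 1 / n) * t k
theorem Grid.tpos {n : ℕ} {t : ℕ → ℝ} (g : Grid n t) : ∀ k, 1 ≤ k → 0 < t k := by
  intro k hk
  induction k, hk using Nat.le_induction with
  | base => exact g.pos
  | succ k hk ih => rw [g.step k hk]; positivity
theorem Grid.nonneg {n : ℕ} {t : ℕ → ℝ} (g : Grid n t) (k : ℕ) : 0 ≤ t k := by
  rcases Nat.eq_zero_or_pos k with rfl | h
  · rw [g.zero]
  · exact (g.tpos k h).le
theorem Grid.le_succ {n : ℕ} {t : ℕ → ℝ} (g : Grid n t) (k : ℕ) : t k ≤ t (k + 1) := by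
  rcases Nat.eq_zero_or_pos k with rfl | h
  · rw [g.zero]; exact g.pos.le
  · rw [g.step k h]
    have := g.nonneg k
    have h2 : (0:ℝ) ≤ 1 / n * t k := by positivity
    linarith
theorem Grid.mono {n : ℕ} {t : ℕ → ℝ} (g : Grid n t) : Monotone t := monotone_nat_of_le_succ g.le_succ
theorem Grid.tau_le {n : ℕ} {t : ℕ → ℝ} (g : Grid n t) {k : ℕ} {A : ℝ} (hA : 2 ≤ A) (h : t k ≤ A) :
    t (k + 1) - t k ≤ A / n := by
  rcases Nat.eq_zero_or_pos k with rfl | hk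
  · rw [g.zero]; have := g.small
    have : (2:ℝ) / n ≤ A / n := by gcongr
    simp only [zero_add, sub_zero]; linarith
  · rw [g.step k hk]
    have : t k / n ≤ A / n := by gcongr
    calc _ = t k / n := by ring
      _ ≤ _ := this
theorem Grid.ex_mid {n : ℕ} {t : ℕ → ℝ} (hn : 1 ≤ n) (g : Grid n t) {k : ℕ} (h : 4 * t 1 ≤ t k) :
    ∃ i, 1 ≤ i ∧ i < k ∧ t k / 4 ≤ t i ∧ t i ≤ t k / 2 := by
  have hk0 : 0 < t k := by have := g.pos; linarith
  set i := Nat.findGreatest (fun i => t i ≤ t k / 2) k with hi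
  have h1k : 1 ≤ k := by
    by_contra hc
    have : k = 0 := by omega
    rw [this, g.zero] at hk0; exact lt_irrefl _ hk0
  have h1 : 1 ≤ i := Nat.le_findGreatest h1k (by have := g.pos; linarith)
  have h2 : t i ≤ t k / 2 := Nat.findGreatest_spec (P := fun i => t i ≤ t k / 2) h1k (by have := g.pos; linarith)
  have hik : i < k := by
    rcases (Nat.findGreatest_le (P := fun i => t i ≤ t k / 2) k).lt_or_eq with h | h
    · exact h
    · rw [← hi] at h; rw [h] at h2; linarith
  have h3 : t k / 2 < t (i + 1) := by
    by_contra hc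
    exact absurd (Nat.le_findGreatest (P := fun i => t i ≤ t k / 2) (n := k) (by omega : i + 1 ≤ k) (not_lt.1 hc)) (by omega)
  refine ⟨i, h1, hik, ?_, h2⟩
  rw [g.step i h1] at h3
  have hn' : (1:ℝ) ≤ n := by exact_mod_cast hn
  have : (1 / n : ℝ) ≤ 1 := by rw [div_le_one (by linarith)]; exact hn'
  have := mlr this (g.nonneg i)
  linarith
/-- decay of `v t^{-α}` -/
theorem bc_chain {n : ℕ} {t : ℕ → ℝ} (g : Grid n t) {α : ℝ} {w : ℕ → ℝ} {J : ℕ}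
    (h : ∀ k, 1 ≤ k → k < J → w (k + 1) ≤ (1 + 1 / n) ^ α * w k) {j k : ℕ} (hj : 1 ≤ j) (hjk : j ≤ k) (hk : k ≤ J) :
    w k ≤ (t k / t j) ^ α * w j := by
  induction k, hjk using Nat.le_induction with
  | base => rw [div_self (g.tpos j hj).ne', Real.one_rpow, one_mul]
  | succ k hjk ih =>
    have h1 := h k (by omega) (by omega)
    have h2 := ih (by omega)
    have e : t (k + 1) / t j = (1 + 1 / n) * (t k / t j) := by rw [g.step k (by omega)]; ring
    have p1 : (0:ℝ) ≤ 1 + 1 / n := by positivity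
    rw [e, Real.mul_rpow p1 (div_nonneg (g.nonneg k) (g.nonneg j)), mul_assoc]
    exact h1.trans (mll h2 (rpow_nonneg p1 _))
theorem gronwall {n : ℕ} {t : ℕ → ℝ} (hn : 1 ≤ n) (g : Grid n t) {C : ℝ} (hC : 0 < C) (hCn : 4 * C ≤ n) {s : ℕ → ℝ} {J : ℕ}
    (hs : ∀ k, 0 ≤ s k) (h : ∀ k, k < J → s (k + 1) ≤ s k + (t (k + 1) - t k) * C * (1 + s (k + 1))) (hJ : t J ≤ 2)
    (k : ℕ) (hk : k ≤ J) : 1 + s k ≤ (1 + s 0) * exp (4 * C) := by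
  have hn' : (1:ℝ) ≤ n := by exact_mod_cast hn
  have key : ∀ k, k ≤ J → 1 + s k ≤ (1 + s 0) * exp (2 * C * t k) := by
    intro k
    induction k with
    | zero => intro _; rw [g.zero]; simp
    | succ k ih =>
      intro hk
      have h1 := ih (by omega)
      have h2 := h k (by omega)
      have h3 := g.tau_le le_rfl ((g.mono (by omega : k ≤ J)).trans hJ)
      have h4 := g.le_succ k
      set x := C * (t (k + 1) - t k) with hx
      have hx0 : 0 ≤ x := mul_nonneg hC.le (by linarith)
      have hx1 : x ≤ 1 / 2 := by
        have : C * (2 / n) ≤ 1 / 2 := by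
          rw [mul_div_assoc', div_le_iff₀ (by linarith)]; linarith
        exact (mll h3 hC.le).trans this
      have h5 : (1 + s (k + 1)) * (1 - x) ≤ 1 + s k := by rw [hx]; nlinarith
      have h6 : 1 ≤ (1 - x) * exp (2 * x) := by
        have := Real.add_one_le_exp (2 * x)
        nlinarith
      have e : exp (2 * C * t (k + 1)) = exp (2 * C * t k) * exp (2 * x) := by
        rw [← Real.exp_add]; congr 1; rw [hx]; ring
      rw [e, ← mul_assoc]
      calc 1 + s (k + 1) ≤ (1 + s (k + 1)) * ((1 - x) * exp (2 * x)) := le_mul_of_one_le_right (by linarith [hs (k + 1)]) h6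
        _ = (1 + s (k + 1)) * (1 - x) * exp (2 * x) := by ring
        _ ≤ (1 + s k) * exp (2 * x) := mlr h5 (exp_pos _).le
        _ ≤ _ := mlr h1 (exp_pos _).le
  refine (key k hk).trans (mll (Real.exp_le_exp.2 ?_) (by linarith [hs 0]))
  have := (g.mono hk).trans hJ
  nlinarith
theorem Lp_bound {m p : ℝ} (hm : 0 < m) (hm1 : m < 1) (hp : 1 ≤ p) :
    ∃ C, 0 < C ∧ ∀ K : ℝ, 1 ≤ K → ∀ᶠ n : ℕ in atTop, ∀ t, Grid n t → ∀ J, t J ≤ 2 →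
      ∀ v : ℕ → (Fin d → ℤ) → ℝ, (∀ k x, 0 ≤ v k x) → (∀ k x, v k x ≤ K) →
      (∀ k, k < J → ∀ x, nsq n x ≤ 1 → v (k + 1) x ≤ v k x + (t (k + 1) - t k) * (lap n (fun y => v (k + 1) y ^ m) x + 1)) →
      I n (fun y => if nsq n y ≤ 1 then v 0 y ^ p else 0) ≤ 2 →
      ∀ k, k ≤ J → I n (fun y => if nsq n y ≤ 1 / 2 then v k y ^ p else 0) ≤ C := by
  obtain ⟨b, hb⟩ := exists_nat_ge (max (2 * p / (1 - m)) 1)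
  have hb1 : 1 ≤ b := by exact_mod_cast (le_max_right _ _).trans hb
  obtain ⟨C, hC, H⟩ := Lp_step (d := d) hm hm1 hp b hb1 ((le_max_left _ _).trans hb)
  refine ⟨2 ^ (b + 2) * (3 * exp (4 * C)), by positivity, fun K hK => ?_⟩
  obtain ⟨n0, hn0⟩ := exists_nat_ge (max (K ^ p) (max 1 (4 * C)))
  filter_upwards [eventually_ge_atTop n0] with n hn t g J hJ v hv hvK hsub h0 k hk
  have hnn : (n0:ℝ) ≤ n := by exact_mod_cast hn
  have hn1 : 1 ≤ n := by
    have : (1:ℝ) ≤ n := ((le_max_left _ _).trans (le_max_right _ _)).trans (hn0.trans hnn)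
    exact_mod_cast this
  have hKn : K ^ p ≤ n := (le_max_left _ _).trans (hn0.trans hnn)
  have hCn : 4 * C ≤ n := ((le_max_right _ _).trans (le_max_right _ _)).trans (hn0.trans hnn)
  have hvp : ∀ k y, 0 ≤ v k y ^ p := fun k y => rpow_nonneg (hv k y) _
  have G := gronwall hn1 g hC hCn (s := fun k => I n (fun y => cut 1 b n y * v k y ^ p)) (J := J)
    (fun k => I_nonneg fun y _ => mul_nonneg (cut_nonneg _ _ _ _) (hvp k y))
    (fun k hk => H K hK n hn1 hKn (v (k + 1)) (v k) _ (sub_nonneg.2 (g.le_succ k)) (hv _) (hv _) (hvK _) (hsub k hk)) hJ k hk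
  have i0 : I n (fun y => cut 1 b n y * v 0 y ^ p) ≤ 2 := by
    refine (I_mono fun y _ => ?_).trans h0
    split_ifs with h
    · exact mul_le_of_le_one_left (hvp 0 y) (cut_le_one one_pos _ _ _)
    · rw [cut_eq_zero one_pos b (not_le.1 h).le, zero_mul]
  have i1 : I n (fun y => if nsq n y ≤ 1 / 2 then v k y ^ p else 0) ≤ 2 ^ (b + 2) * I n (fun y => cut 1 b n y * v k y ^ p) := by
    rw [← I_mul]
    refine I_mono fun y _ => ?_
    split_ifs with h
    · rw [← mul_assoc]
      refine le_mul_of_one_le_left (hvp k y) ?_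
      unfold cut
      rw [← mul_pow]
      refine one_le_pow₀ ?_
      have := le_max_left (1 - nsq n y / 1) 0
      rw [div_one] at *
      linarith
    · exact mul_nonneg (by positivity) (mul_nonneg (cut_nonneg _ _ _ _) (hvp k y))
  refine i1.trans (mll ?_ (by positivity))
  have : (1 + I n (fun y => cut 1 b n y * v 0 y ^ p)) * exp (4 * C) ≤ 3 * exp (4 * C) :=
    mlr (by linarith) (exp_pos _).le
  linarith
theorem I_single {n : ℕ} (hn : 1 ≤ n) {x : Fin d → ℤ} (hx : x ∈ S n) (c : ℝ) :
    I n (fun y => if y = x then (n:ℝ) ^ d * c else 0) = c := by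
  have hn' : (0:ℝ) < n := by exact_mod_cast hn
  unfold I
  rw [Finset.sum_ite_eq' (S n) x, if_pos hx]
  field_simp
theorem lap_trans (n : ℕ) (Φ : (Fin d → ℤ) → ℝ) (c : ℝ) (x y : Fin d → ℤ) :
    lap n (fun y => c * Φ (y - x)) y = (n:ℝ) ^ 2 * c * lap 1 Φ (y - x) := by
  rw [lap_smul]
  unfold lap
  have e1 : ∀ i : Fin d, y + Pi.single i 1 - x = y - x + Pi.single i 1 := fun i => by abel
  have e2 : ∀ i : Fin d, y - Pi.single i 1 - x = y - x - Pi.single i 1 := fun i => by abel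
  simp only [e1, e2]
  push_cast; ring
noncomputable def Gam (n : ℕ) (z : Fin d → ℤ) : ℝ :=
  (n:ℝ) ^ ((d:ℝ) - 2) * (nsq 1 z + 1) ^ (-(((d:ℝ) - 2) / 2))
theorem Gam_nonneg (n : ℕ) (z : Fin d → ℤ) : 0 ≤ Gam n z :=
  mul_nonneg (rpow_nonneg (by positivity) _) (rpow_nonneg (by have := nsq_nonneg 1 z; linarith) _)
theorem green_n (hd : 3 ≤ d) : ∃ c0 C R0 : ℝ, 0 < c0 ∧ 0 < C ∧ 1 ≤ R0 ∧ ∀ n : ℕ, 1 ≤ n → ∀ r : ℝ, R0 ≤ n * r →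
    ∀ x : Fin d → ℤ, x ∈ S n → ∃ Φ : (Fin d → ℤ) → ℝ, (∀ y, 0 ≤ Φ y) ∧ (∀ y, Φ y ≤ Gam n (y - x)) ∧
      (∀ y, Φ y ≠ 0 → nsq n (y - x) ≤ r ^ 2) ∧
      ∀ f : (Fin d → ℤ) → ℝ, (∀ y, 0 ≤ f y) →
        I n (fun y => f y * lap n Φ y) ≤ -c0 * f x + C / r ^ d * I n (fun y => if nsq n (y - x) ≤ 4 * r ^ 2 then f y else 0) := by
  obtain ⟨c0, C, R0, hc0, hC, hR0, H⟩ := green hd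
  refine ⟨c0, C, R0, hc0, hC, hR0, fun n hn r hr x hx => ?_⟩
  have hn' : (0:ℝ) < n := by exact_mod_cast hn
  have hr0 : 0 < r := by
    by_contra hc
    have := mul_nonpos_of_nonneg_of_nonpos hn'.le (not_lt.1 hc)
    linarith
  obtain ⟨Φ, h0, h1, h2, h3⟩ := H (n * r) hr
  have hpow : (n:ℝ) ^ 2 * (n:ℝ) ^ ((d:ℝ) - 2) = (n:ℝ) ^ d := by
    rw [← rpow_natCast, ← rpow_natCast, ← rpow_add hn']; congr 1; push_cast; ring
  have hP : (0:ℝ) ≤ (n:ℝ) ^ ((d:ℝ) - 2) := rpow_nonneg hn'.le _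
  refine ⟨fun y => (n:ℝ) ^ ((d:ℝ) - 2) * Φ (y - x), fun y => mul_nonneg hP (h0 _), fun y => mll (h1 _) hP, ?_, ?_⟩
  · intro y hy
    have := h2 (y - x) (fun h => hy (by simp only [h, mul_zero]))
    rw [nsq_scale hn, mul_pow] at this
    exact le_of_mul_le_mul_left this (by positivity)
  · intro f hf
    have pt : ∀ y ∈ S n, f y * lap n (fun y => (n:ℝ) ^ ((d:ℝ) - 2) * Φ (y - x)) y ≤
        (if y = x then (n:ℝ) ^ d * (-c0 * f x) else 0) + C / r ^ d * (if nsq n (y - x) ≤ 4 * r ^ 2 then f y else 0) := by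
      intro y _
      rw [lap_trans, hpow]
      have h4 := mll (h3 (y - x)) (mul_nonneg (hf y) (by positivity : (0:ℝ) ≤ (n:ℝ) ^ d))
      have c1 : (y - x = 0) ↔ (y = x) := sub_eq_zero
      have c2 : nsq 1 (y - x) ≤ 4 * (n * r) ^ 2 ↔ nsq n (y - x) ≤ 4 * r ^ 2 := by
        rw [nsq_scale hn, mul_pow, mul_left_comm]
        exact mul_le_mul_iff_right₀ (by positivity)
      simp only [c1, c2] at h4
      calc _ = f y * (n:ℝ) ^ d * lap 1 Φ (y - x) := by ring
        _ ≤ _ := h4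
        _ = _ := by
          rw [mul_add]
          congr 1
          · split_ifs with h
            · rw [h]; ring
            · ring
          · split_ifs with h
            · rw [mul_pow]; field_simp
            · ring
    refine (I_mono pt).trans ?_
    rw [I_add, I_single hn hx, I_mul]
end FDE
namespace FDE
variable {d : ℕ}
set_option maxHeartbeats 1000000 in
theorem core (hd : 3 ≤ d) {m p κ c A Cp : ℝ} (hm : 0 < m) (hm1 : m < 1) (hp : 1 ≤ p) (hκ : 1 - m < κ) (hκ1 : κ < 1)
    (hκp : d * κ < 2 * p) (hc : 1 ≤ c) (hA : 0 < A) (hCp : 0 ≤ Cp) :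
    ∃ C R0 : ℝ, 0 < C ∧ 1 ≤ R0 ∧ ∀ n : ℕ, 1 ≤ n → ∀ x ∈ S (d := d) n, ∀ r : ℝ, r ≤ 1 → R0 ≤ n * r → ∀ N : ℝ, 1 ≤ N →
      ∀ t, Grid n t → ∀ i k : ℕ, i ≤ k → t i ≤ t k / 2 → t k ≤ 2 → ∀ v : ℕ → (Fin d → ℤ) → ℝ, (∀ k x, 0 ≤ v k x) →
      (∀ y, nsq n (y - x) ≤ 4 * r ^ 2 → nsq n y ≤ 1) →
      (∀ j, i ≤ j → j < k → ∀ x, nsq n x ≤ 1 → v (j + 1) x ≤ v j x + (t (j + 1) - t j) * (lap n (fun y => v (j + 1) y ^ m) x + 1)) →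
      (∀ j, i < j → j ≤ k → A * N ≤ v j x) →
      (∀ j, i ≤ j → j ≤ k → ∀ y, nsq n (y - x) ≤ 4 * r ^ 2 → v j y ≤ c * N) →
      (∀ j, i ≤ j → j ≤ k → I n (fun y => if nsq n (y - x) ≤ 4 * r ^ 2 then v j y ^ p else 0) ≤ Cp) →
      N ^ (m - 1 + κ) * t k ≤ C / r ^ d := by
  obtain ⟨c0, C, R0, hc0, hC, hR0, H⟩ := green_n hd
  have hκ0 : 0 < κ := by linarith
  have hp0 : 0 < p := by linarith
  have hpκ : 0 < p - κ := by linarith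
  set σ := p / (p - κ) with hσ
  have hσ1 : 1 ≤ σ := by rw [hσ, one_le_div hpκ]; linarith
  obtain ⟨Cg, hCg, HG⟩ := I_green (d := d) (σ := σ) hd (by linarith) (by
    rw [hσ, mul_div_assoc', div_lt_iff₀ hpκ]; nlinarith)
  set D := (Cg + Cp) + 2 * (C * (11 ^ d + Cp) + (11 ^ d + Cg)) with hD
  have h11 : (1:ℝ) ≤ 11 ^ d := one_le_pow₀ (by norm_num)
  have hD0 : 0 < D := by
    have : 0 ≤ C * (11 ^ d + Cp) := by positivity
    rw [hD]; linarith
  refine ⟨2 * c ^ (1 - κ) * D / (c0 * A ^ m), R0, by positivity, hR0, ?_⟩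
  intro n hn x hx r hr1 hR N hN t g i k hik hti htk v hv hloc hsub hlow hup hLp
  have hn' : (0:ℝ) < n := by exact_mod_cast hn
  have hr0 : 0 < r := by
    by_contra hcc
    have := mul_nonpos_of_nonneg_of_nonpos hn'.le (not_lt.1 hcc)
    linarith
  obtain ⟨Φ, f0, f1, f2, f3⟩ := H n hn r hR x hx
  have f2' : ∀ y, Φ y ≠ 0 → nsq n (y - x) ≤ 4 * r ^ 2 := fun y hy => by
    have := f2 y hy; nlinarith [sq_nonneg r]
  set P := (c * N) ^ (1 - κ) with hP
  have hcN : 1 ≤ c * N := by nlinarith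
  have hP1 : 1 ≤ P := Real.one_le_rpow hcN (by linarith)
  -- Gamma power bound
  have hΦσ : I n (fun y => Φ y ^ σ) ≤ Cg := by
    refine (I_mono fun y _ => ?_).trans (HG n hn x)
    by_cases h : Φ y = 0
    · rw [h, Real.zero_rpow (by linarith)]
      split_ifs
      · exact rpow_nonneg (Gam_nonneg n (y - x)) _
      · exact le_rfl
    · have : nsq n (y - x) ≤ 1 := (f2 y h).trans (by nlinarith)
      rw [if_pos this]
      exact rpow_le_rpow (f0 y) (f1 y) (by linarith)
  have hΦ1 : I n Φ ≤ 11 ^ d + Cg := by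
    have : I n Φ ≤ I n (fun y => 1 + Φ y ^ σ) := I_mono fun y _ => by
      rcases le_total (Φ y) 1 with h | h
      · have := rpow_nonneg (f0 y) σ; linarith
      · have := rpow_le_rpow_of_exponent_le h hσ1; rw [rpow_one] at this; linarith
    rw [I_add] at this
    have := I_one_le (d := d) hn
    linarith
  have hsplit : ∀ w : ℝ, 0 ≤ w → w ≤ c * N → w ≤ P * w ^ κ ∧ w ^ m ≤ P * (1 + w ^ p) := by
    intro w hw hwc
    rcases hw.eq_or_lt with rfl | hw'
    · refine ⟨mul_nonneg (by linarith) (rpow_nonneg le_rfl _), ?_⟩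
      rw [Real.zero_rpow hm.ne', Real.zero_rpow hp0.ne']; linarith
    · have e1 : w ^ (1 - κ) ≤ P := rpow_le_rpow hw hwc (by linarith)
      have e2 : w = w ^ (1 - κ) * w ^ κ := by rw [← rpow_add hw']; simp
      have e3 : w ^ m = w ^ (1 - κ) * w ^ (m - 1 + κ) := by rw [← rpow_add hw']; congr 1; ring
      have e4 : w ^ (m - 1 + κ) ≤ 1 + w ^ p := by
        rcases le_total w 1 with h | h
        · have := rpow_le_one hw h (by linarith : 0 ≤ m - 1 + κ)
          have := rpow_nonneg hw p; linarith
        · have := rpow_le_rpow_of_exponent_le h (by linarith : m - 1 + κ ≤ p); linarith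
      constructor
      · calc w = w ^ (1 - κ) * w ^ κ := e2
          _ ≤ _ := mlr e1 (rpow_nonneg hw _)
      · rw [e3]
        exact mul_le_mul e1 e4 (rpow_nonneg hw _) (by linarith)
  have hEi : I n (fun y => Φ y * v i y) ≤ P * (Cg + Cp) := by
    have pt : ∀ y ∈ S n, Φ y * v i y ≤ P * (Φ y ^ σ + (if nsq n (y - x) ≤ 4 * r ^ 2 then v i y ^ p else 0)) := by
      intro y _
      by_cases h : Φ y = 0
      · rw [h, zero_mul]
        refine mul_nonneg (by linarith) (add_nonneg (rpow_nonneg le_rfl _) ?_)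
        split_ifs
        · exact rpow_nonneg (hv i y) _
        · exact le_rfl
      · have hy := f2' y h
        rw [if_pos hy]
        have h1 := (hsplit (v i y) (hv i y) (hup i le_rfl hik y hy)).1
        have hpq : σ.HolderConjugate (p / κ) := by
          rw [Real.holderConjugate_iff]
          refine ⟨?_, ?_⟩
          · rw [hσ, one_lt_div hpκ]; linarith
          · rw [hσ]; field_simp; ring
        have h2 := Real.young_inequality_of_nonneg (f0 y) (rpow_nonneg (hv i y) κ) hpq
        have e : (v i y ^ κ) ^ (p / κ) = v i y ^ p := by rw [← rpow_mul (hv i y)]; congr 1; field_simp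
        rw [e] at h2
        have h3 : Φ y ^ σ / σ ≤ Φ y ^ σ := div_le_self (rpow_nonneg (f0 y) _) hσ1
        have h4 : v i y ^ p / (p / κ) ≤ v i y ^ p := div_le_self (rpow_nonneg (hv i y) _) (by rw [one_le_div hκ0]; linarith)
        calc Φ y * v i y ≤ Φ y * (P * v i y ^ κ) := mll h1 (f0 y)
          _ = P * (Φ y * v i y ^ κ) := by ring
          _ ≤ _ := mll (by linarith) (by linarith)
    refine (I_mono pt).trans ?_
    rw [I_mul, I_add]
    exact mll (add_le_add hΦσ (hLp i le_rfl hik)) (by linarith)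
  set Q := C / r ^ d * (P * (11 ^ d + Cp)) + (11 ^ d + Cg) with hQ
  have hstep : ∀ j, i ≤ j → j < k → I n (fun y => Φ y * v (j + 1) y) ≤ I n (fun y => Φ y * v j y) +
      (t (j + 1) - t j) * (-c0 * (A * N) ^ m + Q) := by
    intro j hij hjk
    have pt : ∀ y ∈ S n, Φ y * v (j + 1) y ≤ Φ y * v j y + (t (j + 1) - t j) * (Φ y * lap n (fun y => v (j + 1) y ^ m) y + Φ y) := by
      intro y _
      by_cases h : Φ y = 0
      · rw [h]; simp
      · have := mll (hsub j hij hjk y (hloc y (f2' y h))) (f0 y)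
        linarith
    refine (I_mono pt).trans ?_
    rw [I_add, I_mul, I_add]
    refine add_le_add le_rfl (mll ?_ (sub_nonneg.2 (g.le_succ j)))
    rw [← sbp hn (fun y => v (j + 1) y ^ m) Φ (fun y hy => (hloc y (f2' y hy)).trans (by norm_num))]
    have h1 := f3 (fun y => v (j + 1) y ^ m) (fun y => rpow_nonneg (hv _ y) _)
    have h2 : (A * N) ^ m ≤ v (j + 1) x ^ m := rpow_le_rpow (by positivity) (hlow (j + 1) (by omega) (by omega)) hm.le
    have h3 : I n (fun y => if nsq n (y - x) ≤ 4 * r ^ 2 then v (j + 1) y ^ m else 0) ≤ P * (11 ^ d + Cp) := by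
      have pt2 : ∀ y ∈ S n, (if nsq n (y - x) ≤ 4 * r ^ 2 then v (j + 1) y ^ m else 0) ≤
          P * (1 + (if nsq n (y - x) ≤ 4 * r ^ 2 then v (j + 1) y ^ p else 0)) := by
        intro y _
        split_ifs with h
        · exact (hsplit _ (hv _ y) (hup (j + 1) (by omega) (by omega) y h)).2
        · linarith
      refine (I_mono pt2).trans ?_
      rw [I_mul, I_add]
      exact mll (add_le_add (I_one_le hn) (hLp (j + 1) (by omega) (by omega))) (by linarith)
    have h4 := mll h3 (by positivity : 0 ≤ C / r ^ d)
    have h5 := mll h2 hc0.le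
    linarith
  have htel : ∀ j, i ≤ j → j ≤ k → I n (fun y => Φ y * v j y) ≤ I n (fun y => Φ y * v i y) + (t j - t i) * (-c0 * (A * N) ^ m + Q) := by
    intro j hij
    induction j, hij using Nat.le_induction with
    | base => intro _; simp
    | succ j hij ih => intro hjk; have := ih (by omega); have := hstep j hij (by omega); linarith
  have hfin := htel k hik le_rfl
  have h0 : 0 ≤ I n (fun y => Φ y * v k y) := I_nonneg fun y _ => mul_nonneg (f0 y) (hv k y)
  have hN0 : 0 < N := by linarith
  have hrd : 0 < r ^ d := by positivity
  have hrd1 : r ^ d ≤ 1 := pow_le_one₀ hr0.le hr1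
  have hi : (1:ℝ) ≤ 1 / r ^ d := by rw [one_le_div hrd]; exact hrd1
  have hQ2 : Q ≤ P * (C * (11 ^ d + Cp) + (11 ^ d + Cg)) / r ^ d := by
    have : (11:ℝ) ^ d + Cg ≤ P * (11 ^ d + Cg) * (1 / r ^ d) := by
      have a1 : (11:ℝ) ^ d + Cg ≤ P * (11 ^ d + Cg) := le_mul_of_one_le_left (by linarith) hP1
      exact a1.trans (le_mul_of_one_le_right (mul_nonneg (by linarith) (by linarith)) hi)
    calc Q ≤ C / r ^ d * (P * (11 ^ d + Cp)) + P * (11 ^ d + Cg) * (1 / r ^ d) := by rw [hQ]; linarith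
      _ = _ := by field_simp
  have hQ0 : 0 ≤ Q := by have : 0 ≤ C / r ^ d * (P * (11 ^ d + Cp)) := by positivity
                         linarith
  have hX0 : 0 ≤ c0 * (A * N) ^ m := by positivity
  have htk0 : 0 ≤ t k := g.nonneg k
  have hti0 : 0 ≤ t i := g.nonneg i
  have main : t k / 2 * (c0 * (A * N) ^ m) ≤ P * D / r ^ d := by
    have m1 : t k / 2 * (c0 * (A * N) ^ m) ≤ (t k - t i) * (c0 * (A * N) ^ m) := mlr (by linarith) hX0
    have m2 : (t k - t i) * Q ≤ 2 * Q := mlr (by linarith) hQ0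
    have m3 : P * (Cg + Cp) ≤ P * (Cg + Cp) / r ^ d := by
      rw [le_div_iff₀ hrd]; exact mul_le_of_le_one_right (by positivity) hrd1
    have e : P * D / r ^ d = P * (Cg + Cp) / r ^ d + 2 * (P * (C * (11 ^ d + Cp) + (11 ^ d + Cg)) / r ^ d) := by
      rw [hD]; ring
    rw [e]
    linarith
  rw [hP, Real.mul_rpow (x := c) (by linarith) hN0.le, Real.mul_rpow (x := A) hA.le hN0.le] at main
  have e5 : N ^ m = N ^ (1 - κ) * N ^ (m - 1 + κ) := by rw [← rpow_add hN0]; congr 1; ring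
  rw [e5] at main
  have hNk : 0 < N ^ (1 - κ) := rpow_pos_of_pos hN0 _
  have hAm : 0 < A ^ m := rpow_pos_of_pos hA _
  have main2 : (N ^ (m - 1 + κ) * t k) * (N ^ (1 - κ) * (c0 * A ^ m / 2)) ≤ (2 * c ^ (1 - κ) * D / (c0 * A ^ m) / r ^ d) * (N ^ (1 - κ) * (c0 * A ^ m / 2)) := by
    calc _ = t k / 2 * (c0 * (A ^ m * (N ^ (1 - κ) * N ^ (m - 1 + κ)))) := by ring
      _ ≤ _ := main
      _ = _ := by field_simp
  exact le_of_mul_le_mul_right main2 (by positivity)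
end FDE
namespace FDE
variable {d : ℕ}
theorem nsq_zero (n : ℕ) : nsq n (0 : Fin d → ℤ) = 0 := by simp [nsq]
theorem ev_small {a X K : ℝ} (ha : 0 < a) : ∀ᶠ n : ℕ in atTop, (X / n) ^ a * K ≤ 1 := by
  have h1 : Tendsto (fun n : ℕ => X / (n:ℝ)) atTop (𝓝 0) := tendsto_const_div_atTop_nhds_zero_nat X
  have h2 : Tendsto (fun n : ℕ => (X / (n:ℝ)) ^ a) atTop (𝓝 0) := by
    have := h1.rpow_const (p := a) (Or.inr ha.le)
    rwa [Real.zero_rpow ha.ne'] at this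
  have h3 := h2.mul_const K
  rw [zero_mul] at h3
  exact (h3.eventually_lt_const one_pos).mono fun n h => h.le
set_option maxHeartbeats 1000000 in
theorem lemmaB (hd : 3 ≤ d) {m p : ℝ} (hm : 0 < m) (hm1 : m < 1) (hp : 1 ≤ p) (hpd : d * (1 - m) < 2 * p) :
    ∃ C, 0 < C ∧ ∀ K : ℝ, 1 ≤ K → ∀ᶠ n : ℕ in atTop, ∀ t, Grid n t → ∀ J, t J ≤ 2 → 1 ≤ t J →
      ∀ v : ℕ → (Fin d → ℤ) → ℝ, (∀ k x, 0 ≤ v k x) → (∀ k x, v k x ≤ K) →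
      (∀ k, k < J → ∀ x, nsq n x ≤ 1 → v (k + 1) x ≤ v k x + (t (k + 1) - t k) * (lap n (fun y => v (k + 1) y ^ m) x + 1)) →
      (∀ k, 1 ≤ k → k < J → ∀ x, v (k + 1) x ≤ (1 + 1 / n) ^ (1 / (1 - m)) * v k x) →
      I n (fun y => if nsq n y ≤ 1 then v 0 y ^ p else 0) ≤ 2 →
      v J 0 ≤ C := by
  have hd' : (3:ℝ) ≤ d := by exact_mod_cast hd
  obtain ⟨κ, hκa, hκb⟩ : ∃ κ, 1 - m < κ ∧ κ < min 1 (2 * p / d) :=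
    exists_between (lt_min (by linarith) (by rw [lt_div_iff₀ (by linarith)]; linarith))
  have hκ1 : κ < 1 := hκb.trans_le (min_le_left _ _)
  have hκp : d * κ < 2 * p := by
    have := hκb.trans_le (min_le_right _ _)
    rw [lt_div_iff₀ (by linarith)] at this; linarith
  obtain ⟨Cp, hCp, HL⟩ := Lp_bound (d := d) hm hm1 hp
  set a := 1 / (m - 1 + κ) with ha
  have ha0 : 0 < a := by rw [ha]; apply one_div_pos.2; linarith
  set b := (d:ℝ) * a with hb
  have hb0 : 0 < b := by positivity
  set α := 1 / (1 - m) with hα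
  have hα0 : 0 < α := by rw [hα]; apply one_div_pos.2; linarith
  have hc1 : (1:ℝ) ≤ 4 ^ a * 2 ^ b := by
    have := Real.one_le_rpow (by norm_num : (1:ℝ) ≤ 4) ha0.le
    have := Real.one_le_rpow (by norm_num : (1:ℝ) ≤ 2) hb0.le
    nlinarith
  obtain ⟨C, R0, hC, hR0, HC⟩ := core hd hm hm1 hp hκa hκ1 hκp hc1 (by positivity : (0:ℝ) < 4 ^ (-α)) hCp.le
  set C1 := max (max 1 (2 ^ a)) ((C * 8 ^ d) ^ a) with hC1
  have hC11 : 1 ≤ C1 := (le_max_left _ _).trans (le_max_left _ _)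
  refine ⟨C1 * 4 ^ b, by positivity, fun K hK => ?_⟩
  filter_upwards [HL K hK, ev_small (X := 8) (K := K) ha0, ev_small (X := 8 * R0) (K := 2 ^ a * K) hb0, eventually_ge_atTop 1]
    with n HLn e1 e2 hn t g J hJ2 hJ1 v hv hvK hsub hbc h0
  have hn' : (1:ℝ) ≤ n := by exact_mod_cast hn
  have hLp := HLn t g J hJ2 v hv hvK hsub h0
  have hJ : 1 ≤ J := by
    by_contra hcc
    have : J = 0 := by omega
    rw [this, g.zero] at hJ1; linarith
  set f : ℕ × (Fin d → ℤ) → ℝ := fun q => t q.1 ^ a * (1 / 4 - nsq n q.2) ^ b * v q.1 q.2 with hf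
  have memS : ∀ y : Fin d → ℤ, nsq n y < 1 / 4 → y ∈ (S n).filter (fun y => nsq n y < 1 / 4) := fun y hy =>
    Finset.mem_filter.2 ⟨mem_S hn (by linarith), hy⟩
  obtain ⟨⟨k, x⟩, hkx, hmax⟩ := Finset.exists_max_image ((Finset.Icc 1 J) ×ˢ ((S (d := d) n).filter (fun y => nsq n y < 1 / 4))) f
    ⟨(J, 0), Finset.mk_mem_product (Finset.mem_Icc.2 ⟨hJ, le_rfl⟩) (memS 0 (by rw [nsq_zero]; norm_num))⟩
  rw [Finset.mem_product, Finset.mem_Icc, Finset.mem_filter] at hkx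
  obtain ⟨⟨hk1, hkJ⟩, hxS, hx4⟩ := hkx
  simp only at hk1 hkJ hxS hx4
  set ω := 1 / 4 - nsq n x with hω
  have hω0 : 0 < ω := by linarith
  have hω1 : ω ≤ 1 / 4 := by have := nsq_nonneg n x; linarith
  have htk0 : 0 < t k := g.tpos k hk1
  have htk2 : t k ≤ 2 := (g.mono hkJ).trans hJ2
  set N := v k x with hN
  have hωb1 : ω ^ b ≤ 1 := rpow_le_one hω0.le (by linarith) hb0.le
  have hωb0 : 0 ≤ ω ^ b := rpow_nonneg hω0.le _
  have hta2 : t k ^ a ≤ 2 ^ a := rpow_le_rpow htk0.le htk2 ha0.le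
  have hta0 : 0 ≤ t k ^ a := rpow_nonneg htk0.le _
  have hY : f (k, x) ≤ C1 := by
    change t k ^ a * ω ^ b * N ≤ C1
    rcases lt_or_ge (t k) (4 * t 1) with c1 | c1
    · have : t k ^ a ≤ (8 / n) ^ a := by
        refine rpow_le_rpow htk0.le ?_ ha0.le
        have := g.small
        have e : (8:ℝ) / n = 4 * (2 / n) := by ring
        linarith
      calc t k ^ a * ω ^ b * N ≤ (8 / n) ^ a * 1 * K := by
            refine mul_le_mul (mul_le_mul this hωb1 hωb0 (rpow_nonneg (by positivity) _)) (hvK k x) (hv k x) ?_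
            exact mul_nonneg (rpow_nonneg (by positivity) _) zero_le_one
        _ ≤ 1 := by rw [mul_one]; exact e1
        _ ≤ C1 := hC11
    rcases lt_or_ge ω (8 * R0 / n) with c2 | c2
    · have : ω ^ b ≤ (8 * R0 / n) ^ b := rpow_le_rpow hω0.le c2.le hb0.le
      have hz : (0:ℝ) ≤ (8 * R0 / n) ^ b := rpow_nonneg (by positivity) _
      calc t k ^ a * ω ^ b * N ≤ 2 ^ a * (8 * R0 / n) ^ b * K :=
            mul_le_mul (mul_le_mul hta2 this hωb0 (by positivity)) (hvK k x) (hv k x) (by positivity)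
        _ = (8 * R0 / n) ^ b * (2 ^ a * K) := by ring
        _ ≤ 1 := e2
        _ ≤ C1 := hC11
    rcases le_or_gt N 1 with c3 | c3
    · calc t k ^ a * ω ^ b * N ≤ 2 ^ a * 1 * 1 := mul_le_mul (mul_le_mul hta2 hωb1 hωb0 (by positivity)) c3 (hv k x) (by positivity)
        _ ≤ C1 := by rw [mul_one, mul_one]; exact (le_max_right _ _).trans (le_max_left _ _)
    obtain ⟨i, hi1, hik, hti4, hti2⟩ := g.ex_mid hn c1
    have hloc : ∀ y : Fin d → ℤ, nsq n (y - x) ≤ 4 * (ω / 8) ^ 2 → ω / 2 ≤ 1 / 4 - nsq n y := by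
      intro y hy
      have h1 := nsq_young n x y hω0
      have h2 : (1 + 1 / ω) * nsq n (y - x) ≤ (1 + 1 / ω) * (4 * (ω / 8) ^ 2) := mll hy (by positivity)
      have h3 : (1 + 1 / ω) * (4 * (ω / 8) ^ 2) = ω ^ 2 / 16 + ω / 16 := by field_simp; ring
      have h4 : nsq n x = 1 / 4 - ω := by rw [hω]; ring
      rw [h3] at h2
      rw [h4] at h1
      have h5 : (1 + ω) * (1 / 4 - ω) = 1 / 4 - 3 / 4 * ω - ω ^ 2 := by ring
      rw [h5] at h1
      have h6 := sq_nonneg ω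
      linarith
    have key := HC n hn x hxS (ω / 8) (by linarith) (by
        rw [div_le_iff₀ (by linarith)] at c2; linarith) N c3.le t g i k hik.le hti2 htk2 v hv
      (fun y hy => by have := hloc y hy; linarith)
      (fun j _ hj => hsub j (by omega))
      (fun j hj hjk => by
        have h1 := bc_chain g (w := fun j => v j x) (α := α) (fun k hk1 hk2 => hbc k hk1 hk2 x) (by omega : 1 ≤ j) hjk hkJ
        have h2 : (t k / t j) ^ α ≤ 4 ^ α := by
          refine rpow_le_rpow (div_nonneg (g.nonneg _) (g.nonneg _)) ?_ hα0.le
          rw [div_le_iff₀ (g.tpos j (by omega))]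
          have := g.mono hj.le; linarith
        have h3 := h1.trans (mlr h2 (hv j x))
        rw [rpow_neg (by norm_num), inv_mul_le_iff₀ (by positivity)]
        exact h3)
      (fun j hj hjk y hy => by
        have h1 := hloc y hy
        have hy4 : nsq n y < 1 / 4 := by linarith
        have h2 := hmax (j, y) (Finset.mk_mem_product (Finset.mem_Icc.2 ⟨by omega, by omega⟩) (memS y hy4))
        change t j ^ a * (1 / 4 - nsq n y) ^ b * v j y ≤ t k ^ a * ω ^ b * N at h2
        have h3 : (t k / 4) ^ a ≤ t j ^ a := rpow_le_rpow (by positivity) (hti4.trans (g.mono hj)) ha0.le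
        have h4 : (ω / 2) ^ b ≤ (1 / 4 - nsq n y) ^ b := rpow_le_rpow (by positivity) h1 hb0.le
        have h5 : (t k / 4) ^ a * (ω / 2) ^ b * v j y ≤ t k ^ a * ω ^ b * N :=
          (mlr (mul_le_mul h3 h4 (by positivity) (rpow_nonneg (g.nonneg j) _)) (hv j y)).trans h2
        rw [Real.div_rpow htk0.le (by norm_num), Real.div_rpow hω0.le (by norm_num)] at h5
        have p1 : 0 < t k ^ a := rpow_pos_of_pos htk0 _
        have p2 : 0 < ω ^ b := rpow_pos_of_pos hω0 _
        have h6 : v j y * (t k ^ a * ω ^ b / (4 ^ a * 2 ^ b)) ≤ 4 ^ a * 2 ^ b * N * (t k ^ a * ω ^ b / (4 ^ a * 2 ^ b)) := by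
          calc _ = t k ^ a / 4 ^ a * (ω ^ b / 2 ^ b) * v j y := by ring
            _ ≤ _ := h5
            _ = _ := by field_simp
        exact le_of_mul_le_mul_right h6 (by positivity))
      (fun j hj hjk => by
        refine (I_mono fun y _ => ?_).trans (hLp j (by omega))
        by_cases h : nsq n (y - x) ≤ 4 * (ω / 8) ^ 2
        · have := hloc y h
          rw [if_pos h, if_pos (by linarith)]
        · rw [if_neg h]
          split_ifs
          · exact rpow_nonneg (hv j y) _
          · exact le_rfl)
    have hN0 : 0 < N := by linarith
    have e3 : N ^ (m - 1 + κ) * t k * ω ^ d ≤ C * 8 ^ d := by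
      rw [div_pow, le_div_iff₀ (by positivity)] at key
      have : N ^ (m - 1 + κ) * t k * (ω ^ d / 8 ^ d) * 8 ^ d ≤ C * 8 ^ d := mlr key (by positivity)
      calc _ = N ^ (m - 1 + κ) * t k * (ω ^ d / 8 ^ d) * 8 ^ d := by field_simp
        _ ≤ _ := this
    have p3 : 0 ≤ N ^ (m - 1 + κ) := rpow_nonneg hN0.le _
    have e4 := rpow_le_rpow (by positivity) e3 ha0.le
    rw [Real.mul_rpow (by positivity) (by positivity), Real.mul_rpow p3 htk0.le, ← rpow_mul hN0.le, ← rpow_natCast ω d,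
      ← rpow_mul hω0.le, ← hb] at e4
    have e5 : (m - 1 + κ) * a = 1 := by rw [ha]; field_simp; exact div_self (by linarith)
    rw [e5, rpow_one] at e4
    calc _ = N * t k ^ a * ω ^ b := by ring
      _ ≤ _ := e4
      _ ≤ C1 := le_max_right _ _
  have hfin := (hmax (J, 0) (Finset.mk_mem_product (Finset.mem_Icc.2 ⟨hJ, le_rfl⟩) (memS 0 (by rw [nsq_zero]; norm_num)))).trans hY
  change t J ^ a * (1 / 4 - nsq n 0) ^ b * v J 0 ≤ C1 at hfin
  rw [nsq_zero, sub_zero, Real.div_rpow zero_le_one (by norm_num), Real.one_rpow] at hfin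
  have h1 : 1 ≤ t J ^ a := Real.one_le_rpow hJ1 ha0.le
  have p4 : (0:ℝ) < 4 ^ b := by positivity
  have : v J 0 / 4 ^ b ≤ C1 := by
    refine le_trans ?_ hfin
    rw [div_eq_mul_one_div, mul_comm, mul_assoc]
    exact le_mul_of_one_le_left (mul_nonneg (by positivity) (hv J 0)) h1
  rwa [div_le_iff₀ p4] at this
end FDE
namespace FDE
variable {d : ℕ}
theorem mass_step {m ρ : ℝ} (hm : 0 < m) (hm1 : m < 1) (hρ : 0 < ρ) (hρ16 : ρ ≤ 16) (b : ℕ) (hb : 1 ≤ ((b:ℝ) + 2) * (1 - m)) :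
    ∃ C, 0 < C ∧ ∀ n : ℕ, 1 ≤ n → ∀ (v w : (Fin d → ℤ) → ℝ) (τ δ e : ℝ), 0 ≤ τ → 0 < δ → 0 ≤ e → e * 11 ^ d ≤ δ ^ m →
      (∀ x, 0 ≤ v x) → (∀ x, 0 ≤ w x) →
      (∀ x, nsq n x < ρ → w x + τ * (lap n (fun y => v y ^ m) x - e) ≤ v x) →
      (I n (fun y => cut ρ b n y * w y) + δ) ^ (1 - m) ≤ (I n (fun y => cut ρ b n y * v y) + δ) ^ (1 - m) + C * τ := by
  set C1 := 2 * d * (b + 2) / ρ with hC1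
  have hC10 : 0 ≤ C1 := by positivity
  set C2 := C1 * ((1 - m) * 11 ^ d + m) + 1 with hC2
  have h11 : (1:ℝ) ≤ 11 ^ d := one_le_pow₀ (by norm_num)
  have hA0 : 0 ≤ (1 - m) * 11 ^ d + m := by
    have := mul_nonneg (by linarith : 0 ≤ 1 - m) (by linarith : (0:ℝ) ≤ 11 ^ d); linarith
  have hC20 : 0 < C2 := by have := mul_nonneg hC10 hA0; linarith
  refine ⟨(1 - m) * C2, mul_pos (by linarith) hC20, ?_⟩
  intro n hn v w τ δ e hτ hδ he heδ hv hw h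
  set ψ : (Fin d → ℤ) → ℝ := cut ρ b n with hψ
  have hψ0 : ∀ y, 0 ≤ ψ y := cut_nonneg ρ b n
  have hψ1 : ∀ y, ψ y ≤ 1 := cut_le_one hρ b n
  set M := I n (fun y => ψ y * v y) with hM
  have hM0 : 0 ≤ M := I_nonneg fun y _ => mul_nonneg (hψ0 y) (hv y)
  set l := M + δ with hl
  have hl0 : 0 < l := by linarith
  have s1 : I n (fun y => ψ y * w y) + τ * (I n (fun y => ψ y * lap n (fun y => v y ^ m) y) - e * 11 ^ d) ≤ M := by
    have pt : ∀ y ∈ S n, ψ y * w y + τ * (ψ y * lap n (fun y => v y ^ m) y - e) ≤ ψ y * v y := by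
      intro y _
      by_cases h0 : ψ y = 0
      · rw [h0]; have := mul_nonneg hτ he; simp; linarith
      · have h1 := mll (h y (nsq_of_cut_ne hρ h0)) (hψ0 y)
        have h2 := mul_nonneg (mul_nonneg hτ he) (sub_nonneg.2 (hψ1 y))
        nlinarith
    have := I_mono pt
    rw [I_add, I_mul, I_sub] at this
    have h3 := I_const_le (d := d) hn he
    have h4 := mll h3 hτ
    linarith
  have s2 : -(C1 * (((1 - m) * 11 ^ d + m) * l ^ m)) ≤ I n (fun y => ψ y * lap n (fun y => v y ^ m) y) := by
    rw [← sbp hn (fun y => v y ^ m) ψ (fun y hy => (nsq_of_cut_ne hρ hy).le.trans hρ16)]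
    have pt : ∀ y ∈ S n, (-C1) * (l ^ m * (1 - m) + m * l ^ (m - 1) * (ψ y * v y)) ≤ v y ^ m * lap n ψ y := by
      intro y _
      have hvm : 0 ≤ v y ^ m := rpow_nonneg (hv y) _
      have h1 := cut_lap_lower hρ b hn y
      set B := max (1 - nsq n y / ρ) 0 with hB
      have hB0 : 0 ≤ B := le_max_right _ _
      have hB1 : B ≤ 1 := cut_base_le_one hρ n y
      have h2 : B ^ (b + 1) ≤ ψ y ^ m := by
        have e1 : ψ y ^ m = B ^ (((b + 2 : ℕ) : ℝ) * m) := by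
          rw [rpow_mul hB0, rpow_natCast]; rfl
        rw [e1, ← rpow_natCast B (b + 1)]
        refine rpow_le_rpow_of_exponent_ge_of_imp hB0 hB1 (by push_cast; linarith) (fun _ h0 => ?_)
        exfalso
        have h7 : 0 < ((b + 2 : ℕ) : ℝ) * m := by positivity
        push_cast at h0
        have : (0:ℝ) ≤ b := by positivity
        linarith
      have h3 : v y ^ m * B ^ (b + 1) ≤ (ψ y * v y) ^ m := by
        rw [Real.mul_rpow (hψ0 y) (hv y), mul_comm (ψ y ^ m)]
        exact mll h2 hvm
      have h4 := conc_tangent hm.le hm1.le hl0 (mul_nonneg (hψ0 y) (hv y))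
      have e2 : l ^ (m - 1) * l = l ^ m := by
        rw [rpow_sub_one hl0.ne']; field_simp
      have h5 : v y ^ m * B ^ (b + 1) ≤ l ^ m * (1 - m) + m * l ^ (m - 1) * (ψ y * v y) := by
        have : m * l ^ (m - 1) * (ψ y * v y - l) = m * l ^ (m - 1) * (ψ y * v y) - m * l ^ m := by
          rw [← e2]; ring
        linarith
      have h6 := mll h1 hvm
      have h7 := mll h5 hC10
      calc _ ≤ -(C1 * (v y ^ m * B ^ (b + 1))) := by linarith
        _ = v y ^ m * -(C1 * B ^ (b + 1)) := by ring
        _ ≤ _ := h6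
    refine le_trans ?_ (I_mono pt)
    rw [I_mul, I_add, I_mul n (m * l ^ (m - 1))]
    have hlm : 0 ≤ l ^ m * (1 - m) := mul_nonneg (rpow_nonneg hl0.le _) (by linarith)
    have h8 := I_const_le (d := d) hn hlm
    have e2 : l ^ (m - 1) * l = l ^ m := by
      rw [rpow_sub_one hl0.ne']; field_simp
    have h9 : m * l ^ (m - 1) * M ≤ m * l ^ m := by
      rw [← e2, ← mul_assoc]
      exact mll (by linarith) (mul_nonneg hm.le (rpow_nonneg hl0.le _))
    have h10 := mll (add_le_add h8 h9) hC10
    rw [← hM]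
    linarith
  have hδl : δ ^ m ≤ l ^ m := rpow_le_rpow hδ.le (by linarith) hm.le
  have s3 : I n (fun y => ψ y * w y) + δ ≤ l + τ * (C2 * l ^ m) := by
    have := mll (by linarith : C1 * (((1 - m) * 11 ^ d + m) * l ^ m) + e * 11 ^ d ≤ C2 * l ^ m) hτ
    have := mll s2 hτ
    linarith
  have hw0 : 0 ≤ I n (fun y => ψ y * w y) := I_nonneg fun y _ => mul_nonneg (hψ0 y) (hw y)
  have s4 := rpow_le_rpow (by linarith) s3 (by linarith : 0 ≤ 1 - m)
  refine s4.trans ?_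
  have hx0 : 0 ≤ τ * C2 * l ^ (m - 1) := by positivity
  have e3 : l + τ * (C2 * l ^ m) = l * (1 + τ * C2 * l ^ (m - 1)) := by
    rw [rpow_sub_one hl0.ne']; field_simp
  rw [e3, Real.mul_rpow hl0.le (by linarith)]
  have s5 := rpow_one_add_le_one_add_mul_self (s := τ * C2 * l ^ (m - 1)) (by linarith) (by linarith : 0 ≤ 1 - m) (by linarith)
  have s6 := mll s5 (rpow_nonneg hl0.le (1 - m))
  refine s6.trans (le_of_eq ?_)
  have e4 : l ^ (1 - m) * l ^ (m - 1) = 1 := by rw [← rpow_add hl0]; simp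
  calc _ = l ^ (1 - m) + (1 - m) * τ * C2 * (l ^ (1 - m) * l ^ (m - 1)) := by ring
    _ = _ := by rw [e4]; ring
theorem lemmaA {m ρ : ℝ} (hm : 0 < m) (hm1 : m < 1) (hρ : 1 < ρ) (hρ16 : ρ ≤ 16) :
    ∃ c C, 0 < c ∧ 0 < C ∧ ∀ n : ℕ, 1 ≤ n → ∀ (t : ℕ → ℝ), Grid n t → ∀ (J : ℕ) (v : ℕ → (Fin d → ℤ) → ℝ) (δ e : ℝ), 0 < δ → 0 ≤ e →
      e * 11 ^ d ≤ δ ^ m → (∀ k x, 0 ≤ v k x) →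
      (∀ k, k < J → ∀ x, nsq n x < ρ → v k x + (t (k + 1) - t k) * (lap n (fun y => v (k + 1) y ^ m) x - e) ≤ v (k + 1) x) →
      (c * I n (fun y => if nsq n y < 1 then v 0 y else 0)) ^ (1 - m) ≤
        (I n (fun y => if nsq n y < ρ then v J y else 0) + δ) ^ (1 - m) + C * t J := by
  obtain ⟨b, hb⟩ := exists_nat_ge (1 / (1 - m))
  have hb' : 1 ≤ ((b:ℝ) + 2) * (1 - m) := by
    rw [div_le_iff₀ (by linarith)] at hb; nlinarith
  have hρ0 : 0 < ρ := by linarith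
  obtain ⟨C, hC, H⟩ := mass_step (d := d) hm hm1 hρ0 hρ16 b hb'
  have hρ1 : 0 < 1 - 1 / ρ := by
    have : 1 / ρ < 1 := by rw [div_lt_one hρ0]; exact hρ
    linarith
  refine ⟨(1 - 1 / ρ) ^ (b + 2), C, by positivity, hC, ?_⟩
  intro n hn t g J v δ e hδ he heδ hv h
  have key : ∀ k, k ≤ J → (I n (fun y => cut ρ b n y * v 0 y) + δ) ^ (1 - m) ≤ (I n (fun y => cut ρ b n y * v k y) + δ) ^ (1 - m) + C * t k := by
    intro k
    induction k with
    | zero => intro _; rw [g.zero]; simp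
    | succ k ih =>
      intro hk
      have h1 := ih (by omega)
      have h2 := H n hn (v (k + 1)) (v k) _ δ e (sub_nonneg.2 (g.le_succ k)) hδ he heδ (hv _) (hv _) (h k (by omega))
      linarith
  have hk := key J le_rfl
  have i0 : (1 - 1 / ρ) ^ (b + 2) * I n (fun y => if nsq n y < 1 then v 0 y else 0) ≤ I n (fun y => cut ρ b n y * v 0 y) := by
    rw [← I_mul]
    refine I_mono fun y _ => ?_
    split_ifs with h1
    · refine mlr (pow_le_pow_left₀ hρ1.le ?_ _) (hv 0 y)
      refine le_trans ?_ (le_max_left _ _)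
      have : nsq n y / ρ ≤ 1 / ρ := by gcongr
      linarith
    · rw [mul_zero]; exact mul_nonneg (cut_nonneg _ _ _ _) (hv 0 y)
  have i1 : I n (fun y => cut ρ b n y * v J y) ≤ I n (fun y => if nsq n y < ρ then v J y else 0) := by
    refine I_mono fun y _ => ?_
    split_ifs with h1
    · exact mul_le_of_le_one_left (hv J y) (cut_le_one hρ0 _ _ _)
    · rw [cut_eq_zero hρ0 b (not_lt.1 h1), zero_mul]
  have n0 : 0 ≤ I n (fun y => if nsq n y < 1 then v 0 y else 0) := I_nonneg fun y _ => by
    split_ifs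
    · exact hv 0 y
    · exact le_rfl
  have n1 : 0 ≤ I n (fun y => cut ρ b n y * v J y) := I_nonneg fun y _ => mul_nonneg (cut_nonneg _ _ _ _) (hv J y)
  have j0 := rpow_le_rpow (mul_nonneg (by positivity) n0) (i0.trans (by linarith : _ ≤ I n (fun y => cut ρ b n y * v 0 y) + δ)) (by linarith : 0 ≤ 1 - m)
  have j1 := rpow_le_rpow (by linarith) (add_le_add i1 (le_refl δ)) (by linarith : 0 ≤ 1 - m)
  linarith
end FDE
namespace FDE
variable {d : ℕ}
theorem scalar_inv {m Λ : ℝ} (hm : 0 < m) (hΛ : 0 ≤ Λ) :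
    ∃ G : ℝ → ℝ, ∀ s, 0 ≤ s → 0 ≤ G s ∧ G s ^ (1 / m) + Λ * G s = s := by
  have h : ∀ s : ℝ, 0 ≤ s → ∃ x, 0 ≤ x ∧ x ^ (1 / m) + Λ * x = s := by
    intro s hs
    have hc : ContinuousOn (fun x : ℝ => x ^ (1 / m) + Λ * x) (Icc 0 (s ^ m)) := by
      have : Continuous (fun x : ℝ => x ^ (1 / m) + Λ * x) :=
        (continuous_id.rpow_const fun x => Or.inr (by positivity)).add (continuous_const.mul continuous_id)
      exact this.continuousOn
    have hsm : 0 ≤ s ^ m := rpow_nonneg hs _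
    have hmem : s ∈ Icc ((0:ℝ) ^ (1 / m) + Λ * 0) ((s ^ m) ^ (1 / m) + Λ * s ^ m) := by
      constructor
      · rw [mul_zero, add_zero, Real.zero_rpow (by positivity)]; exact hs
      · rw [← rpow_mul hs, mul_one_div_cancel hm.ne', rpow_one]
        have := mul_nonneg hΛ hsm; linarith
    obtain ⟨x, hx, he⟩ := intermediate_value_Icc hsm hc hmem
    exact ⟨x, hx.1, he⟩
  choose! G hG using h
  exact ⟨G, hG⟩
theorem scalar_mono {m Λ : ℝ} (hm : 0 < m) (hΛ : 0 ≤ Λ) {x y : ℝ} (hy : 0 ≤ y)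
    (h : x ^ (1 / m) + Λ * x ≤ y ^ (1 / m) + Λ * y) : x ≤ y := by
  by_contra hc
  have hc := not_le.1 hc
  have h1 := rpow_lt_rpow hy hc (by positivity : 0 < 1 / m)
  have h2 := mll hc.le hΛ
  linarith
theorem dir_step {n : ℕ} {m τ M : ℝ} (hm : 0 < m) (hτ : 0 ≤ τ) (b : (Fin d → ℤ) → ℝ) (hb : ∀ x, 0 ≤ b x) (hbM : ∀ x, b x ≤ M) :
    ∃ V : (Fin d → ℤ) → ℝ, (∀ x, 0 ≤ V x) ∧ (∀ x, V x ≤ M) ∧ (∀ x, 16 ≤ nsq n x → V x = 0) ∧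
      ∀ x, nsq n x < 16 → V x = b x + τ * lap n (fun y => V y ^ m) x := by
  set Λ : ℝ := τ * n ^ 2 * (2 * d) with hΛ
  have hΛ0 : 0 ≤ Λ := by positivity
  have hM : 0 ≤ M := (hb 0).trans (hbM 0)
  obtain ⟨G, hG⟩ := scalar_inv hm hΛ0
  set B : ((Fin d → ℤ) → ℝ) → (Fin d → ℤ) → ℝ := fun w x =>
    b x + τ * n ^ 2 * ∑ i : Fin d, (w (x + Pi.single i 1) + w (x - Pi.single i 1)) with hB
  set T : ((Fin d → ℤ) → ℝ) → (Fin d → ℤ) → ℝ := fun w x => if nsq n x < 16 then G (B w x) else 0 with hT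
  have hB0 : ∀ w, (∀ x, 0 ≤ w x) → ∀ x, 0 ≤ B w x := fun w hw x =>
    add_nonneg (hb x) (mul_nonneg (by positivity) (sum_nonneg fun i _ => add_nonneg (hw _) (hw _)))
  have hBmono : ∀ w w', (∀ x, w x ≤ w' x) → ∀ x, B w x ≤ B w' x := fun w w' h x =>
    add_le_add le_rfl (mll (sum_le_sum fun i _ => add_le_add (h _) (h _)) (by positivity))
  set W : ℕ → (Fin d → ℤ) → ℝ := fun k => T^[k] 0 with hW
  have hWs : ∀ k, W (k + 1) = T (W k) := fun k => Function.iterate_succ_apply' T k 0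
  have hMm : 0 ≤ M ^ m := rpow_nonneg hM _
  have W0 : ∀ k x, 0 ≤ W k x := by
    intro k
    induction k with
    | zero => intro x; exact le_rfl
    | succ k ih =>
      intro x; rw [hWs]; simp only [hT]
      split_ifs
      · exact (hG _ (hB0 _ ih x)).1
      · exact le_rfl
  have WM : ∀ k x, W k x ≤ M ^ m := by
    intro k
    induction k with
    | zero => intro x; exact hMm
    | succ k ih =>
      intro x; rw [hWs]; simp only [hT]
      split_ifs
      · refine scalar_mono hm hΛ0 hMm ?_
        rw [(hG _ (hB0 _ (W0 k) x)).2, ← rpow_mul hM, mul_one_div_cancel hm.ne', rpow_one]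
        refine (hBmono _ (fun _ => M ^ m) ih x).trans ?_
        simp only [hB, sum_const, card_univ, Fintype.card_fin, nsmul_eq_mul]
        have := hbM x
        have : τ * n ^ 2 * (d * (M ^ m + M ^ m)) = Λ * M ^ m := by rw [hΛ]; ring
        linarith
      · exact hMm
  have Wmono : ∀ k x, W k x ≤ W (k + 1) x := by
    intro k
    induction k with
    | zero => intro x; exact W0 1 x
    | succ k ih =>
      intro x
      by_cases hx : nsq n x < 16
      · have hp : ∀ k, W (k + 1) x = G (B (W k) x) := fun k => by
          rw [hWs]; simp only [hT]; rw [if_pos hx]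
        rw [hp k, hp (k + 1)]
        refine scalar_mono hm hΛ0 (hG _ (hB0 _ (W0 _) x)).1 ?_
        rw [(hG _ (hB0 _ (W0 _) x)).2, (hG _ (hB0 _ (W0 _) x)).2]
        exact hBmono _ _ ih x
      · have hp : ∀ k, W (k + 1) x = 0 := fun k => by
          rw [hWs]; simp only [hT]; rw [if_neg hx]
        rw [hp k, hp (k + 1)]
  have hlim : ∀ x, ∃ l, Tendsto (fun k => W k x) atTop (𝓝 l) := fun x =>
    ⟨_, tendsto_atTop_ciSup (monotone_nat_of_le_succ fun k => Wmono k x) ⟨M ^ m, by rintro _ ⟨k, rfl⟩; exact WM k x⟩⟩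
  choose L hL using hlim
  have L0 : ∀ x, 0 ≤ L x := fun x => ge_of_tendsto' (hL x) fun k => W0 k x
  have LM : ∀ x, L x ≤ M ^ m := fun x => le_of_tendsto' (hL x) fun k => WM k x
  have e1 : ∀ x, (L x ^ (1 / m)) ^ m = L x := fun x => by
    rw [← rpow_mul (L0 x), one_div_mul_cancel hm.ne', rpow_one]
  refine ⟨fun x => L x ^ (1 / m), fun x => rpow_nonneg (L0 x) _, fun x => ?_, fun x hx => ?_, fun x hx => ?_⟩
  · have := rpow_le_rpow (L0 x) (LM x) (by positivity : 0 ≤ 1 / m)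
    rwa [← rpow_mul hM, mul_one_div_cancel hm.ne', rpow_one] at this
  · have : L x = 0 := tendsto_nhds_unique (hL x) (by
      refine tendsto_const_nhds.congr fun k => ?_
      cases k with
      | zero => rfl
      | succ k => rw [hWs]; simp only [hT]; rw [if_neg (not_lt.2 hx)])
    simp only [this]; exact Real.zero_rpow (by positivity)
  · simp only [e1]
    have t1 : Tendsto (fun k => W (k + 1) x ^ (1 / m) + Λ * W (k + 1) x) atTop (𝓝 (L x ^ (1 / m) + Λ * L x)) := by
      have h1 := (hL x).comp (tendsto_add_atTop_nat 1)
      exact (h1.rpow_const (Or.inr (by positivity))).add (h1.const_mul Λ)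
    have t2 : Tendsto (fun k => B (W k) x) atTop (𝓝 (B L x)) := by
      refine tendsto_const_nhds.add (Tendsto.const_mul _ (tendsto_finsetSum _ fun i _ => (hL _).add (hL _)))
    have e2 : ∀ k, W (k + 1) x ^ (1 / m) + Λ * W (k + 1) x = B (W k) x := fun k => by
      have : W (k + 1) x = G (B (W k) x) := by rw [hWs]; simp only [hT]; rw [if_pos hx]
      rw [this]; exact (hG _ (hB0 _ (W0 k) x)).2
    have e3 := tendsto_nhds_unique (t1.congr e2) t2
    simp only [hB] at e3
    unfold lap
    have e4 : ∑ i : Fin d, (L (x + Pi.single i 1) + L (x - Pi.single i 1) - 2 * L x)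
        = ∑ i : Fin d, (L (x + Pi.single i 1) + L (x - Pi.single i 1)) - 2 * d * L x := by
      rw [sum_sub_distrib]; simp; ring
    rw [e4]
    rw [hΛ] at e3
    linarith
structure Dir (n : ℕ) (m M : ℝ) (t : ℕ → ℝ) (V : ℕ → (Fin d → ℤ) → ℝ) : Prop where
  nonneg : ∀ k x, 0 ≤ V k x
  le : ∀ k x, V k x ≤ M
  zero : ∀ k x, 16 ≤ nsq n x → V k x = 0
  eq : ∀ k x, nsq n x < 16 → V (k + 1) x = V k x + (t (k + 1) - t k) * lap n (fun y => V (k + 1) y ^ m) x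
theorem dir_exists {n : ℕ} {m M : ℝ} (hm : 0 < m) {t : ℕ → ℝ} (ht : ∀ k, t k ≤ t (k + 1)) (g : (Fin d → ℤ) → ℝ)
    (hg : ∀ x, 0 ≤ g x) (hgM : ∀ x, g x ≤ M) (hg0 : ∀ x, 16 ≤ nsq n x → g x = 0) :
    ∃ V, V 0 = g ∧ Dir n m M t V := by
  have st : ∀ (k : ℕ) (b : {b : (Fin d → ℤ) → ℝ // (∀ x, 0 ≤ b x) ∧ (∀ x, b x ≤ M) ∧ (∀ x, 16 ≤ nsq n x → b x = 0)}),
      ∃ V : {b : (Fin d → ℤ) → ℝ // (∀ x, 0 ≤ b x) ∧ (∀ x, b x ≤ M) ∧ (∀ x, 16 ≤ nsq n x → b x = 0)},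
      ∀ x, nsq n x < 16 → V.1 x = b.1 x + (t (k + 1) - t k) * lap n (fun y => V.1 y ^ m) x := by
    intro k b
    obtain ⟨V, h1, h2, h3, h4⟩ := dir_step (n := n) hm (sub_nonneg.2 (ht k)) b.1 b.2.1 b.2.2.1
    exact ⟨⟨V, h1, h2, h3⟩, h4⟩
  choose F hF using st
  let V : ℕ → {b : (Fin d → ℤ) → ℝ // (∀ x, 0 ≤ b x) ∧ (∀ x, b x ≤ M) ∧ (∀ x, 16 ≤ nsq n x → b x = 0)} :=
    fun k => Nat.rec ⟨g, hg, hgM, hg0⟩ (fun k b => F k b) k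
  refine ⟨fun k => (V k).1, rfl, fun k => (V k).2.1, fun k => (V k).2.2.1, fun k => (V k).2.2.2, fun k x hx => hF k (V k) x hx⟩
theorem Dir.sub {n : ℕ} {m M : ℝ} (hm : 0 < m) {t : ℕ → ℝ} (g : Grid n t) {V : ℕ → (Fin d → ℤ) → ℝ} (D : Dir n m M t V) (k : ℕ) (x : Fin d → ℤ) :
    V (k + 1) x ≤ V k x + (t (k + 1) - t k) * lap n (fun y => V (k + 1) y ^ m) x := by
  rcases lt_or_ge (nsq n x) 16 with h | h
  · exact (D.eq k x h).le
  · rw [D.zero _ x h]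
    refine add_nonneg (D.nonneg k x) (mul_nonneg (sub_nonneg.2 (g.le_succ k)) ?_)
    unfold lap
    refine mul_nonneg (by positivity) (sum_nonneg fun i _ => ?_)
    beta_reduce
    rw [D.zero _ x h, Real.zero_rpow hm.ne']
    have := rpow_nonneg (D.nonneg (k + 1) (x + Pi.single i 1)) m
    have := rpow_nonneg (D.nonneg (k + 1) (x - Pi.single i 1)) m
    linarith
theorem Dir.bc {n : ℕ} (hn : 1 ≤ n) {m M : ℝ} (hm : 0 < m) (hm1 : m < 1) {t : ℕ → ℝ} (g : Grid n t) {V : ℕ → (Fin d → ℤ) → ℝ} (D : Dir n m M t V) :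
    ∀ k, 1 ≤ k → ∀ x, V (k + 1) x ≤ (1 + 1 / n) ^ (1 / (1 - m)) * V k x := by
  set q : ℝ := 1 + 1 / n with hq
  have hn' : (1:ℝ) ≤ n := by exact_mod_cast hn
  have hq1 : 1 ≤ q := by have : (0:ℝ) ≤ 1 / n := by positivity
                         linarith
  have hq0 : 0 < q := by linarith
  set α := 1 / (1 - m) with hα
  have hm' : 0 < 1 - m := by linarith
  have hα1 : 1 ≤ α := by rw [hα, one_le_div hm']; linarith
  have hqα : 0 < q ^ α := rpow_pos_of_pos hq0 _
  set Q := (q ^ α) ^ m with hQ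
  have hQq : q ^ α = q * Q := by
    rw [hQ, ← rpow_mul hq0.le]
    nth_rewrite 2 [← rpow_one q]
    rw [← rpow_add hq0]; congr 1; rw [hα]; field_simp; ring
  have hQ1 : 1 ≤ Q := Real.one_le_rpow (Real.one_le_rpow hq1 (by linarith)) hm.le
  have hlap : ∀ k x, lap n (fun y => (q ^ α * V k y) ^ m) x = Q * lap n (fun y => V k y ^ m) x := by
    intro k x
    rw [← lap_smul]
    congr 1; funext y; rw [Real.mul_rpow hqα.le (D.nonneg k y)]
  have comp : ∀ k, (∀ x, nsq n x < 16 → V k x + (t (k + 1) - t k) * (Q * lap n (fun y => V k y ^ m) x) ≤ q ^ α * V k x) →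
      ∀ x, V (k + 1) x ≤ q ^ α * V k x := by
    intro k h
    refine comparison hn hm (sub_nonneg.2 (g.le_succ k)) (D.nonneg _) (fun x => mul_nonneg hqα.le (D.nonneg k x)) (D.zero _)
      (fun x hx => (D.eq k x hx).le) (V' := V k) (Y' := V k) (fun x hx => ?_) (fun x => le_rfl)
    rw [hlap]; exact h x hx
  intro k hk
  induction k, hk using Nat.le_induction with
  | base =>
    refine comp 1 fun x hx => ?_
    have e := D.eq 0 x hx
    rw [g.zero, zero_add, sub_zero] at e
    have e2 : t (1 + 1) - t 1 = (q - 1) * t 1 := by rw [g.step 1 le_rfl, ← hq]; ring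
    rw [e2, hQq]
    have h0 := D.nonneg 0 x
    have h1 := D.nonneg 1 x
    have e3 : t 1 * lap n (fun y => V 1 y ^ m) x = V 1 x - V 0 x := by linarith
    have : (q - 1) * t 1 * (Q * lap n (fun y => V 1 y ^ m) x) = (q - 1) * Q * (V 1 x - V 0 x) := by rw [← e3]; ring
    rw [this]
    have a1 : 0 ≤ (q - 1) * Q * V 0 x := mul_nonneg (mul_nonneg (by linarith) (by linarith)) h0
    have a2 := mul_nonneg (sub_nonneg.2 hQ1) h1
    nlinarith
  | succ k hk ih =>
    refine comp (k + 1) fun x hx => ?_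
    have e := D.eq k x hx
    have e2 : t (k + 1 + 1) - t (k + 1) = q * (t (k + 1) - t k) := by rw [g.step (k + 1) (by omega), g.step k hk, ← hq]; ring
    rw [e2]
    have h := ih x
    have : q ^ α * V (k + 1) x = q ^ α * V k x + q * Q * ((t (k + 1) - t k) * lap n (fun y => V (k + 1) y ^ m) x) := by
      rw [← hQq, e]; ring
    rw [this]
    linarith
end FDE
namespace FDE
variable {d : ℕ}
theorem Grid.formula {n : ℕ} {t : ℕ → ℝ} (g : Grid n t) (k : ℕ) : t (k + 1) = (1 + 1 / n) ^ k * t 1 := by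
  induction k with
  | zero => simp
  | succ k ih => rw [g.step (k + 1) (by omega), ih]; ring
theorem Grid.ex_last {n : ℕ} {t : ℕ → ℝ} (hn : 1 ≤ n) (g : Grid n t) {A : ℝ} (hA : 0 ≤ A) : ∃ k, t k ≤ A ∧ A < t (k + 1) := by
  have hn' : (0:ℝ) < n := by exact_mod_cast hn
  have h : ∃ k, A < t k := by
    have h1 : Tendsto (fun k : ℕ => (1 + 1 / (n:ℝ)) ^ k * t 1) atTop atTop :=
      (tendsto_pow_atTop_atTop_of_one_lt (by have : 0 < 1 / (n:ℝ) := by positivity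
                                             linarith)).atTop_mul_const g.pos
    obtain ⟨k, hk⟩ := (h1.eventually (eventually_gt_atTop A)).exists
    exact ⟨k + 1, by rw [g.formula]; exact hk⟩
  classical
  have h0 : Nat.find h ≠ 0 := fun h0 => by
    have := Nat.find_spec h
    rw [h0, g.zero] at this; linarith
  obtain ⟨k, hk⟩ := Nat.exists_eq_succ_of_ne_zero h0
  refine ⟨k, not_lt.1 (Nat.find_min h (by omega)), ?_⟩
  have := Nat.find_spec h
  rwa [hk] at this
theorem Grid.ex_J {n : ℕ} {t : ℕ → ℝ} (hn : 2 ≤ n) (g : Grid n t) : ∃ J, 1 ≤ t J ∧ t J ≤ 2 := by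
  obtain ⟨k, h1, h2⟩ := g.ex_last (by omega) (zero_le_one)
  refine ⟨k + 1, h2.le, ?_⟩
  have := g.tau_le (A := 2) le_rfl (k := k) (by linarith)
  have : (2:ℝ) / n ≤ 1 := by
    have : (2:ℝ) ≤ n := by exact_mod_cast hn
    rw [div_le_one (by linarith)]; exact this
  linarith
theorem lap_shift (n : ℕ) (f : (Fin d → ℤ) → ℝ) (x y : Fin d → ℤ) : lap n (fun z => f (z + x)) y = lap n f (y + x) := by
  unfold lap
  congr 1
  refine sum_congr rfl fun i _ => ?_
  have e1 : y + Pi.single i 1 + x = y + x + Pi.single i 1 := by abel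
  have e2 : y - Pi.single i 1 + x = y + x - Pi.single i 1 := by abel
  simp only [e1, e2]
theorem I_shift_le {n : ℕ} (F : (Fin d → ℤ) → ℝ) (hF : ∀ y, 0 ≤ F y) (hS : ∀ y, F y ≠ 0 → y ∈ S n) (x : Fin d → ℤ) :
    I n (fun y => F (y + x)) ≤ I n F := by
  unfold I
  refine div_le_div_of_nonneg_right ?_ (by positivity)
  have h : ∑ y ∈ S n, F (y + x) = ∑ z ∈ (S n).map (addRightEmbedding x), F z := by
    rw [Finset.sum_map]; rfl
  rw [h, ← Finset.sum_filter_ne_zero]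
  refine Finset.sum_le_sum_of_subset_of_nonneg (fun z hz => hS z (Finset.mem_filter.1 hz).2) fun i _ _ => hF i
theorem dir_upper (hd : 3 ≤ d) {m p : ℝ} (hm : 0 < m) (hm1 : m < 1) (hp : 1 ≤ p) (hpd : d * (1 - m) < 2 * p) :
    ∃ C, 0 < C ∧ ∀ M : ℝ, 1 ≤ M → ∀ᶠ n : ℕ in atTop, ∀ t, Grid n t → ∀ J, t J ≤ 2 → 1 ≤ t J →
      ∀ V : ℕ → (Fin d → ℤ) → ℝ, Dir n m M t V → I n (fun y => V 0 y ^ p) ≤ 2 → ∀ x, V J x ≤ C := by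
  obtain ⟨C, hC, h⟩ := lemmaB (d := d) hd hm hm1 hp hpd
  refine ⟨C, hC, fun M hM => ?_⟩
  filter_upwards [h M hM, eventually_ge_atTop 1] with n hB hn t g J hJ2 hJ1 V D hI x
  have := hB t g J hJ2 hJ1 (fun k y => V k (y + x)) (fun k y => D.nonneg _ _) (fun k y => D.le _ _) ?_ ?_ ?_
  · simpa using this
  · intro k hk y _
    have := D.sub hm g k (y + x)
    have e := lap_shift n (fun y => V (k + 1) y ^ m) x y
    rw [e]
    have := sub_nonneg.2 (g.le_succ k)
    linarith
  · intro k hk _ y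
    exact D.bc hn hm hm1 g k hk _
  · refine le_trans ?_ hI
    refine le_trans (I_mono (g := fun y => V 0 (y + x) ^ p) fun y _ => ?_)
      (I_shift_le (fun y => V 0 y ^ p) (fun y => rpow_nonneg (D.nonneg _ _) _) (fun y hy => ?_) x)
    · split_ifs
      · exact le_rfl
      · exact rpow_nonneg (D.nonneg _ _) _
    · refine mem_S hn ?_
      by_contra hc
      refine hy ?_
      rw [D.zero 0 y (by linarith), Real.zero_rpow (by linarith)]
theorem dir_extinct (hd : 3 ≤ d) {m p : ℝ} (hm : 0 < m) (hm1 : m < 1) (hp : 1 ≤ p) (hpd : d * (1 - m) < 2 * p) :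
    ∃ T1 : ℝ, 4 ≤ T1 ∧ ∀ M : ℝ, 1 ≤ M → ∀ η' : ℝ, 0 < η' → ∀ᶠ n : ℕ in atTop, ∀ t, Grid n t →
      ∀ V : ℕ → (Fin d → ℤ) → ℝ, Dir n m M t V → I n (fun y => V 0 y ^ p) ≤ 2 →
      ∃ K', t K' ≤ T1 ∧ 2 ≤ t K' ∧ ∀ x, V K' x ≤ η' := by
  obtain ⟨CB, hCB, hU⟩ := dir_upper (d := d) hd hm hm1 hp hpd
  have hm' : 0 < 1 - m := by linarith
  set α := 1 / (1 - m) with hα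
  have hα1 : 1 ≤ α := by rw [hα, one_le_div hm']; linarith
  have hα0 : 0 < α := by linarith
  have hαm : α - 1 = α * m := by rw [hα]; field_simp; ring
  have hd' : (0:ℝ) < d := by exact_mod_cast (by omega : 0 < d)
  set A := α * 2 ^ (α - 1) with hA
  have hA0 : 0 < A := by positivity
  have hγ : 0 < 1 / m - 1 := by rw [sub_pos, one_lt_div hm]; exact hm1
  set w : ℝ := (d / (16 * A)) ^ (1 / (1 / m - 1)) with hw
  have hw0 : 0 < w := by positivity
  have hw1 : A * w ^ (1 / m) = d / 16 * w := by
    have h1 : w ^ (1 / m - 1) = d / (16 * A) := by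
      rw [hw, ← rpow_mul (by positivity), one_div_mul_cancel hγ.ne', rpow_one]
    have h2 : w ^ (1 / m) = w ^ (1 / m - 1) * w := by
      nth_rewrite 3 [← rpow_one w]
      rw [← rpow_add hw0]; congr 1; ring
    rw [h2, h1]; field_simp
  set c' := w / 32 with hc'
  have hc'0 : 0 < c' := by positivity
  set w2 := (w / 2) ^ (1 / m) with hw2
  have hw20 : 0 < w2 := by positivity
  set T1 := 4 + (CB / w2) ^ (1 - m) with hT1
  have hT4 : 4 ≤ T1 := by rw [hT1]; have : 0 ≤ (CB / w2) ^ (1 - m) := by positivity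
                          linarith
  have hT1b : CB ≤ (T1 - 2) ^ α * w2 := by
    have h1 : ((CB / w2) ^ (1 - m)) ^ α = CB / w2 := by
      rw [← rpow_mul (by positivity), hα, mul_one_div_cancel hm'.ne', rpow_one]
    have h2 : ((CB / w2) ^ (1 - m)) ^ α ≤ (T1 - 2) ^ α :=
      rpow_le_rpow (by positivity) (by rw [hT1]; linarith) hα0.le
    rw [h1, div_le_iff₀ hw20] at h2
    exact h2
  refine ⟨T1, hT4, fun M hM η' hη' => ?_⟩
  set W := w ^ (1 / m) with hW
  have hW0 : 0 < W := by positivity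
  set η := (η' / W) ^ (1 - m) / 2 with hη
  have hη0 : 0 < η := by positivity
  have hηb : (2 * η) ^ α * W = η' := by
    have : 2 * η = (η' / W) ^ (1 - m) := by rw [hη]; ring
    rw [this, ← rpow_mul (by positivity), hα, mul_one_div_cancel hm'.ne', rpow_one]
    field_simp
  have hlarge : ∀ᶠ n : ℕ in atTop, T1 / η ≤ n := tendsto_natCast_atTop_atTop.eventually (eventually_ge_atTop _)
  filter_upwards [hU M hM, eventually_ge_atTop 2, hlarge] with n hUn hn2 hnl t g V D hI
  have hn : 1 ≤ n := by omega
  have hn0 : (0:ℝ) < n := by exact_mod_cast hn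
  have hn2' : (2:ℝ) ≤ n := by exact_mod_cast hn2
  have hTn : T1 / n ≤ η := by
    rw [div_le_iff₀ hη0] at hnl
    rw [div_le_iff₀ hn0]; linarith
  obtain ⟨J, hJ1, hJ2⟩ := g.ex_J hn2
  obtain ⟨K', hK1, hK2⟩ := g.ex_last hn (by linarith : 0 ≤ T1)
  have hVJ := hUn t g J hJ2 hJ1 V D hI
  have hKt : T1 - T1 / n ≤ t K' := by
    have := g.tau_le (A := T1) (by linarith) hK1; linarith
  have hK2' : 2 ≤ t K' := by
    have : T1 / n ≤ T1 / 2 := div_le_div_of_nonneg_left (by linarith) (by norm_num) hn2'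
    linarith
  have hJK : J ≤ K' := by
    by_contra hc
    have := g.mono (show K' + 1 ≤ J by omega)
    linarith
  set s : (Fin d → ℤ) → ℝ := fun x => max (c' * (32 - nsq n x)) 0 with hs
  have hs0 : ∀ x, 0 ≤ s x := fun x => le_max_right _ _
  have hsw : ∀ x, s x ≤ w := fun x => max_le (by
    have := mul_nonneg hc'0.le (nsq_nonneg n x)
    have : c' * 32 = w := by rw [hc']; ring
    linarith) hw0.le
  have hsm : ∀ x, (s x ^ (1 / m)) ^ m = s x := fun x => by
    rw [← rpow_mul (hs0 x), one_div_mul_cancel hm.ne', rpow_one]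
  have hlap : ∀ x, nsq n x < 16 → lap n s x = -(2 * d * c') := by
    intro x hx
    have e : ∀ y, nsq n y ≤ 25 → s y = c' * (32 - nsq n y) := fun y hy =>
      max_eq_left (mul_nonneg hc'0.le (by linarith))
    unfold lap
    have : ∀ i : Fin d, s (x + Pi.single i 1) + s (x - Pi.single i 1) - 2 * s x = -(2 * c') * (1 / n : ℝ) ^ 2 := by
      intro i
      obtain ⟨h1, h2⟩ := nsq_nbr_le hn hx.le i
      rw [e _ h1, e _ h2, e _ (by linarith), nsq_add_single, nsq_sub_single]; ring
    rw [sum_congr rfl fun i _ => this i]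
    simp only [sum_const, card_univ, Fintype.card_fin, nsmul_eq_mul]
    field_simp
  have key : ∀ k, J ≤ k → k ≤ K' → ∀ x, V k x ≤ (T1 + η - t k) ^ α * s x ^ (1 / m) := by
    intro k hk
    induction k, hk using Nat.le_induction with
    | base =>
      intro _ x
      rcases lt_or_ge (nsq n x) 16 with hx | hx
      · refine (hVJ x).trans (hT1b.trans ?_)
        refine mul_le_mul (rpow_le_rpow (by linarith) (by linarith) hα0.le) ?_ hw20.le (by
          have : 0 ≤ T1 + η - t J := by linarith
          positivity)
        refine rpow_le_rpow (by positivity) ?_ (by positivity)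
        refine le_trans ?_ (le_max_left _ _)
        have h1 := mll (show (16:ℝ) ≤ 32 - nsq n x by linarith) hc'0.le
        have h2 : c' * 16 = w / 2 := by rw [hc']; ring
        linarith
      · rw [D.zero _ _ hx]
        have : 0 ≤ T1 + η - t J := by linarith
        exact mul_nonneg (rpow_nonneg this _) (rpow_nonneg (hs0 x) _)
    | succ k hk ih =>
      intro hkK
      have ih := ih (by omega)
      have htk1 : t (k + 1) ≤ T1 := (g.mono hkK).trans hK1
      have htk : t k ≤ T1 := (g.le_succ k).trans htk1
      set τ := t (k + 1) - t k with hτ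
      have hτ0 : 0 ≤ τ := sub_nonneg.2 (g.le_succ k)
      have hτη : τ ≤ η := (g.tau_le (by linarith) htk).trans hTn
      set a := T1 + η - t (k + 1) with ha
      have ha0 : η ≤ a := by rw [ha]; linarith
      have ha' : 0 < a := by linarith
      have hak : T1 + η - t k = a + τ := by rw [ha, hτ]; ring
      rw [hak] at ih
      have hP : (a + τ) ^ α - a ^ α ≤ A * τ * a ^ (α * m) := by
        have h1 := conv_tangent (x := a) (y := a + τ) ha'.le (by linarith) hα1
        have h2 : (a + τ) ^ (α - 1) ≤ (2 * a) ^ (α - 1) := rpow_le_rpow (by linarith) (by linarith) (by linarith)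
        rw [Real.mul_rpow (by norm_num) ha'.le] at h2
        rw [← hαm]
        have h3 := mll h2 (mul_nonneg hα0.le hτ0)
        rw [hA]; linarith
      refine comparison hn hm hτ0 (D.nonneg _) (fun x => mul_nonneg (rpow_nonneg ha'.le _) (rpow_nonneg (hs0 x) _)) (D.zero _)
        (fun x hx => (D.eq k x hx).le) (V' := V k) (Y' := fun x => (a + τ) ^ α * s x ^ (1 / m)) (fun x hx => ?_) ih
      have e : (fun y => (a ^ α * s y ^ (1 / m)) ^ m) = fun y => a ^ (α * m) * s y := by
        funext y
        rw [Real.mul_rpow (rpow_nonneg ha'.le _) (rpow_nonneg (hs0 y) _), hsm, ← rpow_mul ha'.le]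
      rw [e, lap_smul, hlap x hx]
      have h1 : s x ^ (1 / m) ≤ W := rpow_le_rpow (hs0 x) (hsw x) (by positivity)
      have h0 : 0 ≤ s x ^ (1 / m) := rpow_nonneg (hs0 x) _
      have h2 := mlr hP h0
      have ham : 0 < a ^ (α * m) := rpow_pos_of_pos ha' _
      have h3 : A * τ * a ^ (α * m) * s x ^ (1 / m) ≤ A * τ * a ^ (α * m) * W :=
        mll h1 (by positivity)
      have h4 : A * τ * a ^ (α * m) * W = τ * (a ^ (α * m) * (2 * d * c')) := by
        have : A * τ * a ^ (α * m) * W = τ * a ^ (α * m) * (A * W) := by ring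
        rw [this, hw1, hc']; ring
      linarith
  refine ⟨K', hK1, hK2', fun x => ?_⟩
  refine (key K' hJK le_rfl x).trans ?_
  rw [← hηb]
  refine mul_le_mul (rpow_le_rpow (by linarith) (by linarith) hα0.le)
    (rpow_le_rpow (hs0 x) (hsw x) (by positivity)) (rpow_nonneg (hs0 x) _) (by positivity)
end FDE
namespace FDE
variable {d : ℕ}
noncomputable def GG (s b A : ℝ) : ℝ := (max A b) ^ (-s) - s * (max A b) ^ (-s - 1) * (A - max A b)
theorem GG_of_ge {s b A : ℝ} (h : b ≤ A) : GG s b A = A ^ (-s) := by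
  unfold GG; rw [max_eq_left h]; ring
theorem GG_of_le {s b A : ℝ} (h : A ≤ b) : GG s b A = b ^ (-s) - s * b ^ (-s - 1) * (A - b) := by
  unfold GG; rw [max_eq_right h]
theorem GG_tangent {s b : ℝ} (hs : 0 ≤ s) (hb : 0 < b) (A B : ℝ) :
    GG s b A - s * (max A b) ^ (-s - 1) * (B - A) ≤ GG s b B := by
  set y := max A b with hy
  have hyb : b ≤ y := le_max_right _ _
  have hy0 : 0 < y := by linarith
  have e : GG s b A - s * y ^ (-s - 1) * (B - A) = y ^ (-s) - s * y ^ (-s - 1) * (B - y) := by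
    unfold GG; rw [← hy]; ring
  rw [e]
  rcases le_total b B with h | h
  · rw [GG_of_ge h]; exact neg_tangent (by linarith) hy0 hs
  · rw [GG_of_le h]
    have h1 := neg_tangent (x := b) hb hy0 hs
    have h2 : y ^ (-s - 1) ≤ b ^ (-s - 1) := rpow_le_rpow_of_nonpos hb hyb (by linarith)
    have h3 := mlr (mll h2 hs) (sub_nonneg.2 h)
    linarith
theorem GG_le {s b A : ℝ} (hs : 0 ≤ s) (hb : 0 < b) (hA : 0 ≤ A) : GG s b A ≤ (1 + s) * b ^ (-s) := by
  have hbs : 0 < b ^ (-s) := rpow_pos_of_pos hb _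
  rcases le_total b A with h | h
  · rw [GG_of_ge h]
    have := rpow_le_rpow_of_nonpos hb h (by linarith : -s ≤ 0)
    nlinarith
  · rw [GG_of_le h]
    have h1 : b ^ (-s - 1) * b = b ^ (-s) := by
      nth_rewrite 2 [← rpow_one b]
      rw [← rpow_add hb]; congr 1; ring
    have h2 : 0 < b ^ (-s - 1) := rpow_pos_of_pos hb _
    have h3 : 0 ≤ s * b ^ (-s - 1) * A := by positivity
    have : s * b ^ (-s - 1) * (A - b) = s * b ^ (-s - 1) * A - s * b ^ (-s) := by rw [← h1]; ring
    rw [this]; linarith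
theorem lap_GG_near {n : ℕ} (hn : 1 ≤ n) {s b : ℝ} (hs : 0 ≤ s) (hb : 0 < b) (x y : Fin d → ℤ) :
    -(2 * d * s * b ^ (-s - 1)) ≤ lap n (fun y => GG s b (nsq n (y - x))) y := by
  have hn0 : (0:ℝ) < n := by exact_mod_cast hn
  set A := nsq n (y - x) with hA
  set k := s * (max A b) ^ (-s - 1) with hk
  have hkb : k ≤ s * b ^ (-s - 1) :=
    mll (rpow_le_rpow_of_nonpos hb (le_max_right _ _) (by linarith)) hs
  have h : ∀ i : Fin d, -(2 * k * (1 / n) ^ 2) ≤ GG s b (nsq n (y + Pi.single i 1 - x)) + GG s b (nsq n (y - Pi.single i 1 - x)) - 2 * GG s b A := by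
    intro i
    have e1 : y + Pi.single i 1 - x = (y - x) + Pi.single i 1 := by abel
    have e2 : y - Pi.single i 1 - x = (y - x) - Pi.single i 1 := by abel
    rw [e1, e2, nsq_add_single, nsq_sub_single]
    have h1 := GG_tangent hs hb A (nsq n (y - x) + (2 * ((y - x) i / n) * (1 / n) + (1 / n : ℝ) ^ 2))
    have h2 := GG_tangent hs hb A (nsq n (y - x) + (-(2 * ((y - x) i / n) * (1 / n)) + (1 / n : ℝ) ^ 2))
    rw [← hk, ← hA] at h1 h2
    rw [← hA]
    linarith
  unfold lap
  have h2 := sum_le_sum fun i (_ : i ∈ Finset.univ) => h i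
  simp only [sum_const, card_univ, Fintype.card_fin, nsmul_eq_mul] at h2
  have h3 := mll h2 (by positivity : (0:ℝ) ≤ n ^ 2)
  refine le_trans ?_ h3
  have e : (n:ℝ) ^ 2 * (d * -(2 * k * (1 / n) ^ 2)) = -(2 * d * k) := by field_simp
  rw [e]
  have := mll hkb (by positivity : (0:ℝ) ≤ 2 * d)
  linarith
set_option maxHeartbeats 400000 in
theorem lap_GG_far (hd : 3 ≤ d) {ρ : ℝ} (hρ : 0 < ρ) : ∃ C, 0 ≤ C ∧ ∀ n : ℕ, 1 ≤ n → 1 ≤ ρ * n → ∀ x y : Fin d → ℤ,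
    4 * ρ ^ 2 < nsq n (y - x) →
    -(C / n ^ 2) ≤ lap n (fun y => GG (((d:ℝ) - 2) / 2) (ρ ^ 2) (nsq n (y - x))) y := by
  set s := ((d:ℝ) - 2) / 2 with hs'
  have hd' : (3:ℝ) ≤ d := by exact_mod_cast hd
  have hs : 0 < s := by rw [hs']; linarith
  refine ⟨(4 * s * d + 2 * s ^ 2 * d) * (4 * ρ ^ 2) ^ (-s - 2), by positivity, fun n hn hρn x y hy => ?_⟩
  have hn0 : (0:ℝ) < n := by exact_mod_cast hn
  set A := nsq n (y - x) with hA
  have hA0 : 0 < A := lt_of_le_of_lt (by positivity) hy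
  set h : ℝ := 1 / n with hh
  have hh0 : 0 < h := by positivity
  have hhρ : h ≤ ρ := by rw [hh, div_le_iff₀ hn0]; exact hρn
  have hsA : 2 * ρ ≤ √A := by
    apply Real.le_sqrt_of_sq_le; nlinarith
  have hsq : √A ^ 2 = A := Real.sq_sqrt hA0.le
  set B := A + h ^ 2 with hB
  have hB0 : 0 < B := by positivity
  have hz : ∀ i, |((y - x) i : ℝ) / n| ≤ √A := fun i => abs_coord_le (Real.sqrt_nonneg A) (by rw [hsq]) i
  set ζ : Fin d → ℝ := fun i => 2 * (((y - x) i : ℝ) / n) * h / B with hζ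
  have hζB : ∀ i, B * ζ i = 2 * (((y - x) i : ℝ) / n) * h := fun i => by rw [hζ]; field_simp
  have hζ1 : ∀ i, |ζ i| < 1 := fun i => by
    rw [hζ]
    simp only
    rw [abs_div, abs_of_pos hB0, div_lt_one hB0, abs_mul, abs_mul, abs_of_pos hh0, abs_of_pos (by norm_num : (0:ℝ) < 2)]
    have h1 := mlr (hz i) hh0.le
    have h2 : 0 < (√A - h) ^ 2 := by
      have : 0 < √A - h := by linarith
      positivity
    rw [hB]; nlinarith
  have hge : ∀ i, ρ ^ 2 ≤ B * (1 + ζ i) ∧ ρ ^ 2 ≤ B * (1 - ζ i) := fun i => by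
    have h1 := abs_le.1 (hz i)
    have h3 : ρ ^ 2 ≤ (√A - h) ^ 2 := by
      apply pow_le_pow_left₀ hρ.le; linarith
    have h4 := hζB i
    have h5 := mlr h1.1 hh0.le
    have h6 := mlr h1.2 hh0.le
    constructor <;> (rw [hB] at h4 ⊢; nlinarith)
  have hsum : ∑ i, ζ i ^ 2 = 4 * A * h ^ 2 / B ^ 2 := by
    have : A = ∑ i, (((y - x) i : ℝ) / n) ^ 2 := rfl
    rw [this, mul_sum, Finset.sum_mul, Finset.sum_div]
    refine sum_congr rfl fun i _ => ?_
    rw [hζ]; ring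
  set u := h ^ 2 / A with hu
  have hu0 : 0 ≤ u := by positivity
  have hBu : B = A * (1 + u) := by rw [hB, hu]; field_simp
  have hBs : B ^ (-s) = A ^ (-s) * (1 + u) ^ (-s) := by rw [hBu, Real.mul_rpow hA0.le (by linarith)]
  have hAs : 0 < A ^ (-s) := rpow_pos_of_pos hA0 _
  have hterm : ∀ i : Fin d, B ^ (-s) * (2 + s * (s + 1) * ζ i ^ 2) - 2 * A ^ (-s) ≤
      GG s (ρ ^ 2) (nsq n (y + Pi.single i 1 - x)) + GG s (ρ ^ 2) (nsq n (y - Pi.single i 1 - x)) - 2 * GG s (ρ ^ 2) A := by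
    intro i
    have e1 : y + Pi.single i 1 - x = (y - x) + Pi.single i 1 := by abel
    have e2 : y - Pi.single i 1 - x = (y - x) - Pi.single i 1 := by abel
    have e3 : nsq n (y - x + Pi.single i 1) = B * (1 + ζ i) := by
      rw [nsq_add_single]; have := hζB i; rw [mul_add, this, hB, ← hA, ← hh]; ring
    have e4 : nsq n (y - x - Pi.single i 1) = B * (1 - ζ i) := by
      rw [nsq_sub_single]; have := hζB i; rw [mul_sub, this, hB, ← hA, ← hh]; ring
    rw [e1, e2, e3, e4, GG_of_ge (hge i).1, GG_of_ge (hge i).2, GG_of_ge (by nlinarith)]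
    have ha := abs_lt.1 (hζ1 i)
    rw [Real.mul_rpow hB0.le (by linarith), Real.mul_rpow hB0.le (by linarith)]
    have h1 := mll (gsum_lower hs.le (hζ1 i)) (rpow_nonneg hB0.le (-s))
    linarith
  have h2 := sum_le_sum fun i (_ : i ∈ Finset.univ) => hterm i
  have e5 : ∑ i : Fin d, (B ^ (-s) * (2 + s * (s + 1) * ζ i ^ 2) - 2 * A ^ (-s))
      = A ^ (-s) * ((1 + u) ^ (-s) * (2 * d + 2 * s * d * (u / (1 + u) ^ 2)) - 2 * d) := by
    have : ∀ i : Fin d, B ^ (-s) * (2 + s * (s + 1) * ζ i ^ 2) - 2 * A ^ (-s) = (2 * B ^ (-s) - 2 * A ^ (-s)) + B ^ (-s) * (s * (s + 1)) * ζ i ^ 2 :=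
      fun i => by ring
    rw [sum_congr rfl fun i _ => this i, sum_add_distrib, ← mul_sum, hsum]
    simp only [sum_const, card_univ, Fintype.card_fin, nsmul_eq_mul]
    have e6 : 4 * A * h ^ 2 / B ^ 2 = 4 * (u / (1 + u) ^ 2) := by
      rw [hBu, hu]; field_simp
    have e7 : s + 1 = d / 2 := by rw [hs']; ring
    rw [e6, hBs, e7]; ring
  rw [e5] at h2
  have hb1 : 1 - s * u ≤ (1 + u) ^ (-s) := by
    have := neg_tangent (x := 1 + u) (y := 1) (s := s) (by linarith) one_pos hs.le
    simp only [Real.one_rpow] at this; linarith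
  set w := u / (1 + u) ^ 2 with hw
  have hw0 : 0 ≤ w := by positivity
  have hwu : w ≤ u := by rw [hw, div_le_iff₀ (by positivity)]; nlinarith [mul_nonneg hu0 hu0, mul_nonneg (mul_nonneg hu0 hu0) hu0]
  have hwl : u * (1 - 2 * u) ≤ w := by
    rw [hw, le_div_iff₀ (by positivity)]
    have : u * (1 - 2 * u) * (1 + u) ^ 2 = u - u * u ^ 2 * (3 + 2 * u) := by ring
    rw [this]
    have : 0 ≤ u * u ^ 2 * (3 + 2 * u) := by positivity
    linarith
  have hb2 : -((4 * s * d + 2 * s ^ 2 * d) * u ^ 2) ≤ (1 + u) ^ (-s) * (2 * d + 2 * s * d * w) - 2 * d := by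
    have h1 := mlr hb1 (by positivity : 0 ≤ 2 * d + 2 * s * d * w)
    have h3 := mll hwl (by positivity : 0 ≤ 2 * s * d)
    have h4 := mll hwu (by positivity : 0 ≤ s * u * (2 * s * d))
    have e : (1 - s * u) * (2 * d + 2 * s * d * w) = 2 * d - 2 * d * s * u + 2 * s * d * w - s * u * (2 * s * d) * w := by ring
    rw [e] at h1
    linarith
  unfold lap
  refine le_trans ?_ (mll h2 (by positivity : (0:ℝ) ≤ n ^ 2))
  have h3 := mll hb2 hAs.le
  refine le_trans ?_ (mll h3 (by positivity : (0:ℝ) ≤ n ^ 2))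
  have e8 : A ^ (-s) * u ^ 2 = A ^ (-s - 2) * h ^ 4 := by
    have : A ^ (-s - 2) = A ^ (-s) / A ^ 2 := by
      rw [rpow_sub hA0]; norm_num
    rw [this, hu]; field_simp
  have e9 : (n:ℝ) ^ 2 * (A ^ (-s) * -((4 * s * d + 2 * s ^ 2 * d) * u ^ 2)) = -((4 * s * d + 2 * s ^ 2 * d) * A ^ (-s - 2) / n ^ 2) := by
    have : (n:ℝ) ^ 2 * (A ^ (-s) * -((4 * s * d + 2 * s ^ 2 * d) * u ^ 2)) = -(n ^ 2 * ((4 * s * d + 2 * s ^ 2 * d) * (A ^ (-s) * u ^ 2))) := by ring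
    rw [this, e8, hh]; field_simp
  rw [e9]
  have h5 : A ^ (-s - 2) ≤ (4 * ρ ^ 2) ^ (-s - 2) := rpow_le_rpow_of_nonpos (by positivity) hy.le (by linarith)
  rw [neg_le_neg_iff]
  refine div_le_div_of_nonneg_right (mll h5 (by positivity)) (by positivity)
theorem nsq_neg (n : ℕ) (x : Fin d → ℤ) : nsq n (-x) = nsq n x := by
  unfold nsq; refine sum_congr rfl fun i _ => ?_
  rw [Pi.neg_apply]; push_cast; ring
theorem testfn (hd : 3 ≤ d) : ∃ c0 C1 : ℝ, 0 < c0 ∧ 0 < C1 ∧ ∀ ρ : ℝ, 0 < ρ → ρ ≤ 1 → ∃ B C : ℝ, 0 ≤ B ∧ 0 ≤ C ∧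
    ∀ n : ℕ, 1 ≤ n → 1 ≤ ρ * n → ∀ x : Fin d → ℤ, nsq n x ≤ 1 → ∃ Φ : (Fin d → ℤ) → ℝ,
      (∀ y, 0 ≤ Φ y) ∧ (∀ y, Φ y ≤ B) ∧ (∀ y, Φ y ≠ 0 → nsq n y < 16) ∧ (∀ y, nsq n y < 9 / 4 → c0 ≤ Φ y) ∧
      ∀ y, -((if nsq n (y - x) ≤ 4 * ρ ^ 2 then C1 / ρ ^ d else 0) + C / n ^ 2) ≤ lap n Φ y := by
  set s := ((d:ℝ) - 2) / 2 with hs'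
  have hd' : (3:ℝ) ≤ d := by exact_mod_cast hd
  have hs : 0 < s := by rw [hs']; linarith
  set c1 := (8.41:ℝ) ^ (-s) with hc1
  refine ⟨(6.25:ℝ) ^ (-s) - c1, 2 * d * s, sub_pos.2 (rpow_lt_rpow_of_neg (by norm_num) (by norm_num) (by linarith)), by positivity,
    fun ρ hρ hρ1 => ?_⟩
  obtain ⟨C, hC, hfar⟩ := lap_GG_far hd hρ
  have hb : 0 < ρ ^ 2 := by positivity
  have hb1 : ρ ^ 2 ≤ 1 := pow_le_one₀ hρ.le hρ1
  refine ⟨(1 + s) * (ρ ^ 2) ^ (-s), C, by positivity, hC, fun n hn hρn x hx => ?_⟩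
  have hn0 : (0:ℝ) < n := by exact_mod_cast hn
  have hCn : 0 ≤ C / n ^ 2 := by positivity
  have hc10 : 0 < c1 := by rw [hc1]; positivity
  refine ⟨fun y => max (GG s (ρ ^ 2) (nsq n (y - x)) - c1) 0, fun y => le_max_right _ _, fun y => ?_, fun y hy => ?_, fun y hy => ?_, fun y => ?_⟩
  · refine max_le ?_ (by positivity)
    have := GG_le hs.le hb (nsq_nonneg n (y - x)); linarith
  · have h1 : nsq n (y - x) < 8.41 := by
      by_contra hc
      have hc := not_lt.1 hc
      refine hy (max_eq_right ?_)
      rw [GG_of_ge (by linarith)]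
      have := rpow_le_rpow_of_nonpos (by norm_num) hc (by linarith : -s ≤ 0)
      linarith
    have h2 := nsq_young n x y (η := 2.9) (by norm_num)
    norm_num at h1 h2
    linarith
  · have h1 : nsq n (y - x) ≤ 6.25 := by
      have h2 := nsq_young n y (y - x) (η := 2 / 3) (by norm_num)
      have e : y - x - y = -x := by abel
      rw [e, nsq_neg] at h2
      norm_num at h2 ⊢
      linarith
    refine le_trans ?_ (le_max_left _ _)
    refine sub_le_sub_right ?_ _
    rcases le_total (ρ ^ 2) (nsq n (y - x)) with h | h
    · rw [GG_of_ge h]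
      exact rpow_le_rpow_of_nonpos (by linarith) h1 (by linarith)
    · rw [GG_of_le h]
      have h3 : (6.25:ℝ) ^ (-s) ≤ (ρ ^ 2) ^ (-s) := rpow_le_rpow_of_nonpos hb (by linarith) (by linarith)
      have h4 : 0 ≤ s * (ρ ^ 2) ^ (-s - 1) * (ρ ^ 2 - nsq n (y - x)) := mul_nonneg (by positivity) (by linarith)
      linarith
  · have hφ : -((if nsq n (y - x) ≤ 4 * ρ ^ 2 then 2 * d * s / ρ ^ d else 0) + C / n ^ 2) ≤ lap n (fun y => GG s (ρ ^ 2) (nsq n (y - x))) y := by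
      split_ifs with h
      · refine le_trans ?_ (lap_GG_near hn hs.le hb x y)
        have e : (ρ ^ 2) ^ (-s - 1) = (ρ ^ d)⁻¹ := by
          rw [← rpow_natCast ρ 2, ← rpow_mul hρ.le, ← rpow_natCast ρ d, ← rpow_neg hρ.le]
          congr 1; rw [hs']; push_cast; ring
        rw [e, div_eq_mul_inv]; linarith
      · rw [zero_add]; exact hfar n hn hρn x y (not_le.1 h)
    rcases le_total (GG s (ρ ^ 2) (nsq n (y - x)) - c1) 0 with h | h
    · refine le_trans (b := 0) ?_ ?_
      · rw [neg_nonpos]; refine add_nonneg ?_ hCn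
        split_ifs
        · positivity
        · exact le_rfl
      · unfold lap
        refine mul_nonneg (by positivity) (sum_nonneg fun i _ => ?_)
        beta_reduce
        rw [max_eq_right h]
        have h1 := le_max_right (GG s (ρ ^ 2) (nsq n (y + Pi.single i 1 - x)) - c1) 0
        have h2 := le_max_right (GG s (ρ ^ 2) (nsq n (y - Pi.single i 1 - x)) - c1) 0
        linarith
    · refine hφ.trans ?_
      have e : lap n (fun y => GG s (ρ ^ 2) (nsq n (y - x)) - c1) y = lap n (fun y => GG s (ρ ^ 2) (nsq n (y - x))) y := by
        rw [lap_sub n (fun y => GG s (ρ ^ 2) (nsq n (y - x))) (fun _ => c1), lap_const, sub_zero]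
      rw [← e]
      exact lap_le_of (fun y => le_max_left _ _) (max_eq_left h).symm
theorem count {n : ℕ} (hn : 1 ≤ n) {ρ : ℝ} (hρ : 0 < ρ) (hρn : 1 ≤ ρ * n) (x : Fin d → ℤ) :
    I n (fun y => if nsq n (y - x) ≤ 4 * ρ ^ 2 then (1:ℝ) else 0) ≤ (5 * ρ) ^ d := by
  have hn0 : (0:ℝ) < n := by exact_mod_cast hn
  unfold I
  rw [div_le_iff₀ (by positivity), ← mul_pow, ← Finset.sum_filter, sum_const, nsmul_eq_mul, mul_one]
  set k : ℤ := ⌊2 * ρ * n⌋ with hk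
  have hk0 : 0 ≤ k := Int.floor_nonneg.2 (by positivity)
  have hsub : (S n).filter (fun y => nsq n (y - x) ≤ 4 * ρ ^ 2) ⊆ Fintype.piFinset fun i => Finset.Icc (x i - k) (x i + k) := by
    intro y hy
    rw [Fintype.mem_piFinset]
    intro i
    have h1 := abs_le.1 (abs_coord_le (r := 2 * ρ) (by positivity) (by have := (Finset.mem_filter.1 hy).2; linarith) i)
    have h2 : ((y - x) i : ℤ) ≤ k := by
      refine Int.le_floor.2 ?_
      have := h1.2; rwa [div_le_iff₀ hn0] at this
    have h3 : (-((y - x) i) : ℤ) ≤ k := by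
      refine Int.le_floor.2 ?_
      have := h1.1; rw [le_div_iff₀ hn0] at this; push_cast at this ⊢; linarith
    rw [Pi.sub_apply] at h2 h3
    rw [Finset.mem_Icc]; constructor <;> linarith
  have h1 : (((S n).filter (fun y => nsq n (y - x) ≤ 4 * ρ ^ 2)).card : ℝ) ≤ ((2 * k + 1 : ℤ) : ℝ) ^ d := by
    have := Finset.card_le_card hsub
    rw [Fintype.card_piFinset] at this
    have e : ∀ i : Fin d, (Finset.Icc (x i - k) (x i + k)).card = (2 * k + 1).toNat := fun i => by
      rw [Int.card_Icc]; congr 1; ring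
    rw [Finset.prod_congr rfl fun i _ => e i, Finset.prod_const, card_univ, Fintype.card_fin] at this
    have e2 : ((2 * k + 1 : ℤ) : ℝ) = ((2 * k + 1).toNat : ℝ) := by
      have : ((2 * k + 1).toNat : ℤ) = 2 * k + 1 := Int.toNat_of_nonneg (by linarith)
      exact_mod_cast this.symm
    rw [e2]; exact_mod_cast this
  refine h1.trans ?_
  have h2 : (k:ℝ) ≤ 2 * ρ * n := Int.floor_le _
  have h3 : (0:ℝ) ≤ k := by exact_mod_cast hk0
  refine pow_le_pow_left₀ ?_ ?_ d
  · push_cast; linarith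
  · push_cast; linarith
end FDE
namespace FDE
variable {d : ℕ}
theorem Dir.kato_sum {n : ℕ} (hn : 1 ≤ n) {m M e : ℝ} (hm : 0 < m) (he : 0 ≤ e) {t : ℕ → ℝ} (g : Grid n t)
    {V u : ℕ → (Fin d → ℤ) → ℝ} (D : Dir n m M t V) (N : ℕ) (hu : ∀ k x, 0 ≤ u k x) (h0 : ∀ x, V 0 x ≤ u 0 x)
    (h : ∀ k, k < N → ∀ x, nsq n x < 16 → u k x + (t (k + 1) - t k) * (lap n (fun y => u (k + 1) y ^ m) x - e) ≤ u (k + 1) x) :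
    ∀ k, k ≤ N → I n (fun x => max (V k x - u k x) 0) ≤ t k * e * 11 ^ d := by
  intro k
  induction k with
  | zero =>
    intro _
    have : (fun x => max (V 0 x - u 0 x) 0) = fun x : Fin d → ℤ => (0:ℝ) := by
      funext x; exact max_eq_right (by linarith [h0 x])
    rw [this, g.zero]; simp [I]
  | succ k ih =>
    intro hk
    have h1 := kato hn hm (sub_nonneg.2 (g.le_succ k)) he (D.nonneg (k + 1)) (hu (k + 1)) (D.zero _) (fun x hx => (D.eq k x hx).le) (h k (by omega))
    have h2 := ih (by omega)
    linarith
theorem Dir.W_exists {n : ℕ} (hn : 1 ≤ n) {m M T1 : ℝ} (hm : 0 < m) (hm1 : m < 1) {t : ℕ → ℝ} (g : Grid n t)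
    {V : ℕ → (Fin d → ℤ) → ℝ} (D : Dir n m M t V) (hM : 0 ≤ M) {N K : ℕ} (hN : 1 ≤ N) (hNK : N ≤ K) (hK : t K ≤ T1) :
    ∃ W : (Fin d → ℤ) → ℝ, (∀ y, 0 ≤ W y) ∧ (∀ y, W y ≤ T1 * M ^ m) ∧ (∀ y, W y ≤ T1 * (T1 / t N) ^ (1 / (1 - m) * m) * V N y ^ m) ∧
      ∀ y, nsq n y < 16 → lap n W y = V K y - V N y := by
  have hm' : 0 < 1 - m := by linarith
  set α := 1 / (1 - m) with hα
  have hα0 : 0 < α := by positivity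
  have hτ : ∀ j, 0 ≤ t (N + j + 1) - t (N + j) := fun j => sub_nonneg.2 (g.le_succ _)
  have hV : ∀ j y, 0 ≤ V j y ^ m := fun j y => rpow_nonneg (D.nonneg _ _) _
  have hsum : ∑ j ∈ Finset.range (K - N), (t (N + j + 1) - t (N + j)) ≤ T1 := by
    have := Finset.sum_range_sub (fun j => t (N + j)) (K - N)
    simp only [← add_assoc] at this
    rw [this, add_zero, Nat.add_sub_cancel' hNK]
    linarith [g.nonneg N]
  have hbd : ∀ y (X : ℝ), 0 ≤ X → (∀ j, j < K - N → V (N + j + 1) y ^ m ≤ X) →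
      ∑ j ∈ Finset.range (K - N), (t (N + j + 1) - t (N + j)) * V (N + j + 1) y ^ m ≤ T1 * X := by
    intro y X hX h
    refine le_trans (sum_le_sum fun j hj => mll (h j (Finset.mem_range.1 hj)) (hτ j)) ?_
    rw [← Finset.sum_mul]
    exact mlr hsum hX
  refine ⟨fun y => ∑ j ∈ Finset.range (K - N), (t (N + j + 1) - t (N + j)) * V (N + j + 1) y ^ m,
    fun y => sum_nonneg fun j _ => mul_nonneg (hτ j) (hV _ _), fun y => ?_, fun y => ?_, fun y hy => ?_⟩
  · exact hbd y _ (rpow_nonneg hM _) fun j _ => rpow_le_rpow (D.nonneg _ _) (D.le _ _) hm.le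
  · rw [mul_assoc]
    have hT : 0 ≤ T1 / t N := div_nonneg ((g.nonneg K).trans hK) (g.nonneg N)
    refine hbd y _ (mul_nonneg (rpow_nonneg hT _) (hV _ _)) fun j hj => ?_
    have h1 := bc_chain g (w := fun k => V k y) (J := K) (fun k hk _ => D.bc hn hm hm1 g k hk y) hN (k := N + j + 1) (by omega) (by omega)
    have h2 : (t (N + j + 1) / t N) ^ α ≤ (T1 / t N) ^ α := by
      refine rpow_le_rpow (div_nonneg (g.nonneg _) (g.nonneg _)) ?_ hα0.le
      exact div_le_div_of_nonneg_right ((g.mono (by omega)).trans hK) (g.nonneg _)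
    have h3 := h1.trans (mlr h2 (D.nonneg N y))
    have h4 := rpow_le_rpow (D.nonneg _ _) h3 hm.le
    rwa [Real.mul_rpow (rpow_nonneg hT _) (D.nonneg _ _), ← rpow_mul hT] at h4
  · rw [lap_sum n _ (fun j => t (N + j + 1) - t (N + j)) (fun j y => V (N + j + 1) y ^ m)]
    have : ∀ j, (t (N + j + 1) - t (N + j)) * lap n (fun y => V (N + j + 1) y ^ m) y = V (N + (j + 1)) y - V (N + j) y := fun j => by
      rw [← add_assoc, D.eq (N + j) y hy]; ring
    rw [sum_congr rfl fun j _ => this j, Finset.sum_range_sub (fun j => V (N + j) y), add_zero, Nat.add_sub_cancel' hNK]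
theorem Im_bound {n : ℕ} (hn : 1 ≤ n) {m l X : ℝ} (hm : 0 < m) (hm1 : m < 1) (hl : 0 < l) {f : (Fin d → ℤ) → ℝ} (hf : ∀ x, 0 ≤ f x)
    (hX : I n f ≤ X) : I n (fun x => f x ^ m) ≤ l ^ m * 11 ^ d + m * l ^ (m - 1) * X := by
  have hc : 0 ≤ m * l ^ (m - 1) := by positivity
  have h1 : I n (fun x => f x ^ m) ≤ I n (fun x => l ^ m + (m * l ^ (m - 1)) * f x) := I_mono fun x _ => by
    have := conc_tangent hm.le hm1.le hl (hf x)
    have := mul_nonneg hc hl.le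
    linarith
  rw [I_add n (fun _ => l ^ m) (fun x => (m * l ^ (m - 1)) * f x), I_mul] at h1
  have h2 := I_const_le (d := d) hn (by positivity : 0 ≤ l ^ m)
  have h3 := mll hX hc
  linarith
set_option maxHeartbeats 1000000 in
theorem thmC (hd : 3 ≤ d) {m p : ℝ} (hm : 0 < m) (hm1 : m < 1) (hp : 1 ≤ p) (hpd : d * (1 - m) < 2 * p) :
    ∃ c κ : ℝ, 0 < c ∧ 0 < κ ∧ ∀ μ0 θ ρ K : ℝ, 0 < μ0 → 0 < θ → θ ≤ 1 → θ ≤ κ * μ0 ^ (1 - m) → 0 < ρ → ρ ≤ 1 → 1 ≤ K →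
      ∃ e0 : ℝ, 0 < e0 ∧ ∀ᶠ n : ℕ in atTop, ∀ t, Grid n t → ∀ N, t N = θ → ∀ u : ℕ → (Fin d → ℤ) → ℝ, (∀ k x, 0 ≤ u k x) →
      (∀ x, u 0 x ≤ K) →
      (∀ k, k < N → ∀ x, nsq n x < 16 → u k x + (t (k + 1) - t k) * (lap n (fun y => u (k + 1) y ^ m) x - e0) ≤ u (k + 1) x) →
      I n (fun y => if nsq n y < 1 then u 0 y ^ p else 0) ≤ 2 → μ0 ≤ I n (fun y => if nsq n y < 1 then u 0 y else 0) →
      ∀ x, nsq n x ≤ 1 → ∃ y, nsq n (y - x) ≤ 4 * ρ ^ 2 ∧ c * μ0 * θ ^ (1 / (1 - m) * m) ≤ u N y ^ m := by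
  have hm' : 0 < 1 - m := by linarith
  set α := 1 / (1 - m) with hα
  have hα0 : 0 < α := by positivity
  obtain ⟨cA, CA, hcA, hCA, hA⟩ := lemmaA (d := d) (ρ := 9 / 4) hm hm1 (by norm_num) (by norm_num)
  obtain ⟨c0, C1, hc0, hC1, htest⟩ := testfn (d := d) hd
  obtain ⟨T1, hT4, hext⟩ := dir_extinct (d := d) hd hm hm1 hp hpd
  have hT0 : 0 < T1 := by linarith
  set E := T1 * T1 ^ (α * m) with hE
  have hE0 : 0 < E := by positivity
  set c := c0 * cA / (32 * C1 * E * 5 ^ d) with hc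
  have h2m : (0:ℝ) < 1 - (1 / 2) ^ (1 - m) := sub_pos.2 (rpow_lt_one (by norm_num) (by norm_num) hm')
  set κ := cA ^ (1 - m) * (1 - (1 / 2) ^ (1 - m)) / CA with hκ
  refine ⟨c, κ, by positivity, by positivity, fun μ0 θ ρ K hμ hθ hθ1 hθκ hρ hρ1 hK => ?_⟩
  obtain ⟨B, C, hB, hC, htest⟩ := htest ρ hρ hρ1
  set β := c0 * cA * μ0 / 32 with hβ
  have hβ0 : 0 < β := by positivity
  set Q := C1 / ρ ^ d * (T1 * (T1 / θ) ^ (α * m)) * 11 ^ d with hQ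
  have hQ0 : 0 < Q := by positivity
  set l := (β / Q) ^ (1 / m) with hl
  have hl0 : 0 < l := by positivity
  have hlm : Q * l ^ m = β := by
    rw [hl, ← rpow_mul (by positivity), one_div_mul_cancel hm.ne', rpow_one]; field_simp
  set e0 := β / (Q * (m * l ^ (m - 1))) with he0
  have he00 : 0 < e0 := by positivity
  have he0' : Q * (m * l ^ (m - 1) * e0) = β := by rw [he0]; field_simp
  set η' := β / (B * 11 ^ d + 1) with hη'
  have hη0 : 0 < η' := by positivity
  have hηb : B * η' * 11 ^ d ≤ β := by
    have : η' * (B * 11 ^ d + 1) = β := by rw [hη']; field_simp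
    linarith
  refine ⟨e0, he00, ?_⟩
  have hl1 : ∀ᶠ n : ℕ in atTop, 1 / ρ ≤ n := tendsto_natCast_atTop_atTop.eventually (eventually_ge_atTop _)
  have hl2 : ∀ᶠ n : ℕ in atTop, C * (T1 * K ^ m * 11 ^ d) / β ≤ n := tendsto_natCast_atTop_atTop.eventually (eventually_ge_atTop _)
  filter_upwards [hext K hK η' hη0, eventually_ge_atTop 1, hl1, hl2] with n hextn hn hnρ hnβ t g N hN u hu hu0 hsup hIp hIμ x hx
  have hn0 : (0:ℝ) < n := by exact_mod_cast hn
  have hn1 : (1:ℝ) ≤ n := by exact_mod_cast hn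
  have hρn : 1 ≤ ρ * n := by rw [div_le_iff₀ hρ] at hnρ; linarith
  have hN1 : 1 ≤ N := Nat.one_le_iff_ne_zero.2 fun h => by rw [h, g.zero] at hN; linarith
  obtain ⟨V, hV0, D⟩ := dir_exists (n := n) (M := K) hm g.le_succ (fun y => if nsq n y < 1 then u 0 y else 0)
    (fun y => by split_ifs; exacts [hu _ _, le_rfl]) (fun y => by split_ifs; exacts [hu0 _, by linarith])
    (fun y hy => if_neg (by linarith))
  obtain ⟨K', hK1, hK2, hVK⟩ := hextn t g V D (by
    refine le_trans (le_of_eq ?_) hIp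
    congr 1; funext y; rw [hV0]; beta_reduce; split_ifs
    · rfl
    · exact Real.zero_rpow (by linarith))
  have hNK : N ≤ K' := by
    by_contra hcon
    have := g.mono (show K' ≤ N by omega); linarith
  -- mass
  have hmass : cA * μ0 / 4 ≤ I n (fun y => if nsq n y < 9 / 4 then V N y else 0) := by
    set Y := I n (fun y => if nsq n y < 9 / 4 then V N y else 0) with hY
    have hY0 : 0 ≤ Y := I_nonneg fun y _ => by split_ifs; exacts [D.nonneg _ _, le_rfl]
    have h1 := hA n hn t g N V (cA * μ0 / 4) 0 (by positivity) le_rfl (by rw [zero_mul]; positivity) D.nonneg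
      (fun k _ y hy => by rw [sub_zero]; exact (D.eq k y (by linarith)).ge)
    rw [← hY, hN] at h1
    have h2 : μ0 ≤ I n (fun y => if nsq n y < 1 then V 0 y else 0) := by
      refine hIμ.trans (le_of_eq ?_)
      congr 1; funext y; rw [hV0]; beta_reduce; split_ifs <;> rfl
    have h3 : (cA * μ0) ^ (1 - m) ≤ (Y + cA * μ0 / 4) ^ (1 - m) + CA * θ :=
      (rpow_le_rpow (by positivity) (mll h2 hcA.le) hm'.le).trans h1
    have h4 : CA * θ ≤ (cA * μ0) ^ (1 - m) * (1 - (1 / 2) ^ (1 - m)) := by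
      refine (mll hθκ hCA.le).trans (le_of_eq ?_)
      rw [hκ, Real.mul_rpow hcA.le hμ.le]; field_simp
    have h5 : (cA * μ0 * (1 / 2)) ^ (1 - m) ≤ (Y + cA * μ0 / 4) ^ (1 - m) := by
      rw [Real.mul_rpow (by positivity) (by norm_num)]; linarith
    have h6 := (rpow_le_rpow_iff (by positivity) (by positivity) hm').1 h5
    linarith
  obtain ⟨Φ, hΦ0, hΦB, hΦs, hΦc, hΦl⟩ := htest n hn hρn x hx
  obtain ⟨W, hW0, hWM, hWV, hWl⟩ := D.W_exists hn hm hm1 g (by linarith) hN1 hNK hK1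
  rw [hN] at hWV
  by_contra hcon
  push Not at hcon
  set χ : (Fin d → ℤ) → ℝ := fun y => if nsq n (y - x) ≤ 4 * ρ ^ 2 then (1:ℝ) else 0 with hχ
  have hχ0 : ∀ y, 0 ≤ χ y := fun y => by simp only [hχ]; split_ifs <;> norm_num
  have hχ1 : ∀ y, χ y ≤ 1 := fun y => by simp only [hχ]; split_ifs <;> norm_num
  have s1 : c0 * (cA * μ0 / 4) ≤ I n (fun y => Φ y * V N y) := by
    refine (mll hmass hc0.le).trans ?_
    rw [← I_mul]
    refine I_mono fun y _ => ?_
    split_ifs with h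
    · exact mlr (hΦc y h) (D.nonneg _ _)
    · rw [mul_zero]; exact mul_nonneg (hΦ0 y) (D.nonneg _ _)
  have s2 : I n (fun y => Φ y * V N y) ≤ B * η' * 11 ^ d + -I n (fun y => Φ y * lap n W y) := by
    have h1 : I n (fun y => Φ y * V N y) = I n (fun y => Φ y * V K' y) - I n (fun y => Φ y * lap n W y) := by
      rw [← I_sub]; congr 1; funext y
      by_cases h : Φ y = 0
      · rw [h]; ring
      · rw [hWl y (hΦs y h)]; ring
    have h2 : I n (fun y => Φ y * V K' y) ≤ B * η' * 11 ^ d :=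
      (I_mono fun y _ => mul_le_mul (hΦB y) (hVK y) (D.nonneg _ _) hB).trans (I_const_le hn (by positivity))
    linarith
  have s3 : -I n (fun y => Φ y * lap n W y) ≤ C1 / ρ ^ d * (T1 * (T1 / θ) ^ (α * m)) * I n (fun y => χ y * V N y ^ m) + β := by
    rw [← sbp hn W Φ fun y hy => (hΦs y hy).le]
    have h1 : -I n (fun y => W y * lap n Φ y) = I n (fun y => -1 * (W y * lap n Φ y)) := by rw [I_mul]; ring
    rw [h1]
    have h2 : I n (fun y => -1 * (W y * lap n Φ y)) ≤ I n (fun y => C1 / ρ ^ d * (T1 * (T1 / θ) ^ (α * m)) * (χ y * V N y ^ m) + C / n ^ 2 * (T1 * K ^ m)) := by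
      refine I_mono fun y _ => ?_
      have h3 := mll (hΦl y) (hW0 y)
      have h4 : (if nsq n (y - x) ≤ 4 * ρ ^ 2 then C1 / ρ ^ d else 0) = C1 / ρ ^ d * χ y := by
        simp only [hχ]; split_ifs <;> ring
      rw [h4] at h3
      have h5 := mll (hWM y) (by positivity : 0 ≤ C / (n:ℝ) ^ 2)
      have h6 := mll (hWV y) (mul_nonneg (by positivity : 0 ≤ C1 / ρ ^ d) (hχ0 y))
      linarith
    refine h2.trans ?_
    rw [I_add n (fun y => C1 / ρ ^ d * (T1 * (T1 / θ) ^ (α * m)) * (χ y * V N y ^ m)) (fun _ => C / n ^ 2 * (T1 * K ^ m)), I_mul]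
    have h7 := I_const_le (d := d) hn (by positivity : 0 ≤ C / n ^ 2 * (T1 * K ^ m))
    have h8 : C / n ^ 2 * (T1 * K ^ m) * 11 ^ d ≤ β := by
      rw [div_le_iff₀ hβ0] at hnβ
      have : C / n ^ 2 * (T1 * K ^ m) * 11 ^ d = C * (T1 * K ^ m * 11 ^ d) / n ^ 2 := by ring
      rw [this, div_le_iff₀ (by positivity)]
      have : (n:ℝ) * β ≤ n ^ 2 * β := mlr (by rw [sq]; exact le_mul_of_one_le_left hn0.le hn1) hβ0.le
      linarith
    linarith
  have s4 : I n (fun y => χ y * V N y ^ m) ≤ c * μ0 * θ ^ (α * m) * (5 * ρ) ^ d + (l ^ m * 11 ^ d + m * l ^ (m - 1) * (e0 * 11 ^ d)) := by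
    have k1 := D.kato_sum hn hm he00.le g N hu (fun y => by rw [hV0]; beta_reduce; split_ifs; exacts [le_rfl, hu _ _]) hsup N le_rfl
    have k2 : I n (fun y => max (V N y - u N y) 0) ≤ e0 * 11 ^ d := by
      refine k1.trans ?_
      rw [hN]
      have : 0 < e0 * 11 ^ d := by positivity
      rw [mul_assoc]; exact mul_le_of_le_one_left this.le hθ1
    have k3 := Im_bound hn hm hm1 hl0 (fun y => le_max_right (V N y - u N y) 0) k2
    have k4 : I n (fun y => χ y * V N y ^ m) ≤ I n (fun y => c * μ0 * θ ^ (α * m) * χ y + max (V N y - u N y) 0 ^ m) := by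
      refine I_mono fun y _ => ?_
      have k5 : V N y ^ m ≤ u N y ^ m + max (V N y - u N y) 0 ^ m := by
        refine le_trans (rpow_le_rpow (D.nonneg _ _) (?_ : V N y ≤ u N y + max (V N y - u N y) 0) hm.le)
          (rpow_add_le_add_rpow (hu _ _) (le_max_right _ _) hm.le hm1.le)
        linarith [le_max_left (V N y - u N y) 0]
      have k6 : 0 ≤ max (V N y - u N y) 0 ^ m := rpow_nonneg (le_max_right _ _) _
      have k7 : χ y * u N y ^ m ≤ c * μ0 * θ ^ (α * m) * χ y := by
        simp only [hχ]
        split_ifs with h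
        · linarith [hcon y h]
        · simp
      have k8 := mll k5 (hχ0 y)
      have k9 := mlr (hχ1 y) k6
      linarith
    rw [I_add n (fun y => c * μ0 * θ ^ (α * m) * χ y) (fun y => max (V N y - u N y) 0 ^ m), I_mul] at k4
    have k10 := mll (count hn hρ hρn x) (by positivity : 0 ≤ c * μ0 * θ ^ (α * m))
    linarith
  have s5 := mll s4 (by positivity : 0 ≤ C1 / ρ ^ d * (T1 * (T1 / θ) ^ (α * m)))
  have e1 : C1 / ρ ^ d * (T1 * (T1 / θ) ^ (α * m)) * (c * μ0 * θ ^ (α * m) * (5 * ρ) ^ d + (l ^ m * 11 ^ d + m * l ^ (m - 1) * (e0 * 11 ^ d)))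
      = C1 * E * 5 ^ d * c * μ0 + Q * l ^ m + Q * (m * l ^ (m - 1) * e0) := by
    rw [hQ, hE, Real.div_rpow hT0.le hθ.le, mul_pow]
    have : θ ^ (α * m) ≠ 0 := (rpow_pos_of_pos hθ _).ne'
    field_simp
    ring
  rw [e1, hlm, he0'] at s5
  have e2 : C1 * E * 5 ^ d * c * μ0 = β := by rw [hc, hβ]; field_simp
  have e3 : c0 * (cA * μ0 / 4) = 8 * β := by rw [hβ]; ring
  rw [e2] at s5
  rw [e3] at s1
  linarith
end FDE
namespace FDE
variable {d : ℕ}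
theorem Grid.tau_pow {n : ℕ} {t : ℕ → ℝ} (g : Grid n t) {k : ℕ} (hk : 1 ≤ k) (i : ℕ) :
    t (k + i + 1) - t (k + i) = (1 + 1 / n) ^ i * (t (k + 1) - t k) := by
  induction i with
  | zero => simp
  | succ i ih =>
    have h1 := g.step (k + i + 1) (by omega)
    have h2 := g.step (k + i) (by omega)
    rw [pow_succ, mul_comm (_ ^ i), mul_assoc, ← ih, ← add_assoc, h1, mul_sub, ← h2]
theorem upperB (hd : 3 ≤ d) {m p : ℝ} (hm : 0 < m) (hm1 : m < 1) (hp : 1 ≤ p) (hpd : d * (1 - m) < 2 * p) :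
    ∃ C, 0 < C ∧ ∀ K : ℝ, 1 ≤ K → ∀ᶠ n : ℕ in atTop, ∀ t, Grid n t → ∀ J, t J = 1 →
      ∀ u : ℕ → (Fin d → ℤ) → ℝ, (∀ k x, 0 ≤ u k x) → (∀ k x, u k x ≤ K) →
      (∀ k, k < J → ∀ x, nsq n x ≤ 1 → u (k + 1) x ≤ u k x + (t (k + 1) - t k) * (lap n (fun y => u (k + 1) y ^ m) x + 1)) →
      I n (fun y => if nsq n y ≤ 1 then u 0 y ^ p else 0) ≤ 2 →
      u J 0 ≤ C := by
  obtain ⟨C, hC, h⟩ := lemmaB (d := d) hd hm hm1 hp hpd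
  refine ⟨C, hC, fun K hK => ?_⟩
  filter_upwards [h K hK, eventually_ge_atTop 1] with n hB hn t g J hJ u hu huK hsub hI
  have hJ1 : 1 ≤ J := Nat.one_le_iff_ne_zero.2 fun h => by rw [h, g.zero] at hJ; linarith
  have hn0 : (0:ℝ) < n := by exact_mod_cast hn
  have hm' : 0 < 1 - m := by linarith
  set q : ℝ := 1 + 1 / n with hq
  have hq1 : 1 < q := by have : (0:ℝ) < 1 / n := by positivity
                         linarith
  have hq0 : 0 < q := by linarith
  set α := 1 / (1 - m) with hα
  have hα1 : 1 ≤ α := by rw [hα, one_le_div hm']; linarith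
  have hαm : α - 1 = α * m := by rw [hα]; field_simp; ring
  set r := q ^ (-α) with hr
  have hr0 : 0 < r := rpow_pos_of_pos hq0 _
  have hrq : r * q = r ^ m := by
    rw [hr, ← rpow_mul hq0.le]
    nth_rewrite 2 [← rpow_one q]
    rw [← rpow_add hq0]; congr 1; linarith
  have hrq1 : r ≤ q⁻¹ := by
    rw [hr, ← rpow_neg_one]
    exact rpow_le_rpow_of_exponent_le hq1.le (by linarith)
  have hr1 : r ≤ 1 := hrq1.trans (inv_le_one_of_one_le₀ hq1.le)
  have hqr : q ^ α * r = 1 := by rw [hr, ← rpow_add hq0, add_neg_cancel, rpow_zero]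
  have hpow : ∀ i : ℕ, r ^ i * q ^ i = (r ^ i) ^ m := fun i => by
    rw [← mul_pow, hrq, ← rpow_natCast, ← rpow_natCast, ← rpow_mul hr0.le, ← rpow_mul hr0.le, mul_comm]
  classical
  let v : ℕ → (Fin d → ℤ) → ℝ := fun k x => if h : 1 ≤ k ∧ k ≤ J then
    (Finset.Icc k J).sup' (Finset.nonempty_Icc.2 h.2) (fun j => r ^ (j - k) * u j x) else u k x
  have v1 : ∀ k x, 1 ≤ k → k ≤ J → ∃ i, k + i ≤ J ∧ v k x = r ^ i * u (k + i) x := by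
    intro k x h1 h2
    obtain ⟨j, hj, he⟩ := Finset.exists_mem_eq_sup' (Finset.nonempty_Icc.2 h2) (fun j => r ^ (j - k) * u j x)
    have hj := Finset.mem_Icc.1 hj
    refine ⟨j - k, by omega, ?_⟩
    simp only [v]
    rw [dif_pos ⟨h1, h2⟩, he, Nat.add_sub_cancel' hj.1]
  have v2 : ∀ k x i, 1 ≤ k → k + i ≤ J → r ^ i * u (k + i) x ≤ v k x := by
    intro k x i h1 h2
    simp only [v]
    rw [dif_pos ⟨h1, by omega⟩]
    have := Finset.le_sup' (fun j => r ^ (j - k) * u j x) (Finset.mem_Icc.2 ⟨by omega, h2⟩ : k + i ∈ Finset.Icc k J)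
    beta_reduce at this
    rwa [Nat.add_sub_cancel_left] at this
  have v0 : ∀ x, v 0 x = u 0 x := fun x => dif_neg (by omega)
  have vcase : ∀ k x, ∃ i, v k x = r ^ i * u (k + i) x := by
    intro k x
    by_cases h : 1 ≤ k ∧ k ≤ J
    · obtain ⟨i, _, hi⟩ := v1 k x h.1 h.2; exact ⟨i, hi⟩
    · exact ⟨0, by simp only [v]; rw [dif_neg h]; simp⟩
  have vn : ∀ k x, 0 ≤ v k x := fun k x => by
    obtain ⟨i, hi⟩ := vcase k x; rw [hi]; exact mul_nonneg (by positivity) (hu _ _)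
  have vK : ∀ k x, v k x ≤ K := fun k x => by
    obtain ⟨i, hi⟩ := vcase k x; rw [hi]
    exact (mul_le_of_le_one_left (hu _ _) (pow_le_one₀ hr0.le hr1)).trans (huK _ _)
  have vlap : ∀ k x i, 1 ≤ k → k + i ≤ J → v k x = r ^ i * u (k + i) x →
      (r ^ i) ^ m * lap n (fun y => u (k + i) y ^ m) x ≤ lap n (fun y => v k y ^ m) x := by
    intro k x i h1 h2 h3
    rw [← lap_smul]
    refine lap_le_of (fun y => ?_) ?_
    · rw [← Real.mul_rpow (by positivity) (hu _ _)]
      exact rpow_le_rpow (mul_nonneg (by positivity) (hu _ _)) (v2 k y i h1 h2) hm.le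
    · rw [← Real.mul_rpow (by positivity) (hu _ _), h3]
  have vle1 : ∀ i : ℕ, (r ^ i) ^ m ≤ 1 := fun i => rpow_le_one (by positivity) (pow_le_one₀ hr0.le hr1) hm.le
  have hfin := hB t g J (by linarith) hJ.ge v vn vK ?_ ?_ ?_
  · have := v2 J 0 0 hJ1 le_rfl
    simp only [pow_zero, one_mul, add_zero] at this
    exact this.trans hfin
  · intro k hk x hx
    obtain ⟨i, hi, he⟩ := v1 (k + 1) x (by omega) (by omega)
    have hl := vlap (k + 1) x i (by omega) hi he
    have hτ := sub_nonneg.2 (g.le_succ k)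
    set Lp := lap n (fun y => u (k + 1 + i) y ^ m) x with hLp
    suffices hs : v (k + 1) x ≤ v k x + (t (k + 1) - t k) * ((r ^ i) ^ m * (Lp + 1)) by
      refine hs.trans (add_le_add le_rfl (mll ?_ hτ))
      linarith [vle1 i]
    rw [he]
    have hstep := hsub (k + i) (by omega) x hx
    have ec : k + i + 1 = k + 1 + i := by omega
    rw [ec, ← hLp] at hstep
    rcases Nat.eq_zero_or_pos k with hk0 | hk1
    · subst hk0
      rcases i with _ | i
      · simp only [pow_zero, one_mul, Real.one_rpow, v0, add_zero] at hstep ⊢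
        exact hstep
      · have h1 := v2 1 x i le_rfl (by omega)
        have e0 : 0 + 1 + (i + 1) = 1 + i + 1 := by omega
        have e1 : 0 + (i + 1) = 1 + i := by omega
        rw [e0] at he hstep ⊢
        rw [e1, g.tau_pow le_rfl i, g.step 1 le_rfl, ← hq] at hstep
        have h2 : r ^ i * u (1 + i) x ≤ r ^ i * (r * u (1 + i + 1) x) := by
          refine h1.trans (le_of_eq ?_)
          rw [zero_add] at he; rw [he]; ring
        have h3 := le_of_mul_le_mul_left h2 (by positivity)
        set U := u (1 + i + 1) x with hU
        have hU0 : 0 ≤ U := hu _ _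
        have h4 : r * U ≤ q⁻¹ * U := mlr hrq1 hU0
        have h5 : (q - 1) * U ≤ (q - 1) * (q ^ (i + 1) * t 1 * (Lp + 1)) := by
          have h6 : U ≤ q⁻¹ * U + q ^ i * (q * t 1 - t 1) * (Lp + 1) := by linarith
          have h7 := mll h6 hq0.le
          have h8 : q * (q⁻¹ * U + q ^ i * (q * t 1 - t 1) * (Lp + 1)) = U + (q - 1) * (q ^ (i + 1) * t 1 * (Lp + 1)) := by
            field_simp
            ring
          rw [h8] at h7; linarith
        have h9 := le_of_mul_le_mul_left h5 (by linarith)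
        have h10 := mll h9 (by positivity : 0 ≤ r ^ (i + 1))
        have h11 : r ^ (i + 1) * (q ^ (i + 1) * t 1 * (Lp + 1)) = t 1 * ((r ^ (i + 1)) ^ m * (Lp + 1)) := by
          rw [← hpow]; ring
        rw [h11] at h10
        rw [g.zero, zero_add, sub_zero]
        linarith [vn 0 x]
    · have h1 := v2 k x i hk1 (by omega)
      have e1 := g.tau_pow hk1 i
      rw [ec, ← hq] at e1
      rw [e1] at hstep
      have h2 := mll hstep (by positivity : 0 ≤ r ^ i)
      have h3 : r ^ i * (u (k + i) x + q ^ i * (t (k + 1) - t k) * (Lp + 1)) = r ^ i * u (k + i) x + (t (k + 1) - t k) * ((r ^ i) ^ m * (Lp + 1)) := by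
        rw [← hpow]; ring
      rw [h3] at h2
      linarith
  · intro k hk1 hk x
    obtain ⟨i, hi, he⟩ := v1 (k + 1) x (by omega) (by omega)
    have h1 := v2 k x (i + 1) hk1 (by omega)
    have e1 : k + (i + 1) = k + 1 + i := by omega
    rw [e1] at h1
    have h2 := mll h1 (rpow_nonneg hq0.le α)
    refine le_trans (le_of_eq ?_) h2
    rw [he, pow_succ]
    calc r ^ i * u (k + 1 + i) x = (q ^ α * r) * (r ^ i * u (k + 1 + i) x) := by rw [hqr, one_mul]
      _ = _ := by ring
  · simp only [v0]; exact hI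
end FDE
namespace FDE
variable {d : ℕ}
noncomputable def th (θ : ℝ) (n k : ℕ) : ℝ := if k = 0 then 0 else θ * (1 + 1 / n) ^ k / (1 + 1 / n) ^ (n ^ 2)
theorem th_last {θ : ℝ} {n : ℕ} (hn : 1 ≤ n) : th θ n (n ^ 2) = θ := by
  have : n ^ 2 ≠ 0 := by positivity
  rw [th, if_neg this]; field_simp
theorem th_grid {θ : ℝ} (h0 : 0 < θ) (h1 : θ ≤ 1) {n : ℕ} (hn : 1 ≤ n) : Grid n (th θ n) := by
  have hn0 : (1:ℝ) ≤ n := by exact_mod_cast hn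
  refine ⟨by simp [th], by simp only [th, one_ne_zero, if_false]; positivity, ?_, ?_⟩
  · simp only [th, one_ne_zero, if_false, pow_one]
    have hb := one_add_mul_le_pow (a := (1:ℝ) / n) (by have : (0:ℝ) ≤ 1 / n := by positivity
                                                       linarith) (n ^ 2)
    have e : (1:ℝ) + ((n ^ 2 : ℕ) : ℝ) * (1 / n) = 1 + n := by push_cast; field_simp
    rw [e] at hb
    rw [div_le_div_iff₀ (by positivity) (by positivity)]
    have e2 : θ * (1 + 1 / n) * n = θ * (1 + n) := by field_simp; ring
    rw [e2]
    have := mlr h1 (by linarith : (0:ℝ) ≤ 1 + n)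
    linarith
  · intro k hk
    simp only [th, if_neg (by omega : k ≠ 0), if_neg (by omega : k + 1 ≠ 0)]
    ring
noncomputable def emb (x : Fin d → ℤ) : EuclideanSpace ℝ (Fin d) := WithLp.toLp 2 (fun i => (x i : ℝ))
theorem emb_add (x y : Fin d → ℤ) : emb (x + y) = emb x + emb y := by
  ext i; simp [emb]
theorem emb_sub (x y : Fin d → ℤ) : emb (x - y) = emb x - emb y := by
  ext i; simp [emb]
theorem emb_single (i : Fin d) : emb (Pi.single i 1) = EuclideanSpace.single i 1 := by
  ext j; by_cases h : j = i
  · subst h; simp [emb]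
  · simp [emb, h]
theorem norm_emb (n : ℕ) (x : Fin d → ℤ) : ‖(1 / n : ℝ) • emb x‖ ^ 2 = nsq n x := by
  rw [EuclideanSpace.norm_sq_eq, nsq]
  refine sum_congr rfl fun i _ => ?_
  simp only [emb, PiLp.smul_apply, smul_eq_mul, Real.norm_eq_abs, sq_abs]; ring
theorem norm_emb_le {n : ℕ} {x : Fin d → ℤ} {r : ℝ} (hr : 0 ≤ r) : ‖(1 / n : ℝ) • emb x‖ ≤ r ↔ nsq n x ≤ r ^ 2 := by
  rw [← norm_emb, sq_le_sq₀ (norm_nonneg _) hr]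
theorem norm_emb_lt {n : ℕ} {x : Fin d → ℤ} {r : ℝ} (hr : 0 ≤ r) : ‖(1 / n : ℝ) • emb x‖ < r ↔ nsq n x < r ^ 2 := by
  rw [← norm_emb, sq_lt_sq₀ (norm_nonneg _) hr]
open Classical Pointwise in
theorem riemann {B : Set (EuclideanSpace ℝ (Fin d))} (hB : Convex ℝ B) (hBm : MeasurableSet B) (hB1 : B ⊆ closedBall 0 1)
    {f : EuclideanSpace ℝ (Fin d) → ℝ} (hf : ContinuousOn f (closedBall 0 1)) :
    Tendsto (fun n : ℕ => I n (fun x => if (1 / n : ℝ) • emb x ∈ B then f ((1 / n : ℝ) • emb x) else 0)) atTop (𝓝 (∫ y in B, f y)) := by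
  set φ : EuclideanSpace ℝ (Fin d) → EuclideanSpace ℝ (Fin d) := fun y => (max 1 ‖y‖)⁻¹ • y with hφ
  have hφc : Continuous φ := by
    refine Continuous.smul (Continuous.inv₀ (continuous_const.max continuous_norm) fun y => ?_) continuous_id
    have := le_max_left 1 ‖y‖; positivity
  have hφB : ∀ y, φ y ∈ closedBall (0 : EuclideanSpace ℝ (Fin d)) 1 := fun y => by
    rw [mem_closedBall_zero_iff, hφ, norm_smul, norm_inv, Real.norm_of_nonneg (by positivity)]
    exact inv_mul_le_one_of_le₀ (le_max_right _ _) (by positivity)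
  have hφe : ∀ y ∈ B, φ y = y := fun y hy => by
    have := mem_closedBall_zero_iff.1 (hB1 hy)
    simp [hφ, max_eq_left this]
  set F : (Fin d → ℝ) → ℝ := fun y => f (φ (WithLp.toLp 2 y)) with hF
  have hFc : Continuous F := hf.comp_continuous (hφc.comp (PiLp.continuous_toLp 2 _)) fun y => hφB _
  set s : Set (Fin d → ℝ) := {y | WithLp.toLp 2 y ∈ B} with hs
  have key := tendsto_tsum_div_pow_atTop_integral (ι := Fin d) s F hFc ?_ ?_ ?_
  · have e1 : ∫ x in s, F x = ∫ y in B, f y := by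
      have h := (PiLp.volume_preserving_toLp (Fin d)).setIntegral_preimage_emb
        (MeasurableEquiv.toLp 2 (Fin d → ℝ)).measurableEmbedding (fun y => f (φ y)) B
      refine h.trans (setIntegral_congr_fun hBm fun y hy => by simp only [hφe y hy])
    rw [e1] at key
    refine key.congr' ?_
    filter_upwards [eventually_ge_atTop 1] with n hn
    have hn0 : (n:ℝ) ≠ 0 := by positivity
    set ψ : (Fin d → ℤ) → (Fin d → ℝ) := fun x => (n:ℝ)⁻¹ • (fun i => (x i : ℝ)) with hψ
    have hψi : Function.Injective ψ := by
      intro x y h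
      ext i
      have := congrFun h i
      simpa [hψ, hn0] using this
    have hem : ∀ x : Fin d → ℤ, WithLp.toLp 2 (ψ x) = (1 / n : ℝ) • emb x := fun x => by
      ext i; simp [hψ, emb]
    have hset : s ∩ (n : ℝ)⁻¹ • (Submodule.span ℤ (Set.range (Pi.basisFun ℝ (Fin d))) : Set (Fin d → ℝ)) =
        ↑(((S n).filter (fun x => (1 / n : ℝ) • emb x ∈ B)).image ψ) := by
      ext y
      simp only [Finset.coe_image, Finset.coe_filter, mem_inter_iff, mem_image, mem_ofPred_eq, hs, Set.mem_smul_set]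
      constructor
      · rintro ⟨hy, z, hz, rfl⟩
        have hz' : ∃ x : Fin d → ℤ, z = fun i => (x i : ℝ) := by
          rw [SetLike.mem_coe, Module.Basis.mem_span_iff_repr_mem ℤ (Pi.basisFun ℝ (Fin d))] at hz
          choose x hx using hz
          exact ⟨x, funext fun i => by simpa using (hx i).symm⟩
        obtain ⟨x, rfl⟩ := hz'
        have hb : (1 / n : ℝ) • emb x ∈ B := by rw [← hem]; exact hy
        refine ⟨x, ⟨mem_S hn ?_, hb⟩, rfl⟩
        have := (norm_emb_le zero_le_one).1 (mem_closedBall_zero_iff.1 (hB1 hb))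
        linarith
      · rintro ⟨x, ⟨_, hb⟩, rfl⟩
        refine ⟨by rw [hem]; exact hb, fun i => (x i : ℝ), ?_, rfl⟩
        rw [SetLike.mem_coe, Module.Basis.mem_span_iff_repr_mem ℤ (Pi.basisFun ℝ (Fin d))]
        exact fun i => ⟨x i, by simp⟩
    rw [hset, Finset.tsum_subtype', Finset.sum_image (fun x _ y _ h => hψi h), I, Fintype.card_fin, Finset.sum_filter]
    congr 1
    refine sum_congr rfl fun x _ => ?_
    split_ifs with h
    · simp only [hF]; rw [hem, hφe _ h]
    · rfl
  · have h2 : s ⊆ closedBall 0 1 := fun y hy => by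
      rw [mem_closedBall_zero_iff, pi_norm_le_iff_of_nonneg zero_le_one]
      intro i
      exact (PiLp.norm_apply_le (WithLp.toLp 2 y) i).trans (mem_closedBall_zero_iff.1 (hB1 hy))
    exact isBounded_closedBall.subset h2
  · exact (PiLp.volume_preserving_toLp (Fin d)).measurable hBm
  · have : Convex ℝ s := hB.linear_preimage (WithLp.linearEquiv 2 ℝ (Fin d → ℝ)).symm.toLinearMap
    exact this.addHaar_frontier _
open Pointwise in
theorem int_scale (x0 : EuclideanSpace ℝ (Fin d)) {R : ℝ} (hR : 0 < R) (f : EuclideanSpace ℝ (Fin d) → ℝ) :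
    ∫ y in ball (0 : EuclideanSpace ℝ (Fin d)) 1, f (x0 + R • y) = (∫ y in ball x0 R, f y) / R ^ d := by
  rw [Measure.setIntegral_comp_smul_of_pos volume (fun y => f (x0 + y)) _ hR, smul_unitBall_of_pos hR, finrank_euclideanSpace,
    Fintype.card_fin, smul_eq_mul, div_eq_inv_mul]
  congr 1
  have h := (measurePreserving_add_left (volume : Measure (EuclideanSpace ℝ (Fin d))) x0).setIntegral_preimage_emb
    (measurableEmbedding_addLeft x0) f (ball x0 R)
  rw [← h]; congr 2
  ext y; simp
theorem riem_lt {x0 : EuclideanSpace ℝ (Fin d)} {R : ℝ} (hR : 0 < R) {f : EuclideanSpace ℝ (Fin d) → ℝ}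
    (hf : ContinuousOn f (closedBall x0 R)) :
    Tendsto (fun n : ℕ => I n (fun x => if nsq n x < 1 then f (x0 + (R / n) • emb x) else 0)) atTop (𝓝 ((∫ y in ball x0 R, f y) / R ^ d)) ∧
    Tendsto (fun n : ℕ => I n (fun x => if nsq n x ≤ 1 then f (x0 + (R / n) • emb x) else 0)) atTop (𝓝 ((∫ y in ball x0 R, f y) / R ^ d)) := by
  have hf' : ContinuousOn (fun y => f (x0 + R • y)) (closedBall 0 1) := by
    refine hf.comp (by fun_prop) fun y hy => ?_
    rw [mem_closedBall_zero_iff] at hy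
    rw [mem_closedBall_iff_norm, add_sub_cancel_left, norm_smul, Real.norm_of_nonneg hR.le]
    exact mul_le_of_le_one_right hR.le hy
  have e : ∀ n : ℕ, ∀ x : Fin d → ℤ, R • (1 / n : ℝ) • emb x = (R / n) • emb x := fun n x => by rw [smul_smul]; congr 1; ring
  have e1 : ∀ n : ℕ, ∀ x : Fin d → ℤ, (1 / n : ℝ) • emb x ∈ ball (0 : EuclideanSpace ℝ (Fin d)) 1 ↔ nsq n x < 1 := fun n x => by
    rw [mem_ball_zero_iff, norm_emb_lt zero_le_one, one_pow]
  have e2 : ∀ n : ℕ, ∀ x : Fin d → ℤ, (1 / n : ℝ) • emb x ∈ closedBall (0 : EuclideanSpace ℝ (Fin d)) 1 ↔ nsq n x ≤ 1 := fun n x => by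
    rw [mem_closedBall_zero_iff, norm_emb_le zero_le_one, one_pow]
  rw [← int_scale x0 hR f]
  constructor
  · have := riemann (convex_ball 0 1) measurableSet_ball ball_subset_closedBall hf'
    simpa only [e, e1] using this
  · have := riemann (convex_closedBall 0 1) measurableSet_closedBall subset_rfl hf'
    have hae : closedBall (0 : EuclideanSpace ℝ (Fin d)) 1 =ᵐ[volume] ball 0 1 := by
      rw [← ball_union_sphere]
      exact union_ae_eq_left_of_ae_eq_empty (ae_eq_empty.2 (Measure.addHaar_sphere_of_ne_zero volume 0 one_ne_zero))
    rw [setIntegral_congr_set hae] at this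
    simpa only [e, e2] using this
end FDE
namespace FDE
variable {d : ℕ}
theorem dsmooth {Q : Set (ℝ × EuclideanSpace ℝ (Fin d))} (hQ : IsOpen Q) {F : ℝ × EuclideanSpace ℝ (Fin d) → ℝ}
    (hF : ContDiffOn ℝ (⊤ : ℕ∞) F Q) (v : EuclideanSpace ℝ (Fin d)) :
    ContDiffOn ℝ (⊤ : ℕ∞) (fun q => fderiv ℝ (fun y => F (q.1, y)) q.2 v) Q ∧
    ∀ s y (h : ℝ), (s, y + h • v) ∈ Q → HasDerivAt (fun h => F (s, y + h • v)) (fderiv ℝ (fun y => F (s, y)) (y + h • v) v) h := by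
  have hd : ∀ q ∈ Q, HasFDerivAt (fun y => F (q.1, y)) ((fderiv ℝ F q).comp (ContinuousLinearMap.inr ℝ ℝ _)) q.2 := fun q hq =>
    HasFDerivAt.comp (g := F) (f := fun y => (q.1, y)) q.2
      ((hF.differentiableOn (by simp)).differentiableAt (hQ.mem_nhds hq)).hasFDerivAt (hasFDerivAt_prodMk_right q.1 q.2)
  constructor
  · have h1 : ContDiffOn ℝ (⊤ : ℕ∞) (fun q => fderiv ℝ F q (0, v)) Q :=
      (hF.fderiv_of_isOpen hQ (by simp)).clm_apply contDiffOn_const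
    refine h1.congr fun q hq => ?_
    rw [(hd q hq).fderiv]; simp
  · intro s y h hq
    have h1 : HasFDerivAt (fun y => F (s, y)) _ (y + h • v) := hd _ hq
    have h2 : HasDerivAt (fun h : ℝ => y + h • v) v h := by
      simpa using ((hasDerivAt_id h).smul_const v).const_add y
    rw [h1.fderiv]
    exact HasFDerivAt.comp_hasDerivAt (l := fun y => F (s, y)) h h1 h2
noncomputable def disc (c a l : ℝ) (x0 : EuclideanSpace ℝ (Fin d)) (R : ℝ) (u : ℝ → EuclideanSpace ℝ (Fin d) → ℝ) (n : ℕ) (t : ℕ → ℝ)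
    (k : ℕ) (x : Fin d → ℤ) : ℝ := if nsq n x ≤ 25 then c * u (a + l * t k) (x0 + (R / n) • emb x) else 0
theorem emb_mem {x0 : EuclideanSpace ℝ (Fin d)} {R r : ℝ} (hR : 0 < R) (hr : 0 ≤ r) {n : ℕ} {x : Fin d → ℤ} (h : nsq n x ≤ r ^ 2) :
    x0 + (R / n) • emb x ∈ closedBall x0 (r * R) := by
  have e : (R / n) • emb x = R • (1 / n : ℝ) • emb x := by rw [smul_smul]; congr 1; ring
  rw [mem_closedBall_iff_norm, add_sub_cancel_left, e, norm_smul, Real.norm_of_nonneg hR.le, mul_comm]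
  exact mlr ((norm_emb_le hr).2 h) hR.le
theorem regs {m T : ℝ} {Ω : Set (EuclideanSpace ℝ (Fin d))} (hΩ : IsOpen Ω) {u : ℝ → EuclideanSpace ℝ (Fin d) → ℝ}
    (hu : IsFDESol m (Ioo 0 T ×ˢ Ω) u) : ∃ D G : Fin d → ℝ × EuclideanSpace ℝ (Fin d) → ℝ, (∀ i, ContinuousOn (G i) (Ioo 0 T ×ˢ Ω)) ∧
      (∀ i s y (h : ℝ), (s, y + h • EuclideanSpace.single i 1) ∈ Ioo 0 T ×ˢ Ω →
        HasDerivAt (fun h : ℝ => u s (y + h • EuclideanSpace.single i 1) ^ m) (D i (s, y + h • EuclideanSpace.single i 1)) h) ∧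
      (∀ i s y (h : ℝ), (s, y + h • EuclideanSpace.single i 1) ∈ Ioo 0 T ×ˢ Ω →
        HasDerivAt (fun h : ℝ => D i (s, y + h • EuclideanSpace.single i 1)) (G i (s, y + h • EuclideanSpace.single i 1)) h) ∧
      ∀ s y, (s, y) ∈ Ioo 0 T ×ˢ Ω → HasDerivAt (fun s => u s y) (∑ i, G i (s, y)) s := by
  obtain ⟨hpos, hsm, heq⟩ := hu
  have hQo : IsOpen (Ioo 0 T ×ˢ Ω) := isOpen_Ioo.prod hΩ
  set g : ℝ × EuclideanSpace ℝ (Fin d) → ℝ := fun q => u q.1 q.2 ^ m with hg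
  have hgs : ContDiffOn ℝ (⊤ : ℕ∞) g (Ioo 0 T ×ˢ Ω) := hsm.rpow_const_of_ne fun q hq => (hpos q hq).ne'
  set D : Fin d → ℝ × EuclideanSpace ℝ (Fin d) → ℝ := fun i q => fderiv ℝ (fun y => g (q.1, y)) q.2 (EuclideanSpace.single i 1) with hD
  set G : Fin d → ℝ × EuclideanSpace ℝ (Fin d) → ℝ := fun i q => fderiv ℝ (fun y => D i (q.1, y)) q.2 (EuclideanSpace.single i 1) with hG
  have hDs : ∀ i, ContDiffOn ℝ (⊤ : ℕ∞) (D i) (Ioo 0 T ×ˢ Ω) := fun i => (dsmooth hQo hgs _).1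
  have hGs : ∀ i, ContDiffOn ℝ (⊤ : ℕ∞) (G i) (Ioo 0 T ×ˢ Ω) := fun i => (dsmooth hQo (hDs i) _).1
  refine ⟨D, G, fun i => (hGs i).continuousOn, fun i s y h hq => (dsmooth hQo hgs _).2 _ _ _ hq,
    fun i s y h hq => (dsmooth hQo (hDs i) _).2 _ _ _ hq, fun s y hq => ?_⟩
  have h1 : DifferentiableAt ℝ (fun s => u s y) s :=
    DifferentiableAt.comp (g := fun q : ℝ × EuclideanSpace ℝ (Fin d) => u q.1 q.2) (f := fun s => (s, y)) s
      ((hsm.differentiableOn (by simp)).differentiableAt (hQo.mem_nhds hq)) (by fun_prop)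
  have h2 := h1.hasDerivAt
  rw [heq (s, y) hq] at h2
  exact h2
theorem consist {m T : ℝ} {Ω : Set (EuclideanSpace ℝ (Fin d))} (hΩ : IsOpen Ω) {u : ℝ → EuclideanSpace ℝ (Fin d) → ℝ}
    (hu : IsFDESol m (Ioo 0 T ×ˢ Ω) u) {x0 : EuclideanSpace ℝ (Fin d)} {R : ℝ} (hR : 0 < R) (hB : closedBall x0 (6 * R) ⊆ Ω)
    {a l c θ : ℝ} (ha : 0 < a) (hl : 0 < l) (hθ : θ ≤ 1) (haT : a + l * θ < T) (hc : 0 < c) (hcl : c * l = c ^ m * R ^ 2) {e : ℝ} (he : 0 < e) :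
    ∀ᶠ n : ℕ in atTop, ∀ t, Grid n t → ∀ N, t N ≤ θ → ∀ k, k < N → ∀ x, nsq n x ≤ 16 →
      |disc c a l x0 R u n t (k + 1) x - disc c a l x0 R u n t k x -
        (t (k + 1) - t k) * lap n (fun y => disc c a l x0 R u n t (k + 1) y ^ m) x| ≤ (t (k + 1) - t k) * e := by
  obtain ⟨D, G, hGc, hDd, hGd, hAd⟩ := regs hΩ hu
  have hpos := hu.1
  set Q := Ioo 0 T ×ˢ Ω with hQ
  set K := Icc a (a + l * θ) ×ˢ closedBall x0 (5 * R) with hK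
  have hKQ : K ⊆ Q := prod_mono (fun s hs => ⟨by linarith [hs.1], by linarith [hs.2]⟩)
    ((closedBall_subset_closedBall (by linarith)).trans hB)
  have hKc : IsCompact K := isCompact_Icc.prod (isCompact_closedBall _ _)
  set M := c * l with hM
  have hM0 : 0 < M := by positivity
  have hunif : ∀ᶠ n : ℕ in atTop, ∀ i, ∀ q ∈ K, ∀ q' ∈ K, dist q q' ≤ (2 * l + R) / n → |G i q - G i q'| ≤ e / (M * (d + 1)) := by
    rw [eventually_all]
    intro i
    have h1 := Metric.uniformContinuousOn_iff.1 (hKc.uniformContinuousOn_of_continuous ((hGc i).mono hKQ)) (e / (M * (d + 1))) (by positivity)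
    obtain ⟨δ, hδ, h⟩ := h1
    have h2 : Tendsto (fun n : ℕ => (2 * l + R) / (n:ℝ)) atTop (𝓝 0) := tendsto_const_div_atTop_nhds_zero_nat _
    filter_upwards [h2.eventually (gt_mem_nhds hδ)] with n hn q hq q' hq' hqq
    exact (h q hq q' hq' (hqq.trans_lt hn)).le
  filter_upwards [hunif, eventually_ge_atTop 1] with n hn hn1 t gr N hN k hk x hx
  have hn0 : (1:ℝ) ≤ n := by exact_mod_cast hn1
  have hRn : 0 < R / n := by positivity
  have ht1 : t (k + 1) ≤ θ := (gr.mono hk).trans hN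
  have ht0 := gr.le_succ k
  have htn := gr.nonneg k
  have hτ := gr.tau_le (k := k) le_rfl (by linarith)
  set X := x0 + (R / n) • emb x with hX
  set s0 := a + l * t k with hs0
  set s1 := a + l * t (k + 1) with hs1
  have hs01 : s0 ≤ s1 := by rw [hs0, hs1]; gcongr
  have hs0a : a ≤ s0 := by rw [hs0]; have := mul_nonneg hl.le htn; linarith
  have hs1T : s1 ≤ a + l * θ := by rw [hs1]; gcongr
  have hXm : X ∈ closedBall x0 (4 * R) := emb_mem hR (by norm_num) (by linarith)
  have hXn : ∀ (i : Fin d) (h : ℝ), h ∈ Icc (0 - R / n) (0 + R / n) → X + h • EuclideanSpace.single i (1:ℝ) ∈ closedBall x0 (5 * R) := by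
    intro i h hh
    have h1 : |h| ≤ R / n := abs_le.2 ⟨by linarith [hh.1], by linarith [hh.2]⟩
    have h2 : R / n ≤ R := div_le_self hR.le hn0
    rw [mem_closedBall_iff_norm] at hXm ⊢
    calc ‖X + h • EuclideanSpace.single i (1:ℝ) - x0‖ = ‖(X - x0) + h • EuclideanSpace.single i (1:ℝ)‖ := by congr 1; abel
      _ ≤ ‖X - x0‖ + ‖h • EuclideanSpace.single i (1:ℝ)‖ := norm_add_le _ _
      _ ≤ 4 * R + |h| := by rw [norm_smul]; simp; linarith
      _ ≤ 5 * R := by linarith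
  have hX5 : X ∈ closedBall x0 (5 * R) := closedBall_subset_closedBall (by linarith) hXm
  -- space
  have hlap : ∃ ξ : Fin d → ℝ, (∀ i, ξ i ∈ Icc (0 - R / n) (0 + R / n)) ∧
      lap n (fun y => disc c a l x0 R u n t (k + 1) y ^ m) x = M * ∑ i, G i (s1, X + ξ i • EuclideanSpace.single i 1) := by
    have h1 : ∀ i, ∃ ξ ∈ Icc (0 - R / n) (0 + R / n), u s1 (X + (0 + R / n) • EuclideanSpace.single i 1) ^ m + u s1 (X + (0 - R / n) • EuclideanSpace.single i 1) ^ m -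
        2 * u s1 (X + (0:ℝ) • EuclideanSpace.single i 1) ^ m = (R / n) ^ 2 * G i (s1, X + ξ • EuclideanSpace.single i 1) := fun i =>
      second_diff (f := fun h : ℝ => u s1 (X + h • EuclideanSpace.single i 1) ^ m) (f' := fun h : ℝ => D i (s1, X + h • EuclideanSpace.single i 1))
        (f'' := fun h : ℝ => G i (s1, X + h • EuclideanSpace.single i 1)) hRn
        (fun h hh => hDd _ _ _ _ (hKQ ⟨⟨hs0a.trans hs01, hs1T⟩, hXn i h hh⟩))
        (fun h hh => hGd _ _ _ _ (hKQ ⟨⟨hs0a.trans hs01, hs1T⟩, hXn i h hh⟩))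
    choose ξ h2 h3 using h1
    refine ⟨ξ, h2, ?_⟩
    rw [lap, mul_sum, mul_sum]
    refine sum_congr rfl fun i _ => ?_
    have hu0 : ∀ y ∈ closedBall x0 (5 * R), 0 ≤ u s1 y := fun y hy => (hpos (s1, y) (hKQ ⟨⟨hs0a.trans hs01, hs1T⟩, hy⟩)).le
    have hnb := nsq_nbr_le hn1 hx i
    have hval : ∀ y, nsq n y ≤ 25 → disc c a l x0 R u n t (k + 1) y ^ m = c ^ m * u s1 (x0 + (R / n) • emb y) ^ m := fun y hy => by
      rw [disc, if_pos hy, mul_rpow hc.le (hu0 _ (emb_mem hR (by norm_num) (by linarith)))]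
    rw [hval _ hnb.1, hval _ hnb.2, hval x (by linarith)]
    have h4 := h3 i
    rw [zero_add, zero_sub, zero_smul, add_zero, neg_smul, ← sub_eq_add_neg] at h4
    rw [emb_add, emb_sub, emb_single, smul_add, smul_sub, ← add_assoc, ← add_sub_assoc, ← hX]
    have h5 : (n:ℝ) ^ 2 * (R / n) ^ 2 = R ^ 2 := by field_simp
    rw [hcl, ← h5]
    linear_combination (n:ℝ) ^ 2 * c ^ m * h4
  obtain ⟨ξ, hξ, hlap⟩ := hlap
  have hA : ∀ s ∈ Icc s0 s1, HasDerivAt (fun s => u s X) (∑ i, G i (s, X)) s := by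
    intro s hs
    exact hAd _ _ (hKQ ⟨⟨hs0a.trans hs.1, hs.2.trans hs1T⟩, hX5⟩)
  have htime : ∃ η ∈ Icc s0 s1, u s1 X - u s0 X = (s1 - s0) * ∑ i, G i (η, X) := by
    rcases hs01.eq_or_lt with h | h
    · exact ⟨s0, ⟨le_rfl, hs01⟩, by rw [← h]; ring⟩
    · obtain ⟨η, hη, h1⟩ := exists_hasDerivAt_eq_slope (fun s => u s X) (fun s => ∑ i, G i (s, X)) h
        (fun s hs => (hA s hs).continuousAt.continuousWithinAt) (fun s hs => hA s (Ioo_subset_Icc_self hs))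
      refine ⟨η, Ioo_subset_Icc_self hη, ?_⟩
      rw [h1]; field_simp [sub_ne_zero.2 h.ne']
  obtain ⟨η, hη, htime⟩ := htime
  have hx25 : nsq n x ≤ 25 := by linarith
  have hs : s1 - s0 = l * (t (k + 1) - t k) := by rw [hs0, hs1]; ring
  have e1 : disc c a l x0 R u n t (k + 1) x - disc c a l x0 R u n t k x -
        (t (k + 1) - t k) * lap n (fun y => disc c a l x0 R u n t (k + 1) y ^ m) x =
      (t (k + 1) - t k) * (M * ∑ i, (G i (η, X) - G i (s1, X + ξ i • EuclideanSpace.single i 1))) := by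
    rw [hlap, disc, disc, if_pos hx25, if_pos hx25, ← hX, ← hs0, ← hs1, sum_sub_distrib, hM]
    rw [hs] at htime
    linear_combination c * htime
  rw [e1, abs_mul, abs_of_nonneg (by linarith : 0 ≤ t (k + 1) - t k)]
  refine mll ?_ (by linarith)
  rw [abs_mul, abs_of_pos hM0]
  have h6 : |∑ i, (G i (η, X) - G i (s1, X + ξ i • EuclideanSpace.single i 1))| ≤ ∑ i : Fin d, e / (M * (d + 1)) := by
    refine (Finset.abs_sum_le_sum_abs _ _).trans (sum_le_sum fun i _ => ?_)
    have k1 : (η, X) ∈ K := mk_mem_prod ⟨hs0a.trans hη.1, hη.2.trans hs1T⟩ hX5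
    have k2 : (s1, X + ξ i • EuclideanSpace.single i 1) ∈ K := mk_mem_prod ⟨hs0a.trans hs01, hs1T⟩ (hXn i _ (hξ i))
    refine hn i (η, X) k1 (s1, X + ξ i • EuclideanSpace.single i 1) k2 ?_
    rw [Prod.dist_eq]
    have h7 : (2 * l + R) / n = l * (2 / n) + R / n := by ring
    refine max_le ?_ ?_
    · simp only [Real.dist_eq]
      have : l * (t (k + 1) - t k) ≤ l * (2 / n) := by gcongr
      rw [abs_le]; constructor <;> linarith [hη.1, hη.2]
    · simp only [dist_self_add_right, norm_smul, EuclideanSpace.norm_single, norm_one, mul_one, Real.norm_eq_abs]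
      have : 0 ≤ l * (2 / n) := by positivity
      rw [abs_le]; constructor <;> linarith [(hξ i).1, (hξ i).2]
  refine (mll h6 hM0.le).trans ?_
  rw [sum_const, card_univ, Fintype.card_fin, nsmul_eq_mul]
  have : M * (d * (e / (M * (d + 1)))) = e * (d / (d + 1)) := by field_simp
  rw [this]
  refine mul_le_of_le_one_right he.le ?_
  rw [div_le_one (by positivity)]; linarith
end FDE
namespace FDE
variable {d : ℕ}
structure Setup (m T : ℝ) (Ω : Set (EuclideanSpace ℝ (Fin d))) (u : ℝ → EuclideanSpace ℝ (Fin d) → ℝ)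
    (x0 : EuclideanSpace ℝ (Fin d)) (R : ℝ) : Prop where
  op : IsOpen Ω
  sol : IsFDESol m (Ioo 0 T ×ˢ Ω) u
  hR : 0 < R
  hB : closedBall x0 (6 * R) ⊆ Ω
variable {m T : ℝ} {Ω : Set (EuclideanSpace ℝ (Fin d))} {u : ℝ → EuclideanSpace ℝ (Fin d) → ℝ}
    {x0 : EuclideanSpace ℝ (Fin d)} {R : ℝ}
theorem Setup.pos (s : Setup m T Ω u x0 R) {a : ℝ} {x : EuclideanSpace ℝ (Fin d)} (ha : 0 < a) (haT : a < T)
    (hx : x ∈ closedBall x0 (6 * R)) : 0 < u a x := s.sol.1 (a, x) ⟨⟨ha, haT⟩, s.hB hx⟩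
theorem Setup.cont (s : Setup m T Ω u x0 R) {a : ℝ} (ha : 0 < a) (haT : a < T) : ContinuousOn (u a) (closedBall x0 (6 * R)) :=
  s.sol.2.1.continuousOn.comp (f := fun x => (a, x)) (by fun_prop) fun _ hx => ⟨⟨ha, haT⟩, s.hB hx⟩
theorem Setup.mem (s : Setup m T Ω u x0 R) {n : ℕ} {x : Fin d → ℤ} (h : nsq n x ≤ 25) : x0 + (R / n) • emb x ∈ closedBall x0 (6 * R) :=
  closedBall_subset_closedBall (by linarith [s.hR]) (emb_mem s.hR (by norm_num : (0:ℝ) ≤ 5) (by linarith))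
theorem prep (s : Setup m T Ω u x0 R) {a l c θ : ℝ} (ha : 0 < a) (hl : 0 < l) (hθ0 : 0 < θ) (hθ : θ ≤ 1) (haT : a + l * θ < T)
    (hc : 0 < c) (hcl : c * l = c ^ m * R ^ 2) :
    ∃ K : ℝ, 1 ≤ K ∧ ∀ e : ℝ, 0 < e → ∀ᶠ n : ℕ in atTop, Grid n (th θ n) ∧ th θ n (n ^ 2) = θ ∧ ∃ v : ℕ → (Fin d → ℤ) → ℝ,
      (∀ k x, 0 ≤ v k x) ∧ (∀ k x, v k x ≤ K) ∧
      (∀ k, k < n ^ 2 → ∀ x, nsq n x ≤ 16 → |v (k + 1) x - v k x - (th θ n (k + 1) - th θ n k) * lap n (fun y => v (k + 1) y ^ m) x| ≤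
        (th θ n (k + 1) - th θ n k) * e) ∧
      (∀ x, nsq n x ≤ 25 → v 0 x = c * u a (x0 + (R / n) • emb x)) ∧
      (∀ x, nsq n x ≤ 25 → v (n ^ 2) x = c * u (a + l * θ) (x0 + (R / n) • emb x)) := by
  set Q := Icc a (a + l * θ) ×ˢ closedBall x0 (6 * R) with hQ
  have hQc : IsCompact Q := isCompact_Icc.prod (isCompact_closedBall _ _)
  have hQs : Q ⊆ Ioo 0 T ×ˢ Ω := prod_mono (fun t ht => ⟨by linarith [ht.1], by linarith [ht.2]⟩) s.hB
  obtain ⟨K, hK⟩ := hQc.exists_bound_of_continuousOn (s.sol.2.1.continuousOn.mono hQs)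
  refine ⟨max 1 (c * K), le_max_left _ _, fun e he => ?_⟩
  filter_upwards [consist s.op s.sol s.hR s.hB ha hl hθ haT hc hcl he, eventually_ge_atTop 1] with n hn hn1
  have gr := th_grid hθ0 hθ hn1
  have hl2 : th θ n (n ^ 2) = θ := th_last hn1
  refine ⟨gr, hl2, fun k => disc c a l x0 R u n (th θ n) (min k (n ^ 2)), ?_, ?_, ?_, ?_, ?_⟩
  · intro k x
    beta_reduce; rw [disc]
    split_ifs with h
    · have h1 := gr.nonneg (min k (n ^ 2))
      have h2 := gr.mono (min_le_right k (n ^ 2))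
      rw [hl2] at h2
      have h3 := mul_nonneg hl.le h1
      have h4 := mll h2 hl.le
      exact mul_nonneg hc.le (s.pos (by linarith) (by linarith) (s.mem h)).le
    · exact le_rfl
  · intro k x
    beta_reduce; rw [disc]
    split_ifs with h
    · have h1 := gr.nonneg (min k (n ^ 2))
      have h2 := gr.mono (min_le_right k (n ^ 2))
      rw [hl2] at h2
      have h3 := mul_nonneg hl.le h1
      have h4 := mll h2 hl.le
      have h5 := hK (a + l * th θ n (min k (n ^ 2)), x0 + (R / n) • emb x) (mk_mem_prod ⟨by linarith, by linarith⟩ (s.mem h))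
      exact le_max_of_le_right (mll ((le_abs_self _).trans h5) hc.le)
    · exact le_max_of_le_left zero_le_one
  · intro k hk x hx
    have := hn (th θ n) gr (n ^ 2) hl2.le k hk x hx
    beta_reduce
    rwa [min_eq_left (by omega : k ≤ n ^ 2), min_eq_left (by omega : k + 1 ≤ n ^ 2)]
  · intro x hx
    beta_reduce
    rw [disc, if_pos hx, Nat.zero_min, gr.zero, mul_zero, add_zero]
  · intro x hx
    beta_reduce
    rw [disc, if_pos hx, min_self, hl2]
theorem UB0 (d : ℕ) (hd : 3 ≤ d) {m p : ℝ} (hm : 0 < m) (hm1 : m < 1) (hp : 1 ≤ p) (hpd : d * (1 - m) < 2 * p) :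
    ∃ C : ℝ, 0 < C ∧ ∀ {T : ℝ} {Ω : Set (EuclideanSpace ℝ (Fin d))} {u : ℝ → EuclideanSpace ℝ (Fin d) → ℝ}
    {x0 : EuclideanSpace ℝ (Fin d)} {R : ℝ}, Setup m T Ω u x0 R → ∀ a t c : ℝ, 0 < a → 0 < t → a + t < T → 0 < c →
      c ^ (1 - m) = R ^ 2 / t → c ^ p * ((∫ y in ball x0 R, u a y ^ p) / R ^ d) ≤ 1 → c * u (a + t) x0 ≤ C := by
  obtain ⟨C, hC, H⟩ := upperB (d := d) hd hm hm1 hp hpd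
  refine ⟨C, hC, fun {T Ω u x0 R} s a t c ha ht haT hc hct hX => ?_⟩
  have hcl : c * t = c ^ m * R ^ 2 := by
    have : c = c ^ m * c ^ (1 - m) := by rw [← rpow_add hc]; simp
    rw [hct] at this
    nth_rewrite 1 [this]; field_simp
  obtain ⟨K, hK, hv⟩ := prep s ha ht one_pos le_rfl (by linarith) hc hcl
  have hcont : ContinuousOn (fun y => (c * u a y) ^ p) (closedBall x0 R) :=
    (continuousOn_const.mul ((s.cont ha (by linarith)).mono (closedBall_subset_closedBall (by linarith [s.hR])))).rpow_const fun _ _ => Or.inr (by linarith)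
  have hr := (riem_lt s.hR hcont).2
  have hlim : (∫ y in ball x0 R, (c * u a y) ^ p) / R ^ d < 2 := by
    have : ∫ y in ball x0 R, (c * u a y) ^ p = c ^ p * ∫ y in ball x0 R, u a y ^ p := by
      rw [← integral_const_mul]
      refine setIntegral_congr_fun measurableSet_ball fun y hy => ?_
      exact mul_rpow hc.le (s.pos ha (by linarith) (ball_subset_closedBall.trans (closedBall_subset_closedBall (by linarith [s.hR])) hy)).le
    rw [this, mul_div_assoc]; linarith
  obtain ⟨n, ⟨gr, hN, v, v0, vK, vs, vi, vf⟩, hn, hI⟩ := ((hv 1 one_pos).and ((H K hK).and (hr.eventually (gt_mem_nhds hlim)))).exists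
  have := hn _ gr _ hN v v0 vK ?_ ?_
  · rw [vf 0 (by rw [nsq_zero]; norm_num)] at this
    have e : emb (0 : Fin d → ℤ) = 0 := by ext i; simp [emb]
    simpa [e] using this
  · intro k hk x hx
    have := (abs_le.1 (vs k hk x (by linarith))).2
    linarith
  · refine le_trans (le_of_eq ?_) hI.le
    congr 1; ext x
    split_ifs with h
    · rw [vi x (by linarith)]
    · rfl
theorem UB (d : ℕ) (hd : 3 ≤ d) {m p : ℝ} (hm : 0 < m) (hm1 : m < 1) (hp : 1 ≤ p) (hpd : d * (1 - m) < 2 * p) :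
    ∃ C : ℝ, 0 < C ∧ ∀ {T : ℝ} {Ω : Set (EuclideanSpace ℝ (Fin d))} {u : ℝ → EuclideanSpace ℝ (Fin d) → ℝ}
    {x0 : EuclideanSpace ℝ (Fin d)} {R : ℝ}, Setup m T Ω u x0 R → ∀ a t Z : ℝ, 0 < a → 0 < t → a + t < T → 0 < Z →
      (∫ y in ball x0 R, u a y ^ p) / R ^ d = Z →
      u (a + t) x0 ≤ C * ((t / R ^ 2) ^ (1 / (1 - m)) + (t / R ^ 2) ^ (-(d / (2 * p - d * (1 - m)))) * Z ^ (2 / (2 * p - d * (1 - m)))) := by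
  obtain ⟨C, hC, H⟩ := UB0 d hd hm hm1 hp hpd
  refine ⟨C, hC, fun {T Ω u x0 R} s a t Z ha ht haT hZ hZe => ?_⟩
  have hm' : 0 < 1 - m := by linarith
  have hR := s.hR
  set α := 1 / (1 - m) with hα
  set q := 2 * p - d * (1 - m) with hq
  have hq0 : 0 < q := by rw [hq]; linarith
  set σ := t / R ^ 2 with hσ
  have hσ0 : 0 < σ := by positivity
  have hn0 : 0 ≤ σ ^ (-(d / q)) * Z ^ (2 / q) := by positivity
  have hn1 : 0 ≤ σ ^ α := by positivity
  by_cases h1 : (σ⁻¹ ^ α) ^ p * Z ≤ 1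
  · have h2 := H s a t (σ⁻¹ ^ α) ha ht haT (by positivity) (by
      rw [← rpow_mul (by positivity), hα, one_div_mul_cancel hm'.ne', rpow_one, hσ, inv_div]) (by rw [hZe]; exact h1)
    rw [inv_rpow hσ0.le, inv_mul_le_iff₀ (by positivity)] at h2
    have := mul_nonneg hC.le hn0
    linarith
  · push Not at h1
    -- smaller radius
    set f := σ ^ (p / q) * Z ^ (-((1 - m) / q)) with hf
    have hf0 : 0 < f := by positivity
    have hfl : Real.log f = (p * Real.log σ - (1 - m) * Real.log Z) / q := by
      rw [hf, Real.log_mul (by positivity) (by positivity), Real.log_rpow hσ0, Real.log_rpow hZ]; ring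
    have hl1 : 0 < -(α * p * Real.log σ) + Real.log Z := by
      have := Real.log_pos h1
      rw [Real.log_mul (by positivity) hZ.ne', Real.log_rpow (by positivity), Real.log_rpow (by positivity), Real.log_inv] at this
      linarith
    have hf1 : f ≤ 1 := by
      rw [← Real.log_nonpos_iff hf0.le, hfl]
      refine div_nonpos_of_nonpos_of_nonneg ?_ hq0.le
      have := mul_pos hm' hl1
      have e : (1 - m) * (-(α * p * Real.log σ) + Real.log Z) = -(p * Real.log σ) + (1 - m) * Real.log Z := by rw [hα]; field_simp
      rw [e] at this; linarith
    set r := f * R with hr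
    have hr0 : 0 < r := by positivity
    have hrR : r ≤ R := mul_le_of_le_one_left hR.le hf1
    have s' : Setup m T Ω u x0 r := ⟨s.op, s.sol, hr0, (closedBall_subset_closedBall (by linarith)).trans s.hB⟩
    have hc0 : 0 < (f ^ 2 / σ) ^ α := by positivity
    have h2 := H s' a t ((f ^ 2 / σ) ^ α) ha ht haT hc0 (by
      rw [← rpow_mul (by positivity), hα, one_div_mul_cancel hm'.ne', rpow_one, hσ, hr]; field_simp) ?_
    · rw [mul_comm, ← le_div_iff₀ hc0] at h2
      have h3 : ((f ^ 2 / σ) ^ α)⁻¹ = σ ^ (-(d / q)) * Z ^ (2 / q) := by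
        refine Real.log_injOn_pos (mem_Ioi.2 (by positivity)) (mem_Ioi.2 (by positivity)) ?_
        rw [Real.log_inv, Real.log_rpow (by positivity), Real.log_div (by positivity) hσ0.ne', Real.log_pow, hfl,
          Real.log_mul (by positivity) (by positivity), Real.log_rpow hσ0, Real.log_rpow hZ, hα]
        have e : (d:ℝ) * (1 - m) = 2 * p - q := by rw [hq]; ring
        have e' : (d:ℝ) = (2 * p - q) / (1 - m) := by rw [← e]; field_simp
        rw [e']; push_cast; field_simp; ring
      rw [div_eq_mul_inv, h3] at h2
      have := mul_nonneg hC.le hn1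
      linarith
    · have hmono : ∫ y in ball x0 r, u a y ^ p ≤ ∫ y in ball x0 R, u a y ^ p := by
        refine setIntegral_mono_set ?_ ?_ (HasSubset.Subset.eventuallyLE (ball_subset_ball hrR))
        · exact (((s.cont ha (by linarith)).rpow_const fun _ _ => Or.inr (by linarith)).integrableOn_compact
            (isCompact_closedBall _ _)).mono_set (ball_subset_closedBall.trans (closedBall_subset_closedBall (by linarith)))
        · refine (ae_restrict_iff' measurableSet_ball).2 (Eventually.of_forall fun y hy => ?_)
          exact rpow_nonneg (s.pos ha (by linarith) (ball_subset_closedBall.trans (closedBall_subset_closedBall (by linarith)) hy)).le _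
      have h4 : (∫ y in ball x0 r, u a y ^ p) / r ^ d ≤ Z / f ^ d := by
        rw [← hZe, hr, mul_pow, div_div, mul_comm (R ^ d)]
        gcongr
      refine (mll h4 (by positivity)).trans (le_of_eq ?_)
      refine Real.log_injOn_pos (mem_Ioi.2 (by positivity)) (mem_Ioi.2 (by positivity)) ?_
      rw [Real.log_mul (by positivity) (by positivity), Real.log_rpow (by positivity), Real.log_rpow (by positivity),
        Real.log_div (by positivity) hσ0.ne', Real.log_div hZ.ne' (by positivity), Real.log_pow, Real.log_pow, hfl, Real.log_one, hα]
      have e : (d:ℝ) * (1 - m) = 2 * p - q := by rw [hq]; ring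
      have e' : (d:ℝ) = (2 * p - q) / (1 - m) := by rw [← e]; field_simp
      rw [e']; push_cast; field_simp; ring
end FDE
namespace FDE
variable {d : ℕ} {m T : ℝ} {Ω : Set (EuclideanSpace ℝ (Fin d))} {u : ℝ → EuclideanSpace ℝ (Fin d) → ℝ}
    {x0 : EuclideanSpace ℝ (Fin d)} {R : ℝ}
theorem lims (s : Setup m T Ω u x0 R) {a c p Y Z : ℝ} (ha : 0 < a) (haT : a < T) (hc : 0 < c) (hp : 1 ≤ p)
    (hY : (∫ y in ball x0 R, u a y) / R ^ d = Y) (hZ : (∫ y in ball x0 R, u a y ^ p) / R ^ d = Z) :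
    Tendsto (fun n : ℕ => I n (fun x => if nsq n x < 1 then c * u a (x0 + (R / n) • emb x) else 0)) atTop (𝓝 (c * Y)) ∧
    Tendsto (fun n : ℕ => I n (fun x => if nsq n x < 1 then (c * u a (x0 + (R / n) • emb x)) ^ p else 0)) atTop (𝓝 (c ^ p * Z)) := by
  have hsub : closedBall x0 R ⊆ closedBall x0 (6 * R) := closedBall_subset_closedBall (by linarith [s.hR])
  have hc1 : ContinuousOn (fun y => c * u a y) (closedBall x0 R) := continuousOn_const.mul ((s.cont ha haT).mono hsub)
  have hc2 : ContinuousOn (fun y => (c * u a y) ^ p) (closedBall x0 R) := hc1.rpow_const fun _ _ => Or.inr (by linarith)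
  constructor
  · have := (riem_lt s.hR hc1).1
    rwa [integral_const_mul, mul_div_assoc, hY] at this
  · have := (riem_lt s.hR hc2).1
    have e : ∫ y in ball x0 R, (c * u a y) ^ p = c ^ p * ∫ y in ball x0 R, u a y ^ p := by
      rw [← integral_const_mul]
      exact setIntegral_congr_fun measurableSet_ball fun y hy => mul_rpow hc.le (s.pos ha haT (hsub (ball_subset_closedBall hy))).le
    rwa [e, mul_div_assoc, hZ] at this
theorem Hbound (s : Setup m T Ω u x0 R) {a p Y Z : ℝ} (ha : 0 < a) (haT : a < T) (hp : 1 ≤ p) (hZ0 : 0 < Z)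
    (hY : (∫ y in ball x0 R, u a y) / R ^ d = Y) (hZ : (∫ y in ball x0 R, u a y ^ p) / R ^ d = Z ^ p) : Y / Z ≤ 11 ^ d + 2 := by
  obtain ⟨h1, h2⟩ := lims s ha haT (inv_pos.2 hZ0) hp hY hZ
  rw [inv_rpow hZ0.le, inv_mul_cancel₀ (by positivity)] at h2
  rw [← div_eq_inv_mul] at h1
  refine le_of_tendsto h1 ?_
  filter_upwards [h2.eventually (gt_mem_nhds one_lt_two), eventually_ge_atTop 1] with n hn hn1
  refine le_trans (I_mono (g := fun x => 1 + if nsq n x < 1 then (Z⁻¹ * u a (x0 + (R / n) • emb x)) ^ p else 0) fun x _ => ?_) ?_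
  · split_ifs with h
    · have hu := s.pos ha haT (s.mem (h.le.trans (by norm_num)) : x0 + (R / n) • emb x ∈ _)
      have hw : 0 ≤ Z⁻¹ * u a (x0 + (R / n) • emb x) := by positivity
      rcases le_total (Z⁻¹ * u a (x0 + (R / n) • emb x)) 1 with h | h
      · have := rpow_nonneg hw p; linarith
      · have := self_le_rpow_of_one_le h hp; linarith
    · norm_num
  · rw [I_add]
    have := I_one_le (d := d) hn1
    linarith
theorem approx (hd : 1 ≤ d) (z : EuclideanSpace ℝ (Fin d)) {n : ℕ} (hn : 1 ≤ n) : ∃ x : Fin d → ℤ, ‖(1 / n : ℝ) • emb x - z‖ ≤ d / n := by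
  have hn0 : (0:ℝ) < n := by positivity
  refine ⟨fun i => ⌊n * z i⌋, ?_⟩
  rw [← sq_le_sq₀ (norm_nonneg _) (by positivity), EuclideanSpace.norm_sq_eq]
  have h1 : ∀ i ∈ Finset.univ, ‖((1 / n : ℝ) • emb (fun i => ⌊n * z i⌋) - z) i‖ ^ 2 ≤ (1 / n : ℝ) ^ 2 := by
    intro i _
    rw [sq_le_sq₀ (norm_nonneg _) (by positivity)]
    simp only [emb, PiLp.sub_apply, PiLp.smul_apply, smul_eq_mul, Real.norm_eq_abs]
    have h2 := Int.floor_le (n * z i)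
    have h3 := Int.lt_floor_add_one (n * z i)
    have e : 1 / n * (⌊n * z i⌋ : ℝ) - z i = (⌊n * z i⌋ - n * z i) / n := by field_simp
    rw [e, abs_div, abs_of_pos hn0]
    gcongr
    rw [abs_le]; constructor <;> linarith
  refine (sum_le_sum h1).trans ?_
  rw [sum_const, card_univ, Fintype.card_fin, nsmul_eq_mul, div_pow, div_pow, one_pow, ← mul_div_assoc, mul_one]
  have : (1:ℝ) ≤ d := by exact_mod_cast hd
  gcongr
  exact le_self_pow₀ this two_ne_zero
theorem LB (d : ℕ) (hd : 3 ≤ d) {m p : ℝ} (hm : 0 < m) (hm1 : m < 1) (hp : 1 ≤ p) (hpd : d * (1 - m) < 2 * p) :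
    ∃ k κ : ℝ, 0 < k ∧ 0 < κ ∧ ∀ {T : ℝ} {Ω : Set (EuclideanSpace ℝ (Fin d))} {u : ℝ → EuclideanSpace ℝ (Fin d) → ℝ}
    {x0 : EuclideanSpace ℝ (Fin d)} {R : ℝ}, Setup m T Ω u x0 R → ∀ a t Y Z : ℝ, 0 < a → 0 < t → a + t < T → 0 < Y → 0 < Z →
      (∫ y in ball x0 R, u a y) / R ^ d = Y → (∫ y in ball x0 R, u a y ^ p) / R ^ d = Z ^ p → t / R ^ 2 ≤ κ * Y ^ (1 - m) →
      ∀ x ∈ ball x0 R, k * (Y / Z) * (t / R ^ 2) ^ (1 / (1 - m) * m) ≤ u (a + t) x ^ m := by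
  obtain ⟨c0, κ0, hc0, hκ0, H⟩ := thmC (d := d) hd hm hm1 hp hpd
  have hm' : 0 < 1 - m := by linarith
  set CH : ℝ := 11 ^ d + 2 with hCH
  have hCH0 : 0 < CH := by positivity
  refine ⟨c0 / 2, min (κ0 * (1 / 2) ^ (1 - m)) ((CH ^ (1 - m))⁻¹), by positivity, lt_min (by positivity) (by positivity),
    fun {T Ω u x0 R} s a t Y Z ha ht haT hY0 hZ0 hY hZ hσκ x hx => ?_⟩
  have hR := s.hR
  set σ := t / R ^ 2 with hσ
  have hσ0 : 0 < σ := by positivity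
  set ℓ := Z ^ (1 - m) with hℓ
  have hℓ0 : 0 < ℓ := by positivity
  set θ := σ / ℓ with hθ
  have hθ0 : 0 < θ := by positivity
  have hHb : Y / Z ≤ CH := Hbound s ha (by linarith) hp hZ0 hY hZ
  have hθH : θ ≤ min (κ0 * (1 / 2) ^ (1 - m)) ((CH ^ (1 - m))⁻¹) * (Y / Z) ^ (1 - m) := by
    rw [hθ, div_rpow hY0.le hZ0.le, ← mul_div_assoc]; gcongr
  have hH0 : 0 < Y / Z := by positivity
  have hθ1 : θ ≤ 1 := by
    refine hθH.trans ((mlr (min_le_right _ _) (by positivity)).trans ?_)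
    rw [inv_mul_le_iff₀ (by positivity), mul_one]
    exact rpow_le_rpow hH0.le hHb hm'.le
  have hθ2 : θ ≤ κ0 * (Y / Z / 2) ^ (1 - m) := by
    refine hθH.trans ((mlr (min_le_left _ _) (by positivity)).trans (le_of_eq ?_))
    rw [mul_assoc, ← mul_rpow (by positivity) hH0.le]; congr 2; ring
  set l := R ^ 2 * ℓ with hl
  have hlθ : l * θ = t := by rw [hl, hθ, hσ]; field_simp
  have hc : 0 < Z⁻¹ := inv_pos.2 hZ0
  have hcl : Z⁻¹ * l = Z⁻¹ ^ m * R ^ 2 := by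
    have e1 : Z⁻¹ ^ m * Z = Z ^ (1 - m) := by rw [inv_rpow hZ0.le, ← rpow_neg hZ0.le]; nth_rewrite 2 [← rpow_one Z]; rw [← rpow_add hZ0]; congr 1; ring
    rw [hl, hℓ, ← e1]; field_simp
  obtain ⟨K, hK, hv⟩ := prep s (l := l) ha (by positivity) hθ0 hθ1 (by rw [hlθ]; exact haT) hc hcl
  obtain ⟨h1, h2⟩ := lims s ha (by linarith) hc hp hY hZ
  rw [inv_rpow hZ0.le, inv_mul_cancel₀ (by positivity)] at h2
  rw [← div_eq_inv_mul] at h1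
  by_contra hcon
  push Not at hcon
  have hx6 : x ∈ ball x0 (6 * R) := ball_subset_ball (by linarith) hx
  have hcat : ContinuousAt (fun z => u (a + t) z ^ m) x :=
    ((s.cont (by linarith) haT).continuousAt (mem_of_superset (isOpen_ball.mem_nhds hx6) ball_subset_closedBall)).rpow_const (Or.inr hm.le)
  obtain ⟨δ, hδ, hδu⟩ := Metric.eventually_nhds_iff.1 (hcat.eventually (gt_mem_nhds hcon))
  set z := R⁻¹ • (x - x0) with hz
  have hxz : x = x0 + R • z := by rw [hz, smul_smul, mul_inv_cancel₀ hR.ne', one_smul]; abel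
  have hz1 : ‖z‖ < 1 := by
    rw [hz, norm_smul, norm_inv, Real.norm_of_nonneg hR.le, inv_mul_lt_iff₀ hR, mul_one]
    exact mem_ball_iff_norm.1 hx
  set ρ := min 1 (δ / (8 * R)) with hρ
  have hρ0 : 0 < ρ := lt_min one_pos (by positivity)
  obtain ⟨e0, he0, H1⟩ := H (Y / Z / 2) θ ρ K (by positivity) hθ0 hθ1 hθ2 hρ0 (min_le_left _ _) hK
  have hdn : Tendsto (fun n : ℕ => (d:ℝ) / n) atTop (𝓝 0) := tendsto_const_div_atTop_nhds_zero_nat _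
  obtain ⟨n, ⟨gr, hN, v, v0, vK, vs, vi, vf⟩, hn, hI1, hI2, hn1, hd1, hd2⟩ := ((hv e0 he0).and (H1.and ((h1.eventually (lt_mem_nhds (half_lt_self hH0))).and
    ((h2.eventually (gt_mem_nhds one_lt_two)).and ((eventually_ge_atTop 1).and ((hdn.eventually (gt_mem_nhds (sub_pos.2 hz1))).and
      (hdn.eventually (gt_mem_nhds (by positivity : 0 < δ / (8 * R)))))))))).exists
  obtain ⟨xn, hxn⟩ := approx (by omega) z hn1
  have hxn1 : nsq n xn ≤ 1 := by
    have : ‖(1 / n : ℝ) • emb xn‖ ≤ 1 := by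
      have := norm_le_norm_add_norm_sub' ((1 / n : ℝ) • emb xn) z
      linarith
    simpa using (norm_emb_le zero_le_one).1 this
  obtain ⟨y, hy1, hy2⟩ := hn _ gr _ hN v v0 (fun x => vK 0 x) (fun k hk x hx => by
    have := (abs_le.1 (vs k hk x hx.le)).1
    linarith) (by
    refine le_trans (le_of_eq ?_) hI2.le
    congr 1; ext x
    split_ifs with h
    · rw [vi x (by linarith)]
    · rfl) (by
    refine le_trans hI1.le (le_of_eq ?_)
    congr 1; ext x
    split_ifs with h
    · rw [vi x (by linarith)]
    · rfl) xn hxn1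
  have hyx : ‖(1 / n : ℝ) • emb y - (1 / n : ℝ) • emb xn‖ ≤ 2 * ρ := by
    rw [← smul_sub, ← emb_sub]; exact (norm_emb_le (by positivity)).2 (by linarith)
  have hyz : ‖(1 / n : ℝ) • emb y - z‖ ≤ 2 * ρ + d / n := (norm_sub_le_norm_sub_add_norm_sub _ _ _).trans (add_le_add hyx hxn)
  have hρ1 : ρ ≤ 1 := min_le_left _ _
  have hρ2 : ρ ≤ δ / (8 * R) := min_le_right _ _
  have hy25 : nsq n y ≤ 25 := by
    have : ‖(1 / n : ℝ) • emb y‖ ≤ 5 := by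
      have := norm_le_norm_add_norm_sub' ((1 / n : ℝ) • emb y) z
      linarith
    have := (norm_emb_le (by norm_num)).1 this
    linarith
  have hdist : dist (x0 + (R / n) • emb y) x < δ := by
    have e : x0 + (R / n) • emb y - x = R • ((1 / n : ℝ) • emb y - z) := by
      rw [hxz, smul_sub, smul_smul R (1 / n : ℝ) (emb y), ← div_eq_mul_one_div]; abel
    rw [dist_eq_norm, e, norm_smul, Real.norm_of_nonneg hR.le]
    calc R * ‖(1 / n : ℝ) • emb y - z‖ ≤ R * (3 * (δ / (8 * R))) := by gcongr; linarith
      _ = 3 / 8 * δ := by field_simp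
      _ < δ := by linarith
  have hfin := hδu hdist
  rw [vf y hy25, hlθ] at hy2
  have hup := s.pos (by linarith) haT (s.mem hy25)
  rw [mul_rpow hc.le hup.le] at hy2
  have hθm : θ ^ (1 / (1 - m) * m) = Z⁻¹ ^ m * σ ^ (1 / (1 - m) * m) := by
    rw [hθ, div_rpow hσ0.le hℓ0.le, hℓ, ← rpow_mul hZ0.le, ← mul_assoc, mul_one_div_cancel hm'.ne', one_mul, inv_rpow hZ0.le]; ring
  rw [hθm] at hy2
  have h5 : Z⁻¹ ^ m * (c0 / 2 * (Y / Z) * σ ^ (1 / (1 - m) * m)) ≤ Z⁻¹ ^ m * u (a + t) (x0 + (R / n) • emb y) ^ m := by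
    linarith
  have := le_of_mul_le_mul_left h5 (by positivity)
  linarith
end FDE
namespace FDE
theorem Ext (d : ℕ) {m : ℝ} (hm : 0 < m) (hm1 : m < 1) :
    ∃ C : ℝ, 0 < C ∧ ∀ {T : ℝ} {Ω : Set (EuclideanSpace ℝ (Fin d))} {u : ℝ → EuclideanSpace ℝ (Fin d) → ℝ}
    {x0 : EuclideanSpace ℝ (Fin d)} {R : ℝ}, Setup m T Ω u x0 R → ExtinctAt T Ω u → ∀ a Y : ℝ, 0 < a → a < T → 0 < Y →
      (∫ y in ball x0 R, u a y) / R ^ d = Y → Y ^ (1 - m) ≤ C * ((T - a) / R ^ 2) := by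
  obtain ⟨c0, C1, hc0, hC1, H⟩ := lemmaA (d := d) hm hm1 (ρ := 4) (by norm_num) (by norm_num)
  have hm' : 0 < 1 - m := by linarith
  set C2 : ℝ := (11 ^ d + 1) ^ (1 - m) + C1 * 1 with hC2
  have hC20 : 0 < C2 := by positivity
  refine ⟨C2 / c0 ^ (1 - m), by positivity, fun {T Ω u x0 R} s hE a Y ha haT hY0 hY => ?_⟩
  have hR := s.hR
  have hTa : 0 < T - a := by linarith
  set c1 := (2 * R ^ 2 / (T - a)) ^ (1 / (1 - m)) with hc1
  have hc10 : 0 < c1 := by positivity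
  set Q := Icc ((a + T) / 2) T ×ˢ closedBall x0 (6 * R) with hQ
  have hQc : IsCompact Q := isCompact_Icc.prod (isCompact_closedBall _ _)
  have hQs : Q ⊆ Ioc 0 T ×ˢ Ω := prod_mono (fun t ht => ⟨by linarith [ht.1], ht.2⟩) s.hB
  obtain ⟨δ, hδ, hun⟩ := Metric.uniformContinuousOn_iff.1 (hQc.uniformContinuousOn_of_continuous (hE.1.mono hQs)) (1 / c1) (by positivity)
  have ht : ∃ t, (T - a) / 2 ≤ t ∧ a + t < T ∧ T - (a + t) < δ := by
    refine ⟨max ((T - a) / 2) (T - a - δ / 2), le_max_left _ _, ?_, ?_⟩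
    · have : max ((T - a) / 2) (T - a - δ / 2) < T - a := max_lt (by linarith) (by linarith)
      linarith
    · linarith [le_max_right ((T - a) / 2) (T - a - δ / 2)]
  obtain ⟨t, ht1, ht2, ht3⟩ := ht
  have ht0 : 0 < t := by linarith
  have hsmall : ∀ x ∈ closedBall x0 (6 * R), c1 * u (a + t) x ≤ 1 := by
    intro x hx
    have h1 := hun (a + t, x) (mk_mem_prod ⟨by linarith, ht2.le⟩ hx) (T, x) (mk_mem_prod ⟨by linarith, le_rfl⟩ hx) (by
      rw [Prod.dist_eq, dist_self, Real.dist_eq]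
      refine max_lt ?_ hδ
      rw [abs_lt]; constructor <;> linarith)
    simp only [hE.2.1 x (s.hB hx), Real.dist_eq, sub_zero] at h1
    have h2 := mll ((le_abs_self _).trans h1.le) hc10.le
    rwa [mul_one_div_cancel hc10.ne'] at h2
  set c := (R ^ 2 / t) ^ (1 / (1 - m)) with hc
  have hc0' : 0 < c := by positivity
  have hcc : c ≤ c1 := by
    refine rpow_le_rpow (by positivity) ?_ (by positivity)
    rw [div_le_div_iff₀ ht0 hTa]
    have := mll ht1 (by positivity : 0 ≤ 2 * R ^ 2)
    linarith
  have hct : c ^ (1 - m) = R ^ 2 / t := by rw [hc, ← rpow_mul (by positivity), one_div_mul_cancel hm'.ne', rpow_one]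
  have hcl : c * t = c ^ m * R ^ 2 := by
    have : c = c ^ m * c ^ (1 - m) := by rw [← rpow_add hc0']; simp
    rw [hct] at this
    nth_rewrite 1 [this]; field_simp
  obtain ⟨K, hK, hv⟩ := prep s ha ht0 one_pos le_rfl (by linarith) hc0' hcl
  obtain ⟨h1, -⟩ := lims s ha haT hc0' le_rfl hY rfl
  have key : (c0 * (c * Y)) ^ (1 - m) ≤ C2 := by
    refine le_of_tendsto ((h1.const_mul c0).rpow_const (Or.inr hm'.le)) ?_
    filter_upwards [hv ((11:ℝ) ^ d)⁻¹ (by positivity), eventually_ge_atTop 1] with n hvn hn1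
    obtain ⟨gr, hN, v, v0, vK, vs, vi, vf⟩ := hvn
    have h2 := H n hn1 _ gr (n ^ 2) v 1 ((11:ℝ) ^ d)⁻¹ one_pos (by positivity) (by rw [one_rpow, inv_mul_cancel₀ (by positivity)]) v0
      (fun k hk x hx => by
        have := (abs_le.1 (vs k hk x (by linarith))).1
        linarith)
    have e1 : I n (fun y => if nsq n y < 1 then v 0 y else 0) = I n (fun x => if nsq n x < 1 then c * u a (x0 + (R / n) • emb x) else 0) := by
      congr 1; ext x
      split_ifs with h
      · rw [vi x (by linarith)]
      · rfl
    have e2 : I n (fun y => if nsq n y < 4 then v (n ^ 2) y else 0) ≤ 11 ^ d := by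
      refine (I_mono (g := fun _ => (1:ℝ)) fun x _ => ?_).trans (I_one_le hn1)
      split_ifs with h
      · rw [vf x (by linarith), mul_one]
        have hx := s.mem (by linarith : nsq n x ≤ 25)
        exact (mlr hcc (s.pos (by linarith) ht2 hx).le).trans (hsmall _ hx)
      · exact zero_le_one
    have e3 : 0 ≤ I n (fun y => if nsq n y < 4 then v (n ^ 2) y else 0) := I_nonneg fun x _ => by
      split_ifs
      · exact v0 _ _
      · exact le_rfl
    rw [e1, hN] at h2
    refine h2.trans ?_
    rw [hC2]; gcongr
  rw [mul_rpow hc0.le (by positivity), mul_rpow hc0'.le hY0.le, hct] at key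
  have h3 : c0 ^ (1 - m) * (R ^ 2 / t * Y ^ (1 - m)) = (c0 ^ (1 - m) * R ^ 2 / t) * Y ^ (1 - m) := by ring
  rw [h3, ← le_div_iff₀' (by positivity)] at key
  refine key.trans ?_
  have h4 : C2 / (c0 ^ (1 - m) * R ^ 2 / t) = C2 / c0 ^ (1 - m) * (t / R ^ 2) := by field_simp
  rw [h4]; gcongr; linarith
theorem coreH (d : ℕ) (hd : 3 ≤ d) {m p : ℝ} (hm : 0 < m) (hm1 : m < 1) (hp : 1 ≤ p) (hpd : d * (1 - m) < 2 * p) :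
    ∃ h1 h2 : ℝ, 0 < h1 ∧ 0 < h2 ∧ ∀ {T : ℝ} {Ω : Set (EuclideanSpace ℝ (Fin d))} {u : ℝ → EuclideanSpace ℝ (Fin d) → ℝ}
    {x0 : EuclideanSpace ℝ (Fin d)} {R : ℝ}, Setup m T Ω u x0 R → ExtinctAt T Ω u → ∀ a Y Z : ℝ, 0 < a → a < T → 0 < Y → 0 < Z →
      (∫ y in ball x0 R, u a y) / R ^ d = Y → (∫ y in ball x0 R, u a y ^ p) / R ^ d = Z ^ p →
      h2 * Y ^ (1 - m) ≤ (T - a) / R ^ 2 ∧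
      ∀ ε t t' : ℝ, 0 < ε → ε ≤ 1 → a + t < T → a + t' < T → ε * (h2 * Y ^ (1 - m)) < t / R ^ 2 → t / R ^ 2 < h2 * Y ^ (1 - m) →
        ε * (h2 * Y ^ (1 - m)) < t' / R ^ 2 → t' / R ^ 2 < h2 * Y ^ (1 - m) → ∀ x ∈ ball x0 R,
        (h1 * ε ^ (2 * p / (2 * p - d * (1 - m)) / (1 - m)) * (Y / Z) ^ (2 * p / (2 * p - d * (1 - m)) + 1 / m)) * u (a + t) x0 ≤ u (a + t') x := by
  obtain ⟨Ce, hCe, HE⟩ := Ext d hm hm1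
  obtain ⟨C, hC, HU⟩ := UB d hd hm hm1 hp hpd
  obtain ⟨k, κ, hk, hκ, HL⟩ := LB d hd hm hm1 hp hpd
  have hm' : 0 < 1 - m := by linarith
  set q := 2 * p - d * (1 - m) with hq
  have hq0 : 0 < q := by rw [hq]; linarith
  set α := 1 / (1 - m) with hα
  have hα0 : 0 < α := by positivity
  set E := 2 * p / q with hEd
  have hdm : (d:ℝ) * (1 - m) = 2 * p - q := by rw [hq]; ring
  have hdq : (d:ℝ) = (2 * p - q) / (1 - m) := by rw [← hdm]; field_simp
  have hE1 : 1 ≤ E := by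
    rw [hEd, one_le_div hq0, hq]
    have : (0:ℝ) ≤ d * (1 - m) := by positivity
    linarith
  set CH : ℝ := 11 ^ d + 2 with hCH
  set h2 := min κ Ce⁻¹ with hh2
  have hh20 : 0 < h2 := lt_min hκ (inv_pos.2 hCe)
  set B := C * (CH ^ E * h2 ^ α + h2 ^ (-(d / q))) with hB
  have hB0 : 0 < B := by positivity
  refine ⟨k ^ (1 / m) * h2 ^ α / B, h2, by positivity, hh20, fun {T Ω u x0 R} s hX a Y Z ha haT hY0 hZ0 hY hZ => ⟨?_, ?_⟩⟩
  · have h1 := HE s hX a Y ha haT hY0 hY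
    calc h2 * Y ^ (1 - m) ≤ Ce⁻¹ * (Ce * ((T - a) / R ^ 2)) := mul_le_mul (min_le_right _ _) h1 (by positivity) (by positivity)
      _ = (T - a) / R ^ 2 := by field_simp
  · intro ε t t' hε hε1 htT ht'T ht1 ht2 ht3 ht4 x hx
    have hR := s.hR
    set τ := h2 * Y ^ (1 - m) with hτ
    have hτ0 : 0 < τ := by positivity
    have hετ : 0 < ε * τ := by positivity
    set H := Y / Z with hH
    have hH0 : 0 < H := by positivity
    have hHC : H ≤ CH := Hbound s ha haT hp hZ0 hY hZ
    have hσ0 : 0 < t / R ^ 2 := hετ.trans ht1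
    have hσ'0 : 0 < t' / R ^ 2 := hετ.trans ht3
    have ht0 : 0 < t := (div_pos_iff_of_pos_right (by positivity)).1 hσ0
    have ht'0 : 0 < t' := (div_pos_iff_of_pos_right (by positivity)).1 hσ'0
    have hU := HU s a t (Z ^ p) ha ht0 htT (by positivity) hZ
    have hτκ : τ ≤ κ * Y ^ (1 - m) := by rw [hτ]; gcongr; exact min_le_left _ _
    have hV := HL s a t' Y Z ha ht'0 ht'T hY0 hZ0 hY hZ (ht4.le.trans hτκ) x hx
    have hτα : τ ^ α = h2 ^ α * Y := by
      rw [hτ, mul_rpow hh20.le (by positivity), ← rpow_mul hY0.le, hα, mul_one_div_cancel hm'.ne', rpow_one]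
    have hxu := s.pos (x := x) (by linarith : 0 < a + t') ht'T (ball_subset_closedBall.trans (closedBall_subset_closedBall (by linarith)) hx)
    -- upper
    have hU1 : u (a + t) x0 ≤ C * (h2 ^ α * Y + ε ^ (-(d / q)) * h2 ^ (-(d / q)) * (H ^ E)⁻¹ * Y) := by
      refine hU.trans ?_
      have e1 : (t / R ^ 2) ^ α ≤ h2 ^ α * Y := by rw [← hτα]; exact rpow_le_rpow hσ0.le ht2.le hα0.le
      have e2 : (t / R ^ 2) ^ (-(d / q)) ≤ (ε * τ) ^ (-(d / q)) := by
        refine rpow_le_rpow_of_nonpos hετ ht1.le ?_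
        rw [neg_nonpos]; positivity
      have e3 : (ε * τ) ^ (-(d / q)) * (Z ^ p) ^ (2 / q) = ε ^ (-(d / q)) * h2 ^ (-(d / q)) * (H ^ E)⁻¹ * Y := by
        refine Real.log_injOn_pos (mem_Ioi.2 (by positivity)) (mem_Ioi.2 (by positivity)) ?_
        rw [Real.log_mul (by positivity) (by positivity), Real.log_rpow hετ, Real.log_rpow (by positivity), Real.log_rpow hZ0, hτ,
          Real.log_mul hε.ne' (by positivity), Real.log_mul hh20.ne' (by positivity), Real.log_rpow hY0,
          Real.log_mul (by positivity) (by positivity), Real.log_mul (by positivity) (by positivity), Real.log_mul (by positivity) (by positivity),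
          Real.log_rpow hε, Real.log_rpow hh20, Real.log_inv, Real.log_rpow hH0, hH, Real.log_div hY0.ne' hZ0.ne', hEd, hdq]
        field_simp; ring
      rw [← e3]
      gcongr
    have hV1 : k ^ (1 / m) * H ^ (1 / m) * (ε ^ α * (h2 ^ α * Y)) ≤ u (a + t') x := by
      have e1 : k * H * (ε * τ) ^ (α * m) ≤ u (a + t') x ^ m := le_trans (by gcongr) hV
      have e2 := rpow_le_rpow (by positivity) e1 (by positivity : 0 ≤ 1 / m)
      rw [← rpow_mul hxu.le, mul_one_div_cancel hm.ne', rpow_one, mul_rpow (by positivity) (by positivity), mul_rpow hk.le hH0.le,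
        ← rpow_mul hετ.le, mul_assoc α, mul_one_div_cancel hm.ne', mul_one, mul_rpow hε.le hτ0.le, hτα] at e2
      exact e2
    refine le_trans ?_ hV1
    have hεE : ε ^ (E / (1 - m)) ≤ ε ^ α := by
      refine rpow_le_rpow_of_exponent_ge hε hε1 ?_
      rw [hα]; gcongr
    have hεE2 : ε ^ (E / (1 - m)) * ε ^ (-(d / q)) = ε ^ α := by
      rw [← rpow_add hε]; congr 1; rw [hEd, hα, hdq]; field_simp; ring
    have hHE : H ^ E ≤ CH ^ E := rpow_le_rpow hH0.le hHC (by linarith)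
    have hHE0 : 0 < H ^ E := by positivity
    have hX1 : ε ^ (E / (1 - m)) * H ^ E * u (a + t) x0 ≤ ε ^ α * Y * B := by
      have e1 := mll hU1 (by positivity : 0 ≤ ε ^ (E / (1 - m)) * H ^ E)
      have e2 : ε ^ (E / (1 - m)) * H ^ E * (C * (h2 ^ α * Y + ε ^ (-(d / q)) * h2 ^ (-(d / q)) * (H ^ E)⁻¹ * Y)) =
          C * Y * h2 ^ α * (ε ^ (E / (1 - m)) * H ^ E) + C * Y * h2 ^ (-(d / q)) * (ε ^ (E / (1 - m)) * ε ^ (-(d / q))) := by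
        field_simp
      rw [e2, hεE2] at e1
      have e3 : C * Y * h2 ^ α * (ε ^ (E / (1 - m)) * H ^ E) ≤ C * Y * h2 ^ α * (ε ^ α * CH ^ E) := by gcongr
      rw [hB]
      linarith
    rw [rpow_add hH0]
    have e4 := mll hX1 (by positivity : 0 ≤ k ^ (1 / m) * h2 ^ α / B * H ^ (1 / m))
    refine le_trans (le_of_eq ?_) (e4.trans (le_of_eq ?_))
    · ring
    · field_simp
end FDE
namespace FDE
theorem contInt {d : ℕ} {T t0 R : ℝ} {Ω : Set (EuclideanSpace ℝ (Fin d))} {u : ℝ → EuclideanSpace ℝ (Fin d) → ℝ}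
    {x0 : EuclideanSpace ℝ (Fin d)} (hc : ContinuousOn (fun q : ℝ × EuclideanSpace ℝ (Fin d) => u q.1 q.2) (Ico 0 T ×ˢ Ω))
    (hB : closedBall x0 R ⊆ Ω) (h0 : 0 ≤ t0) (hT : t0 < T) {φ : ℝ → ℝ} (hφ : Continuous φ) :
    Tendsto (fun a => ∫ y in ball x0 R, φ (u a y)) (𝓝[>] t0) (𝓝 (∫ y in ball x0 R, φ (u t0 y))) := by
  obtain ⟨t1, h1, h2⟩ := exists_between hT
  have hc' : ContinuousOn (fun q : ℝ × EuclideanSpace ℝ (Fin d) => φ (u q.1 q.2)) (Icc t0 t1 ×ˢ closedBall x0 R) :=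
    hφ.comp_continuousOn (hc.mono (prod_mono (fun s hs => ⟨by linarith [hs.1], by linarith [hs.2]⟩) hB))
  obtain ⟨K, hK⟩ := (isCompact_Icc.prod (isCompact_closedBall x0 R)).exists_bound_of_continuousOn hc'
  have hev : ∀ᶠ a in 𝓝[>] t0, a ∈ Icc t0 t1 := by
    filter_upwards [Ioo_mem_nhdsGT h1] with a ha using ⟨ha.1.le, ha.2.le⟩
  refine tendsto_integral_filter_of_dominated_convergence (fun _ => K) ?_ ?_ ?_ ?_
  · filter_upwards [hev] with a ha
    refine ContinuousOn.aestronglyMeasurable ?_ measurableSet_ball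
    exact hc'.comp (f := fun x => (a, x)) (by fun_prop) fun x hx => ⟨ha, ball_subset_closedBall hx⟩
  · filter_upwards [hev] with a ha
    refine (ae_restrict_iff' measurableSet_ball).2 (Eventually.of_forall fun x hx => ?_)
    exact hK (a, x) ⟨ha, ball_subset_closedBall hx⟩
  · exact integrableOn_const (measure_ball_lt_top.ne)
  · refine (ae_restrict_iff' measurableSet_ball).2 (Eventually.of_forall fun x hx => ?_)
    have h3 : ContinuousWithinAt (fun a => φ (u a x)) (Icc t0 t1) t0 :=
      (hc'.comp (f := fun a => (a, x)) (s := Icc t0 t1) (by fun_prop) fun a ha => ⟨ha, ball_subset_closedBall hx⟩) t0 ⟨le_rfl, h1.le⟩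
    exact h3.tendsto.mono_left (le_inf nhdsWithin_le_nhds (le_principal_iff.2 hev))
theorem posInt {d : ℕ} {R p : ℝ} {f : EuclideanSpace ℝ (Fin d) → ℝ} {x0 : EuclideanSpace ℝ (Fin d)} (hp : 1 ≤ p)
    (hc : ContinuousOn f (closedBall x0 R)) (hf : ∀ x ∈ closedBall x0 R, 0 ≤ f x) (hM : 0 < ∫ x in ball x0 R, f x) :
    0 < ∫ x in ball x0 R, f x ^ p := by
  have hcp : ContinuousOn (fun x => f x ^ p) (closedBall x0 R) := hc.rpow_const fun x _ => Or.inr (by linarith)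
  have hi : IntegrableOn (fun x => f x ^ p) (ball x0 R) :=
    (hcp.integrableOn_compact (isCompact_closedBall x0 R)).mono_set ball_subset_closedBall
  have h0 : 0 ≤ᵐ[volume.restrict (ball x0 R)] fun x => f x ^ p :=
    (ae_restrict_iff' measurableSet_ball).2 (Eventually.of_forall fun x hx => rpow_nonneg (hf x (ball_subset_closedBall hx)) _)
  refine lt_of_le_of_ne (integral_nonneg_of_ae h0) fun h => ?_
  have h1 := (setIntegral_eq_zero_iff_of_nonneg_ae h0 hi).1 h.symm
  have h2 : ∫ x in ball x0 R, f x = 0 := by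
    refine integral_eq_zero_of_ae ?_
    filter_upwards [h1, ae_restrict_mem measurableSet_ball] with x hx hxb
    exact ((rpow_eq_zero_iff_of_nonneg (hf x (ball_subset_closedBall hxb))).1 hx).1
  linarith
theorem id1 {R M D m : ℝ} (hR : 0 < R) (hM : 0 < M) : R ^ (2 - D * (1 - m)) * M ^ (1 - m) = R ^ 2 * (M / R ^ D) ^ (1 - m) := by
  rw [div_rpow hM.le (by positivity), ← rpow_mul hR.le, rpow_sub hR, rpow_two]
  ring
theorem id2 {R M P D p : ℝ} (hR : 0 < R) (hP : 0 < P) : M * R ^ (D / p) / (P ^ (1 / p) * R ^ D) = (M / R ^ D) / (P / R ^ D) ^ (1 / p) := by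
  rw [div_rpow hP.le (by positivity), ← rpow_mul hR.le, mul_one_div]
  have : 0 < R ^ (D / p) := by positivity
  have : 0 < R ^ D := by positivity
  have : 0 < P ^ (1 / p) := by positivity
  field_simp
theorem fin (d : ℕ) (hd : 3 ≤ d) {m p : ℝ} (hm : 0 < m) (hm1 : m < 1) (hp : 1 ≤ p) (hpd : d * (1 - m) < 2 * p) :
    ∃ h1 h2 : ℝ, 0 < h1 ∧ 0 < h2 ∧ ∀ {T : ℝ} {Ω : Set (EuclideanSpace ℝ (Fin d))} {u : ℝ → EuclideanSpace ℝ (Fin d) → ℝ}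
      {x0 : EuclideanSpace ℝ (Fin d)} {R : ℝ}, Setup m T Ω u x0 R → ExtinctAt T Ω u →
      ContinuousOn (fun q : ℝ × EuclideanSpace ℝ (Fin d) => u q.1 q.2) (Ico 0 T ×ˢ Ω) → (∀ x ∈ Ω, 0 ≤ u 0 x) →
      ∀ t0, 0 ≤ t0 → t0 < T → ∀ M P : ℝ, 0 < M → (∫ y in ball x0 R, u t0 y) = M → (∫ y in ball x0 R, u t0 y ^ p) = P → 0 < P ∧
      t0 + h2 * (R ^ 2 * (M / R ^ (d:ℝ)) ^ (1 - m)) ≤ T ∧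
      ∀ ε t t', 0 < ε → ε ≤ 1 → t0 + ε * (h2 * (R ^ 2 * (M / R ^ (d:ℝ)) ^ (1 - m))) < t → t < t0 + h2 * (R ^ 2 * (M / R ^ (d:ℝ)) ^ (1 - m)) →
        t0 + ε * (h2 * (R ^ 2 * (M / R ^ (d:ℝ)) ^ (1 - m))) < t' → t' < t0 + h2 * (R ^ 2 * (M / R ^ (d:ℝ)) ^ (1 - m)) →
        ∀ x ∈ ball x0 R, (h1 * ε ^ (2 * p / (2 * p - d * (1 - m)) / (1 - m)) *
          ((M / R ^ (d:ℝ)) / (P / R ^ (d:ℝ)) ^ (1 / p)) ^ (2 * p / (2 * p - d * (1 - m)) + 1 / m)) * u t x0 ≤ u t' x := by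
  obtain ⟨h1, h2, hh1, hh2, H⟩ := coreH d hd hm hm1 hp hpd
  refine ⟨h1, h2, hh1, hh2, fun {T Ω u x0 R} s hext hc hu0 t0 ht0 htT M P hM hMe hPe => ?_⟩
  have hR := s.hR
  have hB : closedBall x0 R ⊆ Ω := (closedBall_subset_closedBall (by linarith)).trans s.hB
  have hpos : ∀ x ∈ closedBall x0 R, 0 ≤ u t0 x := by
    intro x hx
    rcases ht0.eq_or_lt with h | h
    · rw [← h]; exact hu0 x (hB hx)
    · exact (s.pos h htT (closedBall_subset_closedBall (by linarith) hx)).le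
  have hct : ContinuousOn (u t0) (closedBall x0 R) :=
    hc.comp (f := fun x => (t0, x)) (by fun_prop) fun x hx => ⟨⟨ht0, htT⟩, hB hx⟩
  have hP : 0 < P := hPe ▸ posInt hp hct hpos (hMe ▸ hM)
  have hRd : 0 < R ^ (d:ℝ) := by positivity
  have hRdn : R ^ (d:ℝ) = R ^ d := rpow_natCast R d
  have tM : Tendsto (fun a => (∫ y in ball x0 R, u a y) / R ^ (d:ℝ)) (𝓝[>] t0) (𝓝 (M / R ^ (d:ℝ))) := by
    have := (contInt hc hB ht0 htT continuous_id).div_const (R ^ (d:ℝ))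
    simpa only [id, hMe] using this
  have tP : Tendsto (fun a => ((∫ y in ball x0 R, u a y ^ p) / R ^ (d:ℝ)) ^ (1 / p)) (𝓝[>] t0) (𝓝 ((P / R ^ (d:ℝ)) ^ (1 / p))) := by
    have h := (contInt hc hB ht0 htT (φ := fun z => z ^ p) (continuous_rpow_const (by linarith))).div_const (R ^ (d:ℝ))
    rw [hPe] at h
    exact h.rpow_const (Or.inl (by positivity))
  have hY : 0 < M / R ^ (d:ℝ) := by positivity
  have hZ : 0 < (P / R ^ (d:ℝ)) ^ (1 / p) := by positivity
  have tY : Tendsto (fun a => h2 * ((∫ y in ball x0 R, u a y) / R ^ (d:ℝ)) ^ (1 - m)) (𝓝[>] t0) (𝓝 (h2 * (M / R ^ (d:ℝ)) ^ (1 - m))) :=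
    (tM.rpow_const (Or.inl hY.ne')).const_mul _
  have tid : Tendsto (fun a : ℝ => a) (𝓝[>] t0) (𝓝 t0) := tendsto_id.mono_left nhdsWithin_le_nhds
  have evH : ∀ᶠ a in 𝓝[>] t0, t0 < a ∧ a < T ∧ 0 < (∫ y in ball x0 R, u a y) / R ^ (d:ℝ) ∧
      0 < ((∫ y in ball x0 R, u a y ^ p) / R ^ (d:ℝ)) ^ (1 / p) ∧ 
      (∫ y in ball x0 R, u a y ^ p) / R ^ d = (((∫ y in ball x0 R, u a y ^ p) / R ^ (d:ℝ)) ^ (1 / p)) ^ p := by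
    filter_upwards [Ioo_mem_nhdsGT htT, tM.eventually_const_lt hY, tP.eventually_const_lt hZ] with a ha hya hza
    refine ⟨ha.1, ha.2, hya, hza, ?_⟩
    have h5 : 0 ≤ (∫ y in ball x0 R, u a y ^ p) := by
      refine setIntegral_nonneg measurableSet_ball fun y hy => rpow_nonneg (s.pos (by linarith [ha.1]) ha.2 ?_).le _
      exact closedBall_subset_closedBall (by linarith) (ball_subset_closedBall hy)
    rw [one_div, rpow_inv_rpow (by positivity) (by linarith), hRdn]
  have hR2 : 0 < R ^ 2 := by positivity
  have first : h2 * (M / R ^ (d:ℝ)) ^ (1 - m) ≤ (T - t0) / R ^ 2 := by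
    refine le_of_tendsto_of_tendsto tY ((tid.const_sub T).div_const (R ^ 2)) ?_
    filter_upwards [evH] with a ha
    exact (H s hext a _ _ (by linarith) ha.2.1 ha.2.2.1 ha.2.2.2.1 (by rw [hRdn]) ha.2.2.2.2).1
  have first' : t0 + h2 * (R ^ 2 * (M / R ^ (d:ℝ)) ^ (1 - m)) ≤ T := by
    rw [le_div_iff₀ hR2] at first
    linarith
  refine ⟨hP, first', fun ε t t' hε hε1 a1 a2 b1 b2 x hx => ?_⟩
  have key : ∀ {r : ℝ}, t0 + ε * (h2 * (R ^ 2 * (M / R ^ (d:ℝ)) ^ (1 - m))) < r → r < t0 + h2 * (R ^ 2 * (M / R ^ (d:ℝ)) ^ (1 - m)) →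
      ∀ᶠ a in 𝓝[>] t0, ε * (h2 * ((∫ y in ball x0 R, u a y) / R ^ (d:ℝ)) ^ (1 - m)) < (r - a) / R ^ 2 ∧
        (r - a) / R ^ 2 < h2 * ((∫ y in ball x0 R, u a y) / R ^ (d:ℝ)) ^ (1 - m) := by
    intro r r1 r2
    refine ((tY.const_mul ε).eventually_lt ((tid.const_sub r).div_const (R ^ 2)) ?_).and
      (((tid.const_sub r).div_const (R ^ 2)).eventually_lt tY ?_)
    · rw [lt_div_iff₀ hR2]; linarith
    · rw [div_lt_iff₀ hR2]; linarith
  have tL : Tendsto (fun a => (h1 * ε ^ (2 * p / (2 * p - d * (1 - m)) / (1 - m)) *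
          (((∫ y in ball x0 R, u a y) / R ^ (d:ℝ)) / ((∫ y in ball x0 R, u a y ^ p) / R ^ (d:ℝ)) ^ (1 / p)) ^ (2 * p / (2 * p - d * (1 - m)) + 1 / m)) * u t x0)
      (𝓝[>] t0) (𝓝 ((h1 * ε ^ (2 * p / (2 * p - d * (1 - m)) / (1 - m)) *
          ((M / R ^ (d:ℝ)) / (P / R ^ (d:ℝ)) ^ (1 / p)) ^ (2 * p / (2 * p - d * (1 - m)) + 1 / m)) * u t x0)) :=
    (((tM.div tP hZ.ne').rpow_const (Or.inl (div_pos hY hZ).ne')).const_mul _).mul_const _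
  refine le_of_tendsto tL ?_
  filter_upwards [evH, key a1 a2, key b1 b2] with a ha k1 k2
  have := (H s hext a _ _ (by linarith) ha.2.1 ha.2.2.1 ha.2.2.2.1 (by rw [hRdn]) ha.2.2.2.2).2 ε (t - a) (t' - a) hε hε1
    (by linarith) (by linarith) k1.1 k1.2 k2.1 k2.2 x hx
  simpa only [add_sub_cancel] using this
end FDE
end

/-- **Theorem 5.2: intrinsic Harnack inequality of forward, backward and elliptic
type.** Here `m_c = (d-2)/d`, `p_c = d(1-m)/2`, `ϑ_p = 1/(2p - d(1-m))`, and
`t_*(t₀) = h₂ R^{2-d(1-m)} ‖u(t₀,·)‖_{L¹(B_R)}^{1-m}`. -/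
theorem intrinsic_harnack
    (d : ℕ) (hd : 3 ≤ d) (m : ℝ) (hm0 : 0 < m) (hm1 : m < 1) (p : ℝ)
    (hp₁ : (d - 2 : ℝ) / d < m → p = 1)
    (hp₂ : m ≤ (d - 2 : ℝ) / d → d * (1 - m) / 2 < p) :
    ∃ h₁ h₂ : ℝ, 0 < h₁ ∧ 0 < h₂ ∧
      ∀ (Ω : Set (EuclideanSpace ℝ (Fin d))), IsOpen Ω →
      ∀ (u : ℝ → EuclideanSpace ℝ (Fin d) → ℝ) (u₀ : EuclideanSpace ℝ (Fin d) → ℝ) (T : ℝ),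
        0 < T →
        IsFDESol m (Ioo 0 T ×ˢ Ω) u →
        (∀ x ∈ Ω, 0 ≤ u₀ x) →
        LocallyIntegrableOn (fun x => u₀ x ^ p) Ω →
        TakesInit T Ω u u₀ →
        ExtinctAt T Ω u →
      ∀ (x₀ : EuclideanSpace ℝ (Fin d)) (R : ℝ), 0 < R →
        closedBall x₀ (6 * R) ⊆ Ω →
      ∀ t₀ : ℝ, 0 ≤ t₀ → t₀ < T →
        0 < ∫ x in ball x₀ R, u t₀ x →
        t₀ + h₂ * R ^ (2 - d * (1 - m)) * (∫ x in ball x₀ R, u t₀ x) ^ (1 - m) ≤ T ∧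
        ∀ ε : ℝ, 0 < ε → ε ≤ 1 →
        ∀ t ϑ : ℝ, 0 ≤ ϑ →
          t₀ + ε * (h₂ * R ^ (2 - d * (1 - m)) * (∫ x in ball x₀ R, u t₀ x) ^ (1 - m))
            < t - ϑ →
          t + ϑ < t₀ + h₂ * R ^ (2 - d * (1 - m)) * (∫ x in ball x₀ R, u t₀ x) ^ (1 - m) →
        ∀ x ∈ ball x₀ R,
          (h₁ * ε ^ (2 * p / (2 * p - d * (1 - m)) / (1 - m)) *
              ((∫ y in ball x₀ R, u t₀ y) * R ^ ((d : ℝ) / p) /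
                ((∫ y in ball x₀ R, u t₀ y ^ p) ^ (1 / p) * R ^ (d : ℝ))) ^
                (2 * p / (2 * p - d * (1 - m)) + 1 / m)) * u t x₀ ≤ u (t + ϑ) x ∧
          (h₁ * ε ^ (2 * p / (2 * p - d * (1 - m)) / (1 - m)) *
              ((∫ y in ball x₀ R, u t₀ y) * R ^ ((d : ℝ) / p) /
                ((∫ y in ball x₀ R, u t₀ y ^ p) ^ (1 / p) * R ^ (d : ℝ))) ^
                (2 * p / (2 * p - d * (1 - m)) + 1 / m)) * u t x₀ ≤ u (t - ϑ) x := by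
  have hd' : (3:ℝ) ≤ d := by exact_mod_cast hd
  have hd0 : (0:ℝ) < d := by linarith
  have hpp : 1 ≤ p ∧ d * (1 - m) < 2 * p := by
    rcases lt_or_ge ((d - 2 : ℝ) / d) m with h | h
    · rw [hp₁ h]
      rw [div_lt_iff₀ hd0] at h
      exact ⟨le_rfl, by linarith⟩
    · have := hp₂ h
      rw [le_div_iff₀ hd0] at h
      exact ⟨by linarith, by linarith⟩
  obtain ⟨h₁, h₂, k₁, k₂, H⟩ := FDE.fin d hd hm0 hm1 hpp.1 hpp.2
  refine ⟨h₁, h₂, k₁, k₂, fun Ω hΩ u u₀ T hT hsol hu₀ _ hinit hext x₀ R hR hB t₀ ht₀ htT hM => ?_⟩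
  obtain ⟨hP, hA, hC⟩ := H ⟨hΩ, hsol, hR, hB⟩ hext hinit.1 (fun x hx => by rw [hinit.2 x hx]; exact hu₀ x hx) t₀ ht₀ htT _ _ hM rfl rfl
  rw [mul_assoc, FDE.id1 hR hM, FDE.id2 hR hP]
  refine ⟨hA, fun ε hε hε1 t ϑ hϑ a b x hx => ⟨?_, ?_⟩⟩
  · exact hC ε t (t + ϑ) hε hε1 (by linarith) (by linarith) (by linarith) b x hx
  · exact hC ε t (t - ϑ) hε hε1 (by linarith) (by linarith) a (by linarith) x hx
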